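/- For every graph property P, the closure of the upward closure equals the upward closure of the closure: (P↑)‾ = (P̄)↑. -/

import Mathlib

open MeasureTheory Filter Topology
open scoped ENNReal

noncomputable section

/-- The unit interval `[0,1]` as a subset of `ℝ`. -/
def I01 : Set ℝ := Set.Icc 0 1

/-- `W₀`: symmetric measurable functions `[0,1]² → [0,1]`
(represented as functions `ℝ → ℝ → ℝ`, with the relevant values on `[0,1]²`). -/
def IsGraphon (W : ℝ → ℝ → ℝ) : Prop :=
  Measurable (Function.uncurry W) ∧ (∀ x y, W x y = W y x) ∧
    ∀ x y, W x y ∈ Set.Icc (0 : ℝ) 1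

/-- The `L¹` norm of a kernel on `[0,1]²`. -/
def l1Norm (W : ℝ → ℝ → ℝ) : ℝ :=
  ∫ x in I01, ∫ y in I01, |W x y|

/-- The cut norm of a kernel on `[0,1]²`. -/
def cutNorm (W : ℝ → ℝ → ℝ) : ℝ :=
  sSup { r : ℝ | ∃ S T : Set ℝ, MeasurableSet S ∧ MeasurableSet T ∧ S ⊆ I01 ∧ T ⊆ I01 ∧
    r = |∫ x in S, ∫ y in T, W x y| }

/-- An invertible measure preserving map of `[0,1]`. -/
structure InvMP where
  toFun : ℝ → ℝ
  invFun : ℝ → ℝ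
  maps : ∀ x ∈ I01, toFun x ∈ I01
  mapsInv : ∀ x ∈ I01, invFun x ∈ I01
  measurePreserving :
    MeasurePreserving toFun (volume.restrict I01) (volume.restrict I01)
  measurePreservingInv :
    MeasurePreserving invFun (volume.restrict I01) (volume.restrict I01)
  leftInv : ∀ x ∈ I01, invFun (toFun x) = x
  rightInv : ∀ x ∈ I01, toFun (invFun x) = x

/-- `δ_□`: the cut distance, infimum of the cut norm over invertible measure
preserving transformations of `[0,1]`. -/
def deltaCut (U W : ℝ → ℝ → ℝ) : ℝ :=
  ⨅ φ : InvMP, cutNorm (fun x y => U x y - W (φ.toFun x) (φ.toFun y))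

/-- `δ₁`: the `L¹` distance minimized over invertible measure preserving
transformations of `[0,1]`. -/
def delta1 (U W : ℝ → ℝ → ℝ) : ℝ :=
  ⨅ φ : InvMP, l1Norm (fun x y => U x y - W (φ.toFun x) (φ.toFun y))



/-- A graph property: for each `n`, a set of simple graphs on `Fin n`. -/
def GraphProp := ∀ n : ℕ, Set (SimpleGraph (Fin n))

/-- Invariance under isomorphism (isomorphic graphs necessarily have the same
number of vertices). -/
def IsGraphProperty (P : GraphProp) : Prop :=
  ∀ (n : ℕ) (G H : SimpleGraph (Fin n)), Nonempty (G ≃g H) → (G ∈ P n ↔ H ∈ P n)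

/-- The normalized edit distance between graphs on a common vertex set. -/
def graphD1 {n : ℕ} (G H : SimpleGraph (Fin n)) : ℝ :=
  (symmDiff G.edgeSet H.edgeSet).ncard / (n ^ 2 : ℝ)

/-- The edit distance from a graph to a graph property (∞ if the property
contains no graph on the same number of nodes). -/
def graphD1P {n : ℕ} (G : SimpleGraph (Fin n)) (P : GraphProp) : ℝ≥0∞ :=
  ⨅ (H : SimpleGraph (Fin n)) (_ : H ∈ P n), ENNReal.ofReal (graphD1 G H)

open Classical in
/-- The step function `W_G` associated with a graph `G` on `{1,…,n}`:
its value on `((i−1)/n, i/n] × ((j−1)/n, j/n]` is `1` iff `ij ∈ E(G)`. -/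
def graphonOf {n : ℕ} (G : SimpleGraph (Fin n)) : ℝ → ℝ → ℝ := fun x y =>
  if ∃ i j : Fin n, G.Adj i j ∧ x ∈ Set.Ioc (((i : ℕ) : ℝ) / n) ((((i : ℕ) : ℝ) + 1) / n)
      ∧ y ∈ Set.Ioc (((j : ℕ) : ℝ) / n) ((((j : ℕ) : ℝ) + 1) / n)
  then 1 else 0

/-- `H` is (isomorphic to) an induced subgraph of `G`. -/
def IsInducedSubgraph {n k : ℕ} (G : SimpleGraph (Fin n)) (H : SimpleGraph (Fin k)) : Prop :=
  ∃ f : Fin k ↪ Fin n, ∀ i j, H.Adj i j ↔ G.Adj (f i) (f j)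

/-- The subgraph of `G` induced on the vertex subset `S` has property `P`
(as a graph on `k = |S|` nodes). -/
def inducedMem {n : ℕ} (G : SimpleGraph (Fin n)) (S : Finset (Fin n)) (k : ℕ)
    (P : GraphProp) : Prop :=
  ∃ H : SimpleGraph (Fin k), H ∈ P k ∧
    ∃ f : Fin k ↪ Fin n, (∀ i, f i ∈ S) ∧ ∀ i j, H.Adj i j ↔ G.Adj (f i) (f j)

/-- The number of `k`-element vertex subsets of `G` inducing a subgraph with property `P`. -/
def goodCount {n : ℕ} (G : SimpleGraph (Fin n)) (k : ℕ) (P : GraphProp) : ℕ :=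
  {S : Finset (Fin n) | S.card = k ∧ inducedMem G S k P}.ncard

/-- Testability of a graph property (Definition 1.1 of the paper). -/
def GraphTestable (P : GraphProp) : Prop :=
  ∃ P' : GraphProp, IsGraphProperty P' ∧
    (∀ (n : ℕ) (G : SimpleGraph (Fin n)), G ∈ P n → ∀ k, 1 ≤ k → k ≤ n →
      2 * n.choose k ≤ 3 * goodCount G k P') ∧
    (∀ ε : ℝ, 0 < ε → ∃ kε : ℕ, 1 ≤ kε ∧
      ∀ (n : ℕ) (G : SimpleGraph (Fin n)) (k : ℕ), kε ≤ k → k ≤ n →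
        ENNReal.ofReal ε ≤ graphD1P G P →
        3 * goodCount G k P' ≤ n.choose k)

def cube (k : ℕ) : Set (Fin k → ℝ) := Set.univ.pi fun _ => I01

open Classical in
/-- The homomorphism density `t(F,W)`. -/
def homDensity {k : ℕ} (F : SimpleGraph (Fin k)) (W : ℝ → ℝ → ℝ) : ℝ :=
  ∫ x in cube k, ∏ i : Fin k, ∏ j : Fin k,
    if i < j ∧ F.Adj i j then W (x i) (x j) else 1

open Classical in
/-- The induced density `t_ind(F,W)`. -/
def indDensity {k : ℕ} (F : SimpleGraph (Fin k)) (W : ℝ → ℝ → ℝ) : ℝ :=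
  ∫ x in cube k, ∏ i : Fin k, ∏ j : Fin k,
    if i < j then (if F.Adj i j then W (x i) (x j) else 1 - W (x i) (x j)) else 1

/-- Isomorphism of functions in `W₀`: equality of all homomorphism densities. -/
def GraphonIso (U W : ℝ → ℝ → ℝ) : Prop :=
  ∀ (k : ℕ) (F : SimpleGraph (Fin k)), homDensity F U = homDensity F W

open Classical in
/-- `P(G(k,W) ∈ R')`, the probability that the `W`-random graph on `k` nodes
has property `R'`. -/
def probIn (k : ℕ) (W : ℝ → ℝ → ℝ) (R' : GraphProp) : ℝ :=
  ∑ F : SimpleGraph (Fin k), if F ∈ R' k then indDensity F W else 0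

/-- The `L¹` distance from `W` to a set `R` of kernels, with value `∞` for `R = ∅`. -/
def d1SetE (W : ℝ → ℝ → ℝ) (R : Set (ℝ → ℝ → ℝ)) : ℝ≥0∞ :=
  ⨅ (U : ℝ → ℝ → ℝ) (_ : U ∈ R), ENNReal.ofReal (l1Norm fun x y => W x y - U x y)

/-- The cut-norm distance from `W` to a set `R` of kernels, with value `∞` for `R = ∅`. -/
def dCutSetE (W : ℝ → ℝ → ℝ) (R : Set (ℝ → ℝ → ℝ)) : ℝ≥0∞ :=
  ⨅ (U : ℝ → ℝ → ℝ) (_ : U ∈ R), ENNReal.ofReal (cutNorm fun x y => W x y - U x y)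

/-- The open ball `B₁(R,c)` (within `W₀`). -/
def ball1 (R : Set (ℝ → ℝ → ℝ)) (c : ℝ) : Set (ℝ → ℝ → ℝ) :=
  {W | IsGraphon W ∧ d1SetE W R < ENNReal.ofReal c}

/-- The open ball `B_□(R,c)` (within `W₀`). -/
def ballCut (R : Set (ℝ → ℝ → ℝ)) (c : ℝ) : Set (ℝ → ℝ → ℝ) :=
  {W | IsGraphon W ∧ dCutSetE W R < ENNReal.ofReal c}

/-- A graphon property: a set of graphons invariant under isomorphism. -/
def IsGraphonProperty (R : Set (ℝ → ℝ → ℝ)) : Prop :=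
  (∀ W ∈ R, IsGraphon W) ∧
    ∀ U W, IsGraphon U → IsGraphon W → GraphonIso U W → (U ∈ R ↔ W ∈ R)

/-- A set of graphons is closed if it is closed in the cut norm. -/
def CutClosed (R : Set (ℝ → ℝ → ℝ)) : Prop :=
  ∀ W, IsGraphon W →
    (∀ ε : ℝ, 0 < ε → ∃ U ∈ R, cutNorm (fun x y => W x y - U x y) < ε) → W ∈ R

/-- Testability of a graphon property. -/
def GraphonTestable (R : Set (ℝ → ℝ → ℝ)) : Prop :=
  ∃ R' : GraphProp, IsGraphProperty R' ∧
    (∀ W ∈ R, ∀ k : ℕ, 1 ≤ k → (2 : ℝ) / 3 ≤ probIn k W R') ∧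
    (∀ ε : ℝ, 0 < ε → ∃ kε : ℕ, 1 ≤ kε ∧ ∀ k, kε ≤ k → ∀ W, IsGraphon W →
      ENNReal.ofReal ε ≤ d1SetE W R → probIn k W R' ≤ 1 / 3)

/-- The closure `P̄` of a graph property: limits of convergent sequences
of graphs in `P` with sizes tending to infinity. -/
def closureP (P : GraphProp) : Set (ℝ → ℝ → ℝ) :=
  {W | IsGraphon W ∧ ∃ (n : ℕ → ℕ) (G : ∀ m, SimpleGraph (Fin (n m))),
    (∀ m, G m ∈ P (n m)) ∧ Tendsto n atTop atTop ∧
    Tendsto (fun m => deltaCut (graphonOf (G m)) W) atTop (nhds 0)}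

/-- A graph property is robust if graphs whose `W_G` is `d₁`-close to `P̄`
are themselves close to `P` in edit distance. -/
def Robust (P : GraphProp) : Prop :=
  ∀ ε : ℝ, 0 < ε → ∃ (N : ℕ) (ε' : ℝ), 1 ≤ N ∧ 0 < ε' ∧
    ∀ (n : ℕ), N ≤ n → ∀ G : SimpleGraph (Fin n),
      d1SetE (graphonOf G) (closureP P) ≤ ENNReal.ofReal ε' →
      graphD1P G P ≤ ENNReal.ofReal ε

/-- A hereditary graph property: closed under induced subgraphs. -/
def Hereditary (P : GraphProp) : Prop :=
  ∀ (n : ℕ) (G : SimpleGraph (Fin n)), G ∈ P n →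
    ∀ (k : ℕ) (H : SimpleGraph (Fin k)), IsInducedSubgraph G H → H ∈ P k

/-- `U` is a flexing of `W`: `U ∈ W₀` agrees with `W` wherever `W` takes value `0` or `1`. -/
def Flexing (U W : ℝ → ℝ → ℝ) : Prop :=
  IsGraphon U ∧ ∀ x y, (W x y = 0 ∨ W x y = 1) → U x y = W x y

/-- A function property is flexible if it is preserved under flexing. -/
def FlexibleFamily (R : Set (ℝ → ℝ → ℝ)) : Prop :=
  ∀ W ∈ R, ∀ U, Flexing U W → U ∈ R

/-- `U' ≤ W'` almost everywhere on `[0,1]²`. -/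
def aeLE (U W : ℝ → ℝ → ℝ) : Prop :=
  ∀ᵐ p ∂(volume.restrict (I01 ×ˢ I01)), U p.1 p.2 ≤ W p.1 p.2

/-- `U ⪯ W`: up to isomorphism, `U ≤ W` almost everywhere. -/
def graphonLE (U W : ℝ → ℝ → ℝ) : Prop :=
  ∃ U' W', IsGraphon U' ∧ IsGraphon W' ∧ GraphonIso U U' ∧ GraphonIso W W' ∧ aeLE U' W'

/-- The upward closure of a graph property: graphs having a spanning subgraph in `P`. -/
def upP (P : GraphProp) : GraphProp :=
  fun n => {G | ∃ H : SimpleGraph (Fin n), H ∈ P n ∧ H ≤ G}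

/-- The upward closure of a function property. -/
def upR (R : Set (ℝ → ℝ → ℝ)) : Set (ℝ → ℝ → ℝ) :=
  {W | IsGraphon W ∧ ∃ U ∈ R, graphonLE U W}

/-- A stepfunction: constant on the products of a finite measurable partition of `[0,1]`. -/
def IsStepfunction (W : ℝ → ℝ → ℝ) : Prop :=
  ∃ (m : ℕ) (S : Fin m → Set ℝ), (∀ i, MeasurableSet (S i)) ∧
    (⋃ i, S i) = I01 ∧ (∀ i j, i ≠ j → Disjoint (S i) (S j)) ∧
    ∀ i j : Fin m, ∀ x ∈ S i, ∀ x' ∈ S i, ∀ y ∈ S j, ∀ y' ∈ S j, W x y = W x' y'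

open Classical in
/-- A testable graphon functional: its value can be estimated from `W`-random graphs. -/
def TestableFunctional (f : (ℝ → ℝ → ℝ) → ℝ) : Prop :=
  ∃ g : ∀ n : ℕ, SimpleGraph (Fin n) → ℝ,
    (∀ (n : ℕ) (G H : SimpleGraph (Fin n)), Nonempty (G ≃g H) → g n G = g n H) ∧
    ∀ ε : ℝ, 0 < ε → ∃ kε : ℕ, 1 ≤ kε ∧ ∀ k, kε ≤ k → ∀ W, IsGraphon W →
      (∑ F : SimpleGraph (Fin k), if ε < |f W - g k F| then indDensity F W else 0) < 1 / 3



abbrev lam : Measure ℝ := volume.restrict I01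

instance lam_prob : IsProbabilityMeasure lam := ⟨by simp [lam, I01]⟩

theorem measurableSet_I01 : MeasurableSet I01 := measurableSet_Icc

def Nice (D : ℝ → ℝ → ℝ) : Prop :=
  Measurable (Function.uncurry D) ∧ ∃ C, ∀ x y, |D x y| ≤ C

def Unitv (f : ℝ → ℝ) : Prop := Measurable f ∧ ∀ x, f x ∈ Set.Icc (0 : ℝ) 1

def cutLE (D : ℝ → ℝ → ℝ) (ε : ℝ) : Prop :=
  ∀ f g : ℝ → ℝ, Unitv f → Unitv g →
    |∫ z, f z.1 * g z.2 * D z.1 z.2 ∂(lam.prod lam)| ≤ ε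

theorem IsGraphon.nice {W : ℝ → ℝ → ℝ} (h : IsGraphon W) : Nice W :=
  ⟨h.1, 1, fun x y => abs_le.2 ⟨by linarith [(h.2.2 x y).1], (h.2.2 x y).2⟩⟩

theorem Nice.sub {U V : ℝ → ℝ → ℝ} (hU : Nice U) (hV : Nice V) :
    Nice (fun x y => U x y - V x y) := by
  obtain ⟨h1, C1, c1⟩ := hU
  obtain ⟨h2, C2, c2⟩ := hV
  exact ⟨h1.sub h2, C1 + C2, fun x y => (abs_sub _ _).trans (add_le_add (c1 x y) (c2 x y))⟩

theorem Nice.mul {U V : ℝ → ℝ → ℝ} (hU : Nice U) (hV : Nice V) :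
    Nice (fun x y => U x y * V x y) := by
  obtain ⟨h1, C1, c1⟩ := hU
  obtain ⟨h2, C2, c2⟩ := hV
  refine ⟨h1.mul h2, C1 * C2, fun x y => ?_⟩
  rw [abs_mul]
  exact mul_le_mul (c1 x y) (c2 x y) (abs_nonneg _) ((abs_nonneg _).trans (c1 x y))

theorem Nice.comp {U : ℝ → ℝ → ℝ} (hU : Nice U) {φ ψ : ℝ → ℝ} (hφ : Measurable φ)
    (hψ : Measurable ψ) : Nice (fun x y => U (φ x) (ψ y)) := by
  obtain ⟨h1, C1, c1⟩ := hU
  exact ⟨h1.comp (f := fun z : ℝ × ℝ => (φ z.1, ψ z.2)) (by fun_prop), C1, fun x y => c1 _ _⟩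

theorem Nice.integrable {D : ℝ → ℝ → ℝ} (hD : Nice D) (μ : Measure (ℝ × ℝ)) [IsFiniteMeasure μ] :
    Integrable (fun z : ℝ × ℝ => D z.1 z.2) μ := by
  obtain ⟨h, C, c⟩ := hD
  exact Integrable.of_bound (C := C) (h.aestronglyMeasurable) (ae_of_all _ fun z => by
    simpa using c z.1 z.2)

theorem Unitv.nice_mul {f g : ℝ → ℝ} (hf : Unitv f) (hg : Unitv g) :
    Nice (fun x y => f x * g y) := by
  refine ⟨(hf.1.comp measurable_fst).mul (hg.1.comp measurable_snd), 1, fun x y => ?_⟩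
  rw [abs_mul, abs_of_nonneg (hf.2 x).1, abs_of_nonneg (hg.2 y).1]
  exact mul_le_one₀ (hf.2 x).2 (hg.2 y).1 (hg.2 y).2

theorem Nice.integrable_test {D : ℝ → ℝ → ℝ} (hD : Nice D) {f g : ℝ → ℝ} (hf : Unitv f)
    (hg : Unitv g) (μ : Measure (ℝ × ℝ)) [IsFiniteMeasure μ] :
    Integrable (fun z : ℝ × ℝ => f z.1 * g z.2 * D z.1 z.2) μ :=
  ((hf.nice_mul hg).mul hD).integrable μ

theorem Unitv.indicator {S : Set ℝ} (hS : MeasurableSet S) : Unitv (S.indicator fun _ => 1) :=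
  ⟨measurable_const.indicator hS, fun x => by
    by_cases h : x ∈ S <;> simp [h]⟩

theorem abs_integral_mul_le {μ : Measure ℝ} {h f : ℝ → ℝ} {ε : ℝ} (hm : Measurable h)
    (hi : Integrable h μ) (hf : Unitv f)
    (H : ∀ S, MeasurableSet S → |∫ x in S, h x ∂μ| ≤ ε) : |∫ x, f x * h x ∂μ| ≤ ε := by
  have hfh : Integrable (fun x => f x * h x) μ := by
    refine hi.bdd_mul (c := 1) hf.1.aestronglyMeasurable (ae_of_all _ fun x => ?_)
    rw [Real.norm_eq_abs, abs_of_nonneg (hf.2 x).1]; exact (hf.2 x).2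
  have m1 : MeasurableSet {x | 0 ≤ h x} := measurableSet_le measurable_const hm
  have m2 : MeasurableSet {x | h x ≤ 0} := measurableSet_le hm measurable_const
  have h1 : ∫ x, f x * h x ∂μ ≤ ∫ x in {x | 0 ≤ h x}, h x ∂μ := by
    rw [← integral_indicator m1]
    refine integral_mono hfh (hi.indicator m1) fun x => ?_
    have := hf.2 x
    simp only [Set.indicator, Set.mem_ofPred_eq]
    split_ifs with hx
    · nlinarith [this.1, this.2]
    · push Not at hx; nlinarith [this.1, this.2]
  have h2 : ∫ x in {x | h x ≤ 0}, h x ∂μ ≤ ∫ x, f x * h x ∂μ := by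
    rw [← integral_indicator m2]
    refine integral_mono (hi.indicator m2) hfh fun x => ?_
    have := hf.2 x
    simp only [Set.indicator, Set.mem_ofPred_eq]
    split_ifs with hx
    · nlinarith [this.1, this.2]
    · push Not at hx; nlinarith [this.1, this.2]
  have := H _ m1
  have := H _ m2
  rw [abs_le] at *
  constructor <;> linarith

theorem restrict_sub {S : Set ℝ} (h : S ⊆ I01) : volume.restrict S = lam.restrict S := by
  rw [lam, Measure.restrict_restrict_of_subset h]

theorem iter_eq {D : ℝ → ℝ → ℝ} (hD : Nice D) {S T : Set ℝ} :
    ∫ x in S, ∫ y in T, D x y ∂lam ∂lam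
      = ∫ z in S ×ˢ T, D z.1 z.2 ∂(lam.prod lam) := by
  rw [← Measure.prod_restrict, integral_prod]
  exact hD.integrable _

theorem cutSet_bdd {D : ℝ → ℝ → ℝ} (hD : Nice D) : BddAbove { r : ℝ | ∃ S T : Set ℝ,
    MeasurableSet S ∧ MeasurableSet T ∧ S ⊆ I01 ∧ T ⊆ I01 ∧
    r = |∫ x in S, ∫ y in T, D x y| } := by
  refine ⟨∫ z, |D z.1 z.2| ∂(lam.prod lam), ?_⟩
  rintro r ⟨S, T, hS, hT, h1, h2, rfl⟩
  rw [restrict_sub h1, restrict_sub h2, iter_eq hD]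
  refine (abs_integral_le_integral_abs).trans ?_
  exact setIntegral_le_integral (hD.integrable _).abs (ae_of_all _ fun z => abs_nonneg _)

theorem cutLE_of_cutNorm {D : ℝ → ℝ → ℝ} (hD : Nice D) {ε : ℝ} (h : cutNorm D ≤ ε) :
    cutLE D ε := by
  have key : ∀ S T, MeasurableSet S → MeasurableSet T →
      |∫ z in S ×ˢ T, D z.1 z.2 ∂(lam.prod lam)| ≤ ε := by
    intro S T hS hT
    refine le_trans ?_ h
    refine le_csSup (cutSet_bdd hD) ⟨S ∩ I01, T ∩ I01, hS.inter measurableSet_I01,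
      hT.inter measurableSet_I01, Set.inter_subset_right, Set.inter_subset_right, ?_⟩
    rw [restrict_sub Set.inter_subset_right, restrict_sub Set.inter_subset_right, iter_eq hD]
    congr 1
    rw [← Measure.prod_restrict, ← Measure.prod_restrict, lam,
      Measure.restrict_restrict hS, Measure.restrict_restrict hT,
      Measure.restrict_restrict (hS.inter measurableSet_I01),
      Measure.restrict_restrict (hT.inter measurableSet_I01), Set.inter_assoc, Set.inter_self,
      Set.inter_assoc, Set.inter_self]
  intro f g hf hg
  have hgD : Nice (fun x y => g y * D x y) := by
    have := ((Unitv.indicator (S := Set.univ) MeasurableSet.univ).nice_mul hg).mul hD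
    simpa using this
  have e1 : ∫ z, f z.1 * g z.2 * D z.1 z.2 ∂(lam.prod lam)
      = ∫ x, f x * ∫ y, g y * D x y ∂lam ∂lam := by
    rw [integral_prod _ (hD.integrable_test hf hg _)]
    congr 1; ext x
    rw [← integral_const_mul]
    congr 1; ext y; ring
  rw [e1]
  have meas : Measurable (fun x => ∫ y, g y * D x y ∂lam) :=
    (hgD.1.stronglyMeasurable.integral_prod_right' (ν := lam)).measurable
  refine abs_integral_mul_le meas ?_ hf ?_
  · exact (hgD.integrable (lam.prod lam)).integral_prod_left
  intro S hS
  have e2 : ∫ x in S, ∫ y, g y * D x y ∂lam ∂lam = ∫ y, g y * ∫ x in S, D x y ∂lam ∂lam := by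
    rw [integral_integral_swap]
    · congr 1; ext y; rw [integral_const_mul]
    · exact hgD.integrable _
  rw [e2]
  have hD' : Nice (fun x y => D y x) := ⟨hD.1.comp measurable_swap, hD.2.imp fun C c x y => c y x⟩
  refine abs_integral_mul_le
    (hD'.1.stronglyMeasurable.integral_prod_right' (ν := lam.restrict S)).measurable ?_ hg ?_
  · exact (hD'.integrable (lam.prod (lam.restrict S))).integral_prod_left
  intro T hT
  rw [integral_integral_swap, iter_eq hD]
  · exact key S T hS hT
  · exact hD'.integrable _

theorem cutNorm_le {D : ℝ → ℝ → ℝ} (hD : Nice D) {ε : ℝ} (h : cutLE D ε) :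
    cutNorm D ≤ ε := by
  refine csSup_le ⟨_, ∅, ∅, MeasurableSet.empty, MeasurableSet.empty, by simp, by simp, rfl⟩ ?_
  rintro r ⟨S, T, hS, hT, h1, h2, rfl⟩
  rw [restrict_sub h1, restrict_sub h2, iter_eq hD]
  refine le_trans (le_of_eq ?_) (h _ _ (Unitv.indicator hS) (Unitv.indicator hT))
  rw [← integral_indicator (hS.prod hT)]
  congr 2; ext z
  by_cases a : z.1 ∈ S <;> by_cases b : z.2 ∈ T <;> simp [Set.indicator, a, b]

theorem cutNorm_nonneg (D : ℝ → ℝ → ℝ) : 0 ≤ cutNorm D := by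
  apply Real.sSup_nonneg
  rintro r ⟨S, T, -, -, -, -, rfl⟩
  exact abs_nonneg _

theorem cutLE.mono {D : ℝ → ℝ → ℝ} {ε δ : ℝ} (h : cutLE D ε) (hh : ε ≤ δ) : cutLE D δ :=
  fun f g hf hg => (h f g hf hg).trans hh

theorem cutLE.tri {U V W : ℝ → ℝ → ℝ} (hU : Nice U) (hV : Nice V) (hW : Nice W) {ε δ : ℝ}
    (h1 : cutLE (fun x y => U x y - V x y) ε) (h2 : cutLE (fun x y => V x y - W x y) δ) :
    cutLE (fun x y => U x y - W x y) (ε + δ) := by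
  intro f g hf hg
  have := add_le_add (h1 f g hf hg) (h2 f g hf hg)
  refine le_trans ?_ this
  refine le_trans (le_of_eq ?_) (abs_add_le _ _)
  rw [← integral_add ((hU.sub hV).integrable_test hf hg _) ((hV.sub hW).integrable_test hf hg _)]
  congr 2; ext z; ring

theorem cutLE.symm {U V : ℝ → ℝ → ℝ} {ε : ℝ}
    (h1 : cutLE (fun x y => U x y - V x y) ε) : cutLE (fun x y => V x y - U x y) ε := by
  intro f g hf hg
  convert h1 f g hf hg using 1
  rw [← abs_neg, ← integral_neg]
  congr 2; ext z; ring

theorem cutLE_of_l1 {D : ℝ → ℝ → ℝ} (hD : Nice D) {ε : ℝ}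
    (h : ∫ z, |D z.1 z.2| ∂(lam.prod lam) ≤ ε) : cutLE D ε := by
  intro f g hf hg
  refine (abs_integral_le_integral_abs).trans (le_trans ?_ h)
  refine integral_mono (hD.integrable_test hf hg _).abs (hD.integrable _).abs fun z => ?_
  simp only [abs_mul]
  have h1 := hf.2 z.1
  have h2 := hg.2 z.2
  rw [abs_of_nonneg h1.1, abs_of_nonneg h2.1]
  exact mul_le_of_le_one_left (abs_nonneg _) (mul_le_one₀ h1.2 h2.1 h2.2)

theorem cutLE_of_ae {D : ℝ → ℝ → ℝ} (hD : Nice D)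
    (h : ∀ᵐ z ∂(lam.prod lam), D z.1 z.2 = 0) : cutLE D 0 := by
  refine cutLE_of_l1 hD (le_of_eq ?_)
  rw [integral_eq_zero_iff_of_nonneg (fun z => abs_nonneg _) (hD.integrable _).abs]
  filter_upwards [h] with z hz using by simp [hz]

theorem lam_mem : ∀ᵐ x ∂lam, x ∈ I01 := ae_restrict_mem measurableSet_I01

theorem ae_prod {p q : ℝ → Prop} (hp : ∀ᵐ x ∂lam, p x) (hq : ∀ᵐ x ∂lam, q x) :
    ∀ᵐ z ∂(lam.prod lam), p z.1 ∧ q z.2 :=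
  ((Measure.quasiMeasurePreserving_fst (μ := lam) (ν := lam)).ae hp).and
    ((Measure.quasiMeasurePreserving_snd (μ := lam) (ν := lam)).ae hq)

theorem InvMP.integral_comp (φ : InvMP) {F : ℝ × ℝ → ℝ} (hF : Measurable F) :
    ∫ z, F (φ.toFun z.1, φ.toFun z.2) ∂(lam.prod lam) = ∫ z, F z ∂(lam.prod lam) := by
  have h := φ.measurePreserving.prod φ.measurePreserving
  conv_rhs => rw [← h.map_eq]
  rw [integral_map h.measurable.aemeasurable hF.aestronglyMeasurable]
  rfl

theorem cutLE.comp {D : ℝ → ℝ → ℝ} (hD : Nice D) {ε : ℝ} (h : cutLE D ε) (φ : InvMP) :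
    cutLE (fun x y => D (φ.toFun x) (φ.toFun y)) ε := by
  intro f g hf hg
  have hm := φ.measurePreservingInv.measurable
  have hf' : Unitv (f ∘ φ.invFun) := ⟨hf.1.comp hm, fun x => hf.2 _⟩
  have hg' : Unitv (g ∘ φ.invFun) := ⟨hg.1.comp hm, fun x => hg.2 _⟩
  refine le_trans (le_of_eq ?_) (h _ _ hf' hg')
  rw [← φ.integral_comp (F := fun z => (f ∘ φ.invFun) z.1 * (g ∘ φ.invFun) z.2 * D z.1 z.2)]
  · congr 1
    apply integral_congr_ae
    filter_upwards [ae_prod lam_mem lam_mem] with z hz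
    simp [φ.leftInv _ hz.1, φ.leftInv _ hz.2]
  · exact (((hf'.nice_mul hg').mul hD).1)

def InvMP.symm (φ : InvMP) : InvMP :=
  ⟨φ.invFun, φ.toFun, φ.mapsInv, φ.maps, φ.measurePreservingInv, φ.measurePreserving,
    φ.rightInv, φ.leftInv⟩

/-- first φ, then ψ -/
def InvMP.trans (φ ψ : InvMP) : InvMP where
  toFun := ψ.toFun ∘ φ.toFun
  invFun := φ.invFun ∘ ψ.invFun
  maps x hx := ψ.maps _ (φ.maps _ hx)
  mapsInv x hx := φ.mapsInv _ (ψ.mapsInv _ hx)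
  measurePreserving := ψ.measurePreserving.comp φ.measurePreserving
  measurePreservingInv := φ.measurePreservingInv.comp ψ.measurePreservingInv
  leftInv x hx := by simp [ψ.leftInv _ (φ.maps _ hx), φ.leftInv _ hx]
  rightInv x hx := by simp [φ.rightInv _ (ψ.mapsInv _ hx), ψ.rightInv _ hx]

def InvMP.refl : InvMP where
  toFun := id
  invFun := id
  maps x hx := hx
  mapsInv x hx := hx
  measurePreserving := MeasurePreserving.id _
  measurePreservingInv := MeasurePreserving.id _
  leftInv x hx := rfl
  rightInv x hx := rfl

def pull (W : ℝ → ℝ → ℝ) (φ : InvMP) : ℝ → ℝ → ℝ := fun x y => W (φ.toFun x) (φ.toFun y)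

theorem Nice.pull {W : ℝ → ℝ → ℝ} (h : Nice W) (φ : InvMP) : Nice (pull W φ) :=
  h.comp φ.measurePreserving.measurable φ.measurePreserving.measurable

theorem IsGraphon.pull {W : ℝ → ℝ → ℝ} (h : IsGraphon W) (φ : InvMP) : IsGraphon (pull W φ) :=
  ⟨(h.nice.pull φ).1, fun x y => h.2.1 _ _, fun x y => h.2.2 _ _⟩

theorem pull_trans (W : ℝ → ℝ → ℝ) (φ ψ : InvMP) : pull W (φ.trans ψ) = pull (pull W ψ) φ := rfl

/-- closeness of two kernels -/
def near (U W : ℝ → ℝ → ℝ) (φ : InvMP) (ε : ℝ) : Prop :=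
  cutLE (fun x y => U x y - pull W φ x y) ε

theorem near.tri {U V W : ℝ → ℝ → ℝ} (hU : Nice U) (hV : Nice V) (hW : Nice W) {φ ψ : InvMP}
    {ε δ : ℝ} (h1 : near U V φ ε) (h2 : near V W ψ δ) : near U W (φ.trans ψ) (ε + δ) := by
  refine cutLE.tri hU (hV.pull φ) (hW.pull _) h1 ?_
  exact cutLE.comp (hV.sub (hW.pull ψ)) h2 φ

theorem pull_symm_ae (V : ℝ → ℝ → ℝ) (φ : InvMP) :
    ∀ᵐ z ∂(lam.prod lam), pull (pull V φ) φ.symm z.1 z.2 = V z.1 z.2 := by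
  filter_upwards [ae_prod lam_mem lam_mem] with z hz
  simp [pull, InvMP.symm, φ.rightInv _ hz.1, φ.rightInv _ hz.2]

theorem near.symm {U V : ℝ → ℝ → ℝ} (hU : Nice U) (hV : Nice V) {φ : InvMP}
    {ε : ℝ} (h1 : near U V φ ε) : near V U φ.symm ε := by
  have h2 := cutLE.comp (hU.sub (hV.pull φ)) h1 φ.symm
  have h3 : cutLE (fun x y => pull (pull V φ) φ.symm x y - V x y) 0 :=
    cutLE_of_ae (((hV.pull φ).pull φ.symm).sub hV) (by
      filter_upwards [pull_symm_ae V φ] with z hz using by rw [hz, sub_self])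
  have := cutLE.tri (hU.pull φ.symm) ((hV.pull φ).pull φ.symm) hV h2 h3
  rw [add_zero] at this
  exact this.symm

theorem deltaCut_nonneg (U W : ℝ → ℝ → ℝ) : 0 ≤ deltaCut U W :=
  Real.iInf_nonneg fun _ => cutNorm_nonneg _

theorem deltaCut_le {U W : ℝ → ℝ → ℝ} (hU : Nice U) (hW : Nice W) {φ : InvMP} {ε : ℝ}
    (h : near U W φ ε) : deltaCut U W ≤ ε :=
  (ciInf_le ⟨0, by rintro _ ⟨φ, rfl⟩; exact cutNorm_nonneg _⟩ φ).trans
    (cutNorm_le (hU.sub (hW.pull φ)) h)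

theorem exists_near {U W : ℝ → ℝ → ℝ} (hU : Nice U) (hW : Nice W) {ε : ℝ}
    (h : deltaCut U W < ε) : ∃ φ, near U W φ ε := by
  have : Nonempty InvMP := ⟨InvMP.refl⟩
  obtain ⟨φ, hφ⟩ := exists_lt_of_ciInf_lt h
  exact ⟨φ, cutLE_of_cutNorm (hU.sub (hW.pull φ)) hφ.le⟩


def idx (n : ℕ) [NeZero n] (x : ℝ) : Fin n :=
  ⟨min (⌈(n : ℝ) * x⌉₊ - 1) (n - 1), by have := NeZero.pos n; omega⟩

theorem npos (n : ℕ) [NeZero n] : (0 : ℝ) < n := by exact_mod_cast NeZero.pos n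

theorem idx_mono (n : ℕ) [NeZero n] : Monotone (idx n) := by
  intro x y h
  have : ⌈(n : ℝ) * x⌉₊ ≤ ⌈(n : ℝ) * y⌉₊ := Nat.ceil_mono (by gcongr)
  simp only [idx, Fin.mk_le_mk]
  omega

theorem idx_measurable (n : ℕ) [NeZero n] : Measurable (idx n) := (idx_mono n).measurable

theorem idx_eq_iff {n : ℕ} [NeZero n] {x : ℝ} (hx : x ∈ Set.Ioc (0 : ℝ) 1) (i : Fin n) :
    idx n x = i ↔ x ∈ Set.Ioc (((i : ℕ) : ℝ) / n) ((((i : ℕ) : ℝ) + 1) / n) := by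
  have hn := npos n
  have h1 : 0 < ⌈(n : ℝ) * x⌉₊ := Nat.ceil_pos.2 (mul_pos hn hx.1)
  have h2 : ⌈(n : ℝ) * x⌉₊ ≤ n := Nat.ceil_le.2 (by nlinarith [hx.2])
  have h3 : idx n x = i ↔ ⌈(n : ℝ) * x⌉₊ = i + 1 := by
    rw [Fin.ext_iff]; simp only [idx]; omega
  rw [h3, Nat.ceil_eq_iff (by omega), Set.mem_Ioc, div_lt_iff₀ hn, le_div_iff₀ hn]
  simp [mul_comm]

theorem Ioc_sub {n : ℕ} [NeZero n] (i : Fin n) :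
    Set.Ioc (((i : ℕ) : ℝ) / n) ((((i : ℕ) : ℝ) + 1) / n) ⊆ Set.Ioc 0 1 := by
  have hn := npos n
  intro x hx
  refine ⟨lt_of_le_of_lt (by positivity) hx.1, hx.2.trans ?_⟩
  rw [div_le_one hn]
  exact_mod_cast i.2

theorem lam_eq : lam = volume.restrict (Set.Ioc (0 : ℝ) 1) := by
  rw [lam, I01, restrict_Ioc_eq_restrict_Icc]

theorem lam_mem' : ∀ᵐ x ∂lam, x ∈ Set.Ioc (0 : ℝ) 1 := by
  rw [lam_eq]; exact ae_restrict_mem measurableSet_Ioc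

theorem fiber_eq {n : ℕ} [NeZero n] (i : Fin n) :
    idx n ⁻¹' {i} ∩ Set.Ioc (0 : ℝ) 1 = Set.Ioc (((i : ℕ) : ℝ) / n) ((((i : ℕ) : ℝ) + 1) / n) := by
  ext x
  constructor
  · rintro ⟨h, hx⟩; exact (idx_eq_iff hx i).1 h
  · intro h; exact ⟨(idx_eq_iff (Ioc_sub i h) i).2 h, Ioc_sub i h⟩

theorem meas_fiber {n : ℕ} [NeZero n] (i : Fin n) : MeasurableSet (idx n ⁻¹' {i}) :=
  idx_measurable n (measurableSet_singleton i)

theorem restrict_fiber {n : ℕ} [NeZero n] (i : Fin n) : lam.restrict (idx n ⁻¹' {i})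
    = volume.restrict (Set.Ioc (((i : ℕ) : ℝ) / n) ((((i : ℕ) : ℝ) + 1) / n)) := by
  rw [lam_eq, Measure.restrict_restrict (meas_fiber i), fiber_eq]

theorem lam_fiber {n : ℕ} [NeZero n] (i : Fin n) : lam.real (idx n ⁻¹' {i}) = 1 / n := by
  have := congrArg (fun μ : Measure ℝ => μ.real Set.univ) (restrict_fiber i)
  simp only [measureReal_restrict_apply_univ] at this
  rw [this, Real.volume_real_Ioc_of_le (by gcongr; linarith)]
  ring

/-- step kernel of a matrix -/
def stepK {n : ℕ} [NeZero n] (A : Fin n → Fin n → ℝ) : ℝ → ℝ → ℝ :=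
  fun x y => A (idx n x) (idx n y)

theorem stepK_nice {n : ℕ} [NeZero n] (A : Fin n → Fin n → ℝ) : Nice (stepK A) := by
  refine ⟨?_, ∑ i, ∑ j, |A i j|, fun x y => ?_⟩
  · have : Measurable (fun z : Fin n × Fin n => A z.1 z.2) := measurable_of_finite _
    exact this.comp (((idx_measurable n).comp measurable_fst).prodMk
      ((idx_measurable n).comp measurable_snd))
  · refine le_trans ?_ (Finset.single_le_sum (f := fun i => ∑ j, |A i j|)
      (fun i _ => Finset.sum_nonneg fun j _ => abs_nonneg _) (Finset.mem_univ (idx n x)))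
    exact (Finset.single_le_sum (f := fun j => |A (idx n x) j|)
      (fun i _ => abs_nonneg _) (Finset.mem_univ (idx n y)))

open Classical in
def adjM {n : ℕ} (G : SimpleGraph (Fin n)) : Fin n → Fin n → ℝ := fun i j =>
  if G.Adj i j then 1 else 0

theorem graphonOf_eq {n : ℕ} [NeZero n] (G : SimpleGraph (Fin n)) {x y : ℝ}
    (hx : x ∈ Set.Ioc (0 : ℝ) 1) (hy : y ∈ Set.Ioc (0 : ℝ) 1) :
    graphonOf G x y = stepK (adjM G) x y := by
  have : (∃ i j : Fin n, G.Adj i j ∧ x ∈ Set.Ioc (((i : ℕ) : ℝ) / n) ((((i : ℕ) : ℝ) + 1) / n)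
      ∧ y ∈ Set.Ioc (((j : ℕ) : ℝ) / n) ((((j : ℕ) : ℝ) + 1) / n)) ↔
      G.Adj (idx n x) (idx n y) := by
    constructor
    · rintro ⟨i, j, h, h1, h2⟩
      rw [← idx_eq_iff hx] at h1
      rw [← idx_eq_iff hy] at h2
      rwa [h1, h2]
    · intro h
      exact ⟨_, _, h, (idx_eq_iff hx _).1 rfl, (idx_eq_iff hy _).1 rfl⟩
  simp only [graphonOf, stepK, adjM]
  by_cases h : G.Adj (idx n x) (idx n y)
  · rw [if_pos h, if_pos (this.2 h)]
  · rw [if_neg h, if_neg (fun h' => h (this.1 h'))]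

theorem graphonOf_ae {n : ℕ} [NeZero n] (G : SimpleGraph (Fin n)) :
    ∀ᵐ z ∂(lam.prod lam), graphonOf G z.1 z.2 = stepK (adjM G) z.1 z.2 := by
  filter_upwards [ae_prod lam_mem' lam_mem'] with z hz using graphonOf_eq G hz.1 hz.2

open Classical in
theorem graphonOf_graphon {n : ℕ} (G : SimpleGraph (Fin n)) : IsGraphon (graphonOf G) := by
  refine ⟨?_, ?_, ?_⟩
  · unfold graphonOf Function.uncurry
    refine Measurable.ite ?_ measurable_const measurable_const
    have : {a : ℝ × ℝ | ∃ i j : Fin n, G.Adj i j ∧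
        a.1 ∈ Set.Ioc (((i : ℕ) : ℝ) / n) ((((i : ℕ) : ℝ) + 1) / n)
        ∧ a.2 ∈ Set.Ioc (((j : ℕ) : ℝ) / n) ((((j : ℕ) : ℝ) + 1) / n)} =
        ⋃ i : Fin n, ⋃ j : Fin n, ⋃ _ : G.Adj i j,
          Set.Ioc (((i : ℕ) : ℝ) / n) ((((i : ℕ) : ℝ) + 1) / n) ×ˢ
          Set.Ioc (((j : ℕ) : ℝ) / n) ((((j : ℕ) : ℝ) + 1) / n) := by
      ext a
      simp only [Set.mem_iUnion, Set.mem_prod, exists_prop]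
      rfl
    rw [this]
    exact MeasurableSet.iUnion fun i => MeasurableSet.iUnion fun j => MeasurableSet.iUnion fun _ =>
      measurableSet_Ioc.prod measurableSet_Ioc
  · intro x y
    unfold graphonOf
    congr 1
    apply propext
    constructor <;> rintro ⟨i, j, h, h1, h2⟩ <;> exact ⟨j, i, h.symm, h2, h1⟩
  · intro x y
    unfold graphonOf
    split_ifs <;> simp

def matLE {n : ℕ} (D : Fin n → Fin n → ℝ) (ε : ℝ) : Prop :=
  ∀ f g : Fin n → ℝ, (∀ i, f i ∈ Set.Icc (0 : ℝ) 1) → (∀ i, g i ∈ Set.Icc (0 : ℝ) 1) →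
    |∑ i, ∑ j, f i * g j * D i j| ≤ ε * (n : ℝ) ^ 2

theorem cutLE_stepK {n : ℕ} [NeZero n] {D : Fin n → Fin n → ℝ} {ε : ℝ} (h : matLE D ε) :
    cutLE (stepK D) ε := by
  intro f g hf hg
  have hn := npos n
  let F (f : ℝ → ℝ) (i : Fin n) : ℝ := n * ∫ x in idx n ⁻¹' {i}, f x ∂lam
  have hinteg : ∀ f, Unitv f → Integrable f lam := fun f hf =>
    Integrable.of_bound (C := 1) hf.1.aestronglyMeasurable (ae_of_all _ fun x => by
      rw [Real.norm_eq_abs, abs_of_nonneg (hf.2 x).1]; exact (hf.2 x).2)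
  have hF : ∀ f, Unitv f → ∀ i, F f i ∈ Set.Icc (0 : ℝ) 1 := by
    intro f hf i
    constructor
    · exact mul_nonneg hn.le (integral_nonneg fun x => (hf.2 x).1)
    · have : ∫ x in idx n ⁻¹' {i}, f x ∂lam ≤ ∫ x in idx n ⁻¹' {i}, (1 : ℝ) ∂lam :=
        integral_mono (hinteg f hf).integrableOn (integrable_const _) fun x => (hf.2 x).2
      rw [setIntegral_const, lam_fiber, smul_eq_mul, mul_one] at this
      calc F f i ≤ n * (1 / n) := mul_le_mul_of_nonneg_left this hn.le
        _ = 1 := by field_simp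
  have key := h (F f) (F g) (hF f hf) (hF g hg)
  have e : ∫ z, f z.1 * g z.2 * stepK D z.1 z.2 ∂(lam.prod lam)
      = (∑ i, ∑ j, F f i * F g j * D i j) / (n : ℝ) ^ 2 := by
    have : ∀ z : ℝ × ℝ, f z.1 * g z.2 * stepK D z.1 z.2 = ∑ i, ∑ j,
        D i j * ((idx n ⁻¹' {i}).indicator f z.1 * (idx n ⁻¹' {j}).indicator g z.2) := by
      intro z
      rw [Finset.sum_eq_single (idx n z.1), Finset.sum_eq_single (idx n z.2)]
      · simp [Set.indicator, stepK]; ring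
      · intro b _ hb; simp [Set.indicator, hb.symm]
      · simp
      · intro b _ hb; simp [Set.indicator, hb.symm]
      · simp
    simp_rw [this]
    have hi : ∀ i j, Integrable (fun z : ℝ × ℝ => D i j * ((idx n ⁻¹' {i}).indicator f z.1 *
        (idx n ⁻¹' {j}).indicator g z.2)) (lam.prod lam) := fun i j =>
      (((hinteg f hf).indicator (meas_fiber i)).mul_prod
        ((hinteg g hg).indicator (meas_fiber j))).const_mul _
    rw [integral_finset_sum _ fun i _ => integrable_finset_sum _ fun j _ => hi i j,
      Finset.sum_div]
    refine Finset.sum_congr rfl fun i _ => ?_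
    rw [integral_finset_sum _ fun j _ => hi i j, Finset.sum_div]
    refine Finset.sum_congr rfl fun j _ => ?_
    rw [integral_const_mul, integral_prod_mul, integral_indicator (meas_fiber i),
      integral_indicator (meas_fiber j)]
    simp only [F]
    field_simp
  rw [e, abs_div, abs_of_pos (by positivity : (0 : ℝ) < (n : ℝ) ^ 2), div_le_iff₀ (by positivity)]
  exact key

theorem matLE_of_finset {n : ℕ} {D : Fin n → Fin n → ℝ} {ε : ℝ}
    (h : ∀ S T : Finset (Fin n), |∑ i ∈ S, ∑ j ∈ T, D i j| ≤ ε * (n : ℝ) ^ 2) : matLE D ε := by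
  have one : ∀ (h : Fin n → ℝ) (B : ℝ), (∀ S : Finset (Fin n), |∑ i ∈ S, h i| ≤ B) →
      ∀ f : Fin n → ℝ, (∀ i, f i ∈ Set.Icc (0 : ℝ) 1) → |∑ i, f i * h i| ≤ B := by
    intro h B H f hf
    have h1 : ∑ i, f i * h i ≤ ∑ i ∈ Finset.univ.filter (fun i => 0 ≤ h i), h i := by
      rw [Finset.sum_filter]
      refine Finset.sum_le_sum fun i _ => ?_
      have := hf i
      split_ifs with hx
      · nlinarith [this.1, this.2]
      · push Not at hx; nlinarith [this.1, this.2]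
    have h2 : ∑ i ∈ Finset.univ.filter (fun i => h i ≤ 0), h i ≤ ∑ i, f i * h i := by
      rw [Finset.sum_filter]
      refine Finset.sum_le_sum fun i _ => ?_
      have := hf i
      split_ifs with hx
      · nlinarith [this.1, this.2]
      · push Not at hx; nlinarith [this.1, this.2]
    have a := abs_le.1 (H (Finset.univ.filter (fun i => 0 ≤ h i)))
    have b := abs_le.1 (H (Finset.univ.filter (fun i => h i ≤ 0)))
    rw [abs_le]
    constructor <;> linarith
  intro f g hf hg
  have e : ∑ i, ∑ j, f i * g j * D i j = ∑ i, f i * ∑ j, g j * D i j := by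
    refine Finset.sum_congr rfl fun i _ => ?_
    rw [Finset.mul_sum]
    exact Finset.sum_congr rfl fun j _ => by ring
  rw [e]
  refine one _ _ (fun S => ?_) f hf
  have e2 : ∑ i ∈ S, ∑ j, g j * D i j = ∑ j, g j * ∑ i ∈ S, D i j := by
    rw [Finset.sum_comm]
    exact Finset.sum_congr rfl fun j _ => by rw [Finset.mul_sum]
  rw [e2]
  refine one _ _ (fun T => ?_) g hg
  rw [Finset.sum_comm]
  exact h S T

theorem matLE.add {n : ℕ} {D E : Fin n → Fin n → ℝ} {ε δ : ℝ} (h1 : matLE D ε) (h2 : matLE E δ) :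
    matLE (fun i j => D i j + E i j) (ε + δ) := by
  intro f g hf hg
  have := add_le_add (h1 f g hf hg) (h2 f g hf hg)
  rw [← add_mul] at this
  refine le_trans (le_trans (le_of_eq ?_) (abs_add_le _ _)) this
  rw [← Finset.sum_add_distrib]
  congr 1
  refine Finset.sum_congr rfl fun i _ => ?_
  rw [← Finset.sum_add_distrib]
  exact Finset.sum_congr rfl fun j _ => by ring

theorem matLE.mono {n : ℕ} {D : Fin n → Fin n → ℝ} {ε δ : ℝ} (h1 : matLE D ε) (h : ε ≤ δ) :
    matLE D δ := fun f g hf hg => (h1 f g hf hg).trans (by gcongr)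

theorem matLE_of_l1 {n : ℕ} {D : Fin n → Fin n → ℝ} {ε : ℝ}
    (h : ∑ i, ∑ j, |D i j| ≤ ε * (n : ℝ) ^ 2) : matLE D ε := by
  intro f g hf hg
  refine le_trans (Finset.abs_sum_le_sum_abs _ _) (le_trans ?_ h)
  refine Finset.sum_le_sum fun i _ => ?_
  refine le_trans (Finset.abs_sum_le_sum_abs _ _) ?_
  refine Finset.sum_le_sum fun j _ => ?_
  rw [abs_mul, abs_mul, abs_of_nonneg (hf i).1, abs_of_nonneg (hg j).1]
  exact mul_le_of_le_one_left (abs_nonneg _) (mul_le_one₀ (hf i).2 (hg j).1 (hg j).2)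

/-! permutations -/

def permFun {n : ℕ} [NeZero n] (σ : Equiv.Perm (Fin n)) (x : ℝ) : ℝ :=
  x + (Set.Ioc (0 : ℝ) 1).indicator
    (fun x => (((σ (idx n x) : ℕ) : ℝ) - ((idx n x : ℕ) : ℝ)) / n) x

theorem permFun_fiber {n : ℕ} [NeZero n] (σ : Equiv.Perm (Fin n)) {i : Fin n} {x : ℝ}
    (hx : x ∈ Set.Ioc (((i : ℕ) : ℝ) / n) ((((i : ℕ) : ℝ) + 1) / n)) :
    permFun σ x = x + (((σ i : ℕ) : ℝ) - ((i : ℕ) : ℝ)) / n := by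
  have h1 := Ioc_sub i hx
  have h2 := (idx_eq_iff h1 i).2 hx
  simp only [permFun, Set.indicator, h1, if_true, h2]

theorem permFun_mem {n : ℕ} [NeZero n] (σ : Equiv.Perm (Fin n)) {i : Fin n} {x : ℝ}
    (hx : x ∈ Set.Ioc (((i : ℕ) : ℝ) / n) ((((i : ℕ) : ℝ) + 1) / n)) :
    permFun σ x ∈ Set.Ioc (((σ i : ℕ) : ℝ) / n) ((((σ i : ℕ) : ℝ) + 1) / n) := by
  rw [permFun_fiber σ hx]
  obtain ⟨h1, h2⟩ := hx
  rw [sub_div]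
  rw [add_div] at h2 ⊢
  constructor <;> linarith

theorem permFun_mem' {n : ℕ} [NeZero n] (σ : Equiv.Perm (Fin n)) {x : ℝ}
    (hx : x ∈ Set.Ioc (0 : ℝ) 1) : permFun σ x ∈ Set.Ioc (0 : ℝ) 1 :=
  Ioc_sub _ (permFun_mem σ ((idx_eq_iff hx _).1 rfl))

theorem idx_permFun {n : ℕ} [NeZero n] (σ : Equiv.Perm (Fin n)) {x : ℝ}
    (hx : x ∈ Set.Ioc (0 : ℝ) 1) : idx n (permFun σ x) = σ (idx n x) :=
  (idx_eq_iff (permFun_mem' σ hx) _).2 (permFun_mem σ ((idx_eq_iff hx _).1 rfl))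

theorem permFun_inv {n : ℕ} [NeZero n] (σ τ : Equiv.Perm (Fin n)) (h : ∀ i, τ (σ i) = i) (x : ℝ) :
    permFun τ (permFun σ x) = x := by
  by_cases hx : x ∈ Set.Ioc (0 : ℝ) 1
  · have h1 := (idx_eq_iff (n := n) hx _).1 rfl
    rw [permFun_fiber τ (permFun_mem σ h1), permFun_fiber σ h1, h]
    ring
  · have : ∀ τ : Equiv.Perm (Fin n), permFun τ x = x := fun τ => by simp [permFun, hx]
    rw [this, this]

theorem permFun_measurable {n : ℕ} [NeZero n] (σ : Equiv.Perm (Fin n)) :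
    Measurable (permFun σ) := by
  refine measurable_id.add (Measurable.indicator ?_ measurableSet_Ioc)
  have : Measurable (fun i : Fin n => (((σ i : ℕ) : ℝ) - ((i : ℕ) : ℝ)) / n) := measurable_from_top
  exact this.comp (idx_measurable n)

theorem lam_decomp {n : ℕ} [NeZero n] {S : Set ℝ} (hS : MeasurableSet S) : lam S = ∑ i : Fin n,
    volume (S ∩ Set.Ioc (((i : ℕ) : ℝ) / n) ((((i : ℕ) : ℝ) + 1) / n)) := by
  have h1 : ∀ i : Fin n, volume (S ∩ Set.Ioc (((i : ℕ) : ℝ) / n) ((((i : ℕ) : ℝ) + 1) / n))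
      = lam (S ∩ idx n ⁻¹' {i}) := fun i => by
    rw [← Measure.restrict_apply hS, ← restrict_fiber, Measure.restrict_apply hS]
  simp_rw [h1]
  rw [← measure_biUnion_finset]
  · congr 1; ext x; simp
  · intro i _ j _ hij
    refine Set.disjoint_left.2 fun x hx hy => hij ?_
    have a := hx.2; have b := hy.2
    simp at a b
    rw [← a, ← b]
  · exact fun i _ => hS.inter (meas_fiber i)

theorem permFun_mp {n : ℕ} [NeZero n] (σ : Equiv.Perm (Fin n)) :
    MeasurePreserving (permFun σ) lam lam := by
  refine ⟨permFun_measurable σ, ?_⟩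
  ext S hS
  rw [Measure.map_apply (permFun_measurable σ) hS, lam_decomp (n := n) hS,
    lam_decomp (n := n) (permFun_measurable σ hS),
    ← Equiv.sum_comp σ (fun i : Fin n =>
      volume (S ∩ Set.Ioc (((i : ℕ) : ℝ) / n) ((((i : ℕ) : ℝ) + 1) / n)))]
  refine Finset.sum_congr rfl fun i _ => ?_
  have e : permFun σ ⁻¹' S ∩ Set.Ioc (((i : ℕ) : ℝ) / n) ((((i : ℕ) : ℝ) + 1) / n) =
      (fun x => x + (((σ i : ℕ) : ℝ) - ((i : ℕ) : ℝ)) / n) ⁻¹'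
        (S ∩ Set.Ioc (((σ i : ℕ) : ℝ) / n) ((((σ i : ℕ) : ℝ) + 1) / n)) := by
    ext x
    constructor
    · rintro ⟨h1, h2⟩
      have := permFun_mem σ h2
      rw [Set.mem_preimage, permFun_fiber σ h2] at *
      exact ⟨h1, this⟩
    · rintro ⟨h1, h2⟩
      have h3 : x ∈ Set.Ioc (((i : ℕ) : ℝ) / n) ((((i : ℕ) : ℝ) + 1) / n) := by
        obtain ⟨a, b⟩ := h2
        simp only [sub_div, add_div] at a b
        constructor
        · linarith
        · rw [add_div]; linarith
      exact ⟨by rw [Set.mem_preimage, permFun_fiber σ h3]; exact h1, h3⟩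
  rw [e, measure_preimage_add_right]

theorem permFun_I01 {n : ℕ} [NeZero n] (σ : Equiv.Perm (Fin n)) (x : ℝ) (hx : x ∈ I01) :
    permFun σ x ∈ I01 := by
  by_cases h : x ∈ Set.Ioc (0 : ℝ) 1
  · exact Set.Ioc_subset_Icc_self (permFun_mem' σ h)
  · have : permFun σ x = x := by simp [permFun, h]
    rwa [this]

def permMP {n : ℕ} [NeZero n] (σ : Equiv.Perm (Fin n)) : InvMP where
  toFun := permFun σ
  invFun := permFun σ.symm
  maps := permFun_I01 σ
  mapsInv := permFun_I01 σ.symm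
  measurePreserving := permFun_mp σ
  measurePreservingInv := permFun_mp σ.symm
  leftInv x _ := permFun_inv σ σ.symm (by simp) x
  rightInv x _ := permFun_inv σ.symm σ (by simp) x


theorem lam_idx_finset {n : ℕ} [NeZero n] (T : Finset (Fin n)) :
    lam.real (idx n ⁻¹' (T : Set (Fin n))) = T.card / n := by
  have h : idx n ⁻¹' (T : Set (Fin n)) = ⋃ i ∈ T, idx n ⁻¹' {i} := by
    ext x; simp
  rw [h, measureReal_biUnion_finset]
  · simp [lam_fiber, div_eq_mul_inv]
  · intro i _ j _ hij
    refine Set.disjoint_left.2 fun x hx hy => hij ?_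
    simp only [Set.mem_preimage, Set.mem_singleton_iff] at hx hy
    rw [← hx, hy]
  · intro i _; exact meas_fiber i

theorem lam_nested {A B : Set ℝ} (hA : MeasurableSet A) (hB : MeasurableSet B)
    (hAB : A ⊆ B ∨ B ⊆ A) {η : ℝ} (h : |lam.real A - lam.real B| ≤ η) :
    lam.real (symmDiff A B) ≤ η := by
  rcases hAB with h1 | h1
  · have : symmDiff A B = B \ A := by
      simp [symmDiff_def, Set.diff_eq_empty.2 h1]
    rw [this, measureReal_diff h1 hA]
    rw [abs_sub_comm] at h
    exact (le_abs_self _).trans h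
  · have : symmDiff A B = A \ B := by
      simp [symmDiff_def, Set.diff_eq_empty.2 h1]
    rw [this, measureReal_diff h1 hB]
    exact (le_abs_self _).trans h

theorem mono_close {p : ℕ} {C C' : ℝ → Fin p} (hC : Monotone C) (hC' : Monotone C') {η : ℝ}
    (h : ∀ a, |lam.real {x | C x ≤ a} - lam.real {x | C' x ≤ a}| ≤ η) :
    lam.real {x | C x ≠ C' x} ≤ p * η := by
  have hm : ∀ D : ℝ → Fin p, Monotone D → ∀ a, MeasurableSet {x | D x ≤ a} := fun D hD a =>
    hD.measurable (measurableSet_Iic)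
  have h1 : {x | C x ≠ C' x} ⊆ ⋃ a ∈ (Finset.univ : Finset (Fin p)), symmDiff {x | C x ≤ a} {x | C' x ≤ a} := by
    intro x hx
    simp only [Set.mem_iUnion]
    rcases lt_or_gt_of_ne hx with h2 | h2
    · exact ⟨C x, Finset.mem_univ _, by simpa [Set.mem_symmDiff] using h2⟩
    · exact ⟨C' x, Finset.mem_univ _, by simpa [Set.mem_symmDiff] using h2⟩
  refine (measureReal_mono h1 (measure_ne_top _ _)).trans ((measureReal_biUnion_finset_le _ _).trans ?_)
  refine (Finset.sum_le_sum (g := fun _ => η) fun a _ => ?_).trans (by simp)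
  refine lam_nested (hm _ hC a) (hm _ hC' a) ?_ (h a)
  have hl : ∀ D : ℝ → Fin p, Monotone D → IsLowerSet {x | D x ≤ a} := fun D hD x y hxy hx =>
    (hD hxy).trans hx
  exact (hl _ hC).total (hl _ hC')

theorem l1_color {p : ℕ} {C C' : ℝ → Fin p} (hC : Measurable C) (hC' : Measurable C') {η L : ℝ}
    (s : Fin p → Fin p → ℝ) (hL : ∀ a b, |s a b| ≤ L)
    (h : lam.real {x | C x ≠ C' x} ≤ η) :
    ∫ z, |s (C z.1) (C z.2) - s (C' z.1) (C' z.2)| ∂(lam.prod lam) ≤ 4 * L * η := by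
  have hL0 : 0 ≤ L := by
    have := hL (C 0) (C 0)
    exact (abs_nonneg _).trans this
  set E := {x | C x ≠ C' x} with hE
  have hEm : MeasurableSet E := (measurableSet_eq_fun hC hC').compl
  have hN : ∀ D : ℝ → Fin p, Measurable D → Nice (fun x y => s (D x) (D y)) := fun D hD =>
    ⟨(measurable_of_finite (fun z : Fin p × Fin p => s z.1 z.2)).comp
      ((hD.comp measurable_fst).prodMk (hD.comp measurable_snd)), L, fun x y => hL _ _⟩
  have i1 : Integrable (fun z : ℝ × ℝ => E.indicator (fun _ => (1:ℝ)) z.1) (lam.prod lam) :=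
    ((integrable_const (1:ℝ)).indicator hEm).comp_fst lam
  have i2 : Integrable (fun z : ℝ × ℝ => E.indicator (fun _ => (1:ℝ)) z.2) (lam.prod lam) :=
    ((integrable_const (1:ℝ)).indicator hEm).comp_snd lam
  have e1 : ∫ z : ℝ × ℝ, E.indicator (fun _ => (1:ℝ)) z.1 ∂(lam.prod lam) = lam.real E := by
    rw [integral_fun_fst (fun x => E.indicator (fun _ => (1:ℝ)) x)]
    simp [integral_indicator hEm]
  have e2 : ∫ z : ℝ × ℝ, E.indicator (fun _ => (1:ℝ)) z.2 ∂(lam.prod lam) = lam.real E := by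
    rw [integral_fun_snd (fun x => E.indicator (fun _ => (1:ℝ)) x)]
    simp [integral_indicator hEm]
  calc _ ≤ ∫ z : ℝ × ℝ, (2 * L * E.indicator (fun _ => (1:ℝ)) z.1 + 2 * L * E.indicator (fun _ => (1:ℝ)) z.2) ∂(lam.prod lam) := by
        refine integral_mono (((hN C hC).sub (hN C' hC')).integrable _).abs
          ((i1.const_mul _).add (i2.const_mul _)) fun z => ?_
        have hab : |s (C z.1) (C z.2) - s (C' z.1) (C' z.2)| ≤ 2 * L := by
          refine (abs_sub _ _).trans ?_
          linarith [hL (C z.1) (C z.2), hL (C' z.1) (C' z.2)]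
        by_cases h1 : z.1 ∈ E <;> by_cases h2 : z.2 ∈ E
        · simp [h1, h2]; linarith
        · simp [h1, h2]; linarith
        · simp [h1, h2]; linarith
        · simp [h1, h2]
          simp only [hE, Set.mem_ofPred_eq, not_not] at h1 h2
          simp [h1, h2]
    _ = 4 * L * lam.real E := by
        rw [integral_add (i1.const_mul _) (i2.const_mul _), integral_const_mul, integral_const_mul,
          e1, e2]
        ring
    _ ≤ _ := by gcongr

theorem near_sort {n p : ℕ} [NeZero n] (c : Fin n → Fin p) (σ : Equiv.Perm (Fin n))
    {A : Fin n → Fin n → ℝ} {s : Fin p → Fin p → ℝ} {ε : ℝ}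
    (h : matLE (fun i j => A i j - s (c i) (c j)) ε) :
    near (stepK fun i j => s (c (σ i)) (c (σ j))) (stepK A) (permMP σ) ε := by
  have h1 := (cutLE_stepK h).comp (stepK_nice _) (permMP σ)
  have h2 : cutLE (fun x y => (pull (stepK A) (permMP σ)) x y
      - pull (stepK fun i j => s (c i) (c j)) (permMP σ) x y) ε := h1
  have h3 := cutLE_of_ae (((stepK_nice fun i j => s (c (σ i)) (c (σ j)))).sub
    ((stepK_nice fun i j => s (c i) (c j)).pull (permMP σ))) (by
      filter_upwards [ae_prod lam_mem' lam_mem'] with z hz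
      simp [pull, stepK, permMP, idx_permFun σ hz.1, idx_permFun σ hz.2])
  have := h3.tri (stepK_nice _) ((stepK_nice _).pull _) ((stepK_nice _).pull _) h2.symm
  exact this.mono (by linarith)

theorem lam_color {n p : ℕ} [NeZero n] (c : Fin n → Fin p) (σ : Equiv.Perm (Fin n)) (a : Fin p) :
    lam.real {x | c (σ (idx n x)) ≤ a} = (Finset.univ.filter fun i => c i ≤ a).card / n := by
  have : {x | c (σ (idx n x)) ≤ a} = idx n ⁻¹'
      ((Finset.univ.filter fun i => c (σ i) ≤ a : Finset (Fin n)) : Set (Fin n)) := by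
    ext x; simp
  rw [this, lam_idx_finset]
  congr 2
  refine Finset.card_bij (fun i _ => σ i) (by simp) (by simp) ?_
  intro b hb
  exact ⟨σ.symm b, by simpa using hb, by simp⟩

theorem align {n n' p : ℕ} [NeZero n] [NeZero n'] (c : Fin n → Fin p) (c' : Fin n' → Fin p) {η : ℝ}
    (hc : ∀ a, |((Finset.univ.filter fun i => c i ≤ a).card / n : ℝ)
      - (Finset.univ.filter fun i => c' i ≤ a).card / n'| ≤ η) :
    ∃ φ : InvMP, ∀ (A : Fin n → Fin n → ℝ) (B : Fin n' → Fin n' → ℝ) (s : Fin p → Fin p → ℝ)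
      (L ε ε' : ℝ), (∀ a b, |s a b| ≤ L) → matLE (fun i j => A i j - s (c i) (c j)) ε →
      matLE (fun i j => B i j - s (c' i) (c' j)) ε' →
      near (stepK A) (stepK B) φ (ε + ε' + 4 * L * (p * η)) := by
  set σ := Tuple.sort c
  set σ' := Tuple.sort c'
  refine ⟨((permMP σ).symm.trans InvMP.refl).trans (permMP σ'), ?_⟩
  intro A B s L ε ε' hL hA hB
  have h1 := (near_sort c σ hA).symm (stepK_nice _) (stepK_nice _)
  have h2 := near_sort c' σ' hB
  have m1 : Monotone (fun x => c (σ (idx n x))) := fun x y hxy =>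
    Tuple.monotone_sort c (idx_mono n hxy)
  have m2 : Monotone (fun x => c' (σ' (idx n' x))) := fun x y hxy =>
    Tuple.monotone_sort c' (idx_mono n' hxy)
  have h3 : near (stepK fun i j => s (c (σ i)) (c (σ j))) (stepK fun i j => s (c' (σ' i)) (c' (σ' j)))
      InvMP.refl (4 * L * (p * η)) := by
    refine cutLE_of_l1 ((stepK_nice _).sub ((stepK_nice _).pull _)) ?_
    refine l1_color m1.measurable m2.measurable s hL (mono_close m1 m2 fun a => ?_)
    rw [lam_color, lam_color]
    exact hc a
  refine (((h1.tri (stepK_nice _) (stepK_nice _) (stepK_nice _) h3)).tri (stepK_nice _)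
    (stepK_nice _) (stepK_nice _) h2).mono ?_
  linarith

theorem near_congr_left {U U' W : ℝ → ℝ → ℝ} (hU : Nice U) (hU' : Nice U') (hW : Nice W)
    (h : ∀ᵐ z ∂(lam.prod lam), U' z.1 z.2 = U z.1 z.2) {φ : InvMP} {ε : ℝ} (hn : near U W φ ε) :
    near U' W φ ε := by
  have := (cutLE_of_ae (hU'.sub hU) (by filter_upwards [h] with z hz using by simp [hz])).tri hU' hU
    (hW.pull φ) hn
  exact this.mono (by linarith)

theorem near_graph_left {n : ℕ} [NeZero n] {G : SimpleGraph (Fin n)} {W : ℝ → ℝ → ℝ} (hW : Nice W)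
    {φ : InvMP} {ε : ℝ} (hn : near (stepK (adjM G)) W φ ε) : near (graphonOf G) W φ ε :=
  near_congr_left (stepK_nice _) (graphonOf_graphon G).nice hW (graphonOf_ae G) hn

theorem near_graph_right {n : ℕ} [NeZero n] {G : SimpleGraph (Fin n)} {W : ℝ → ℝ → ℝ} (hW : Nice W)
    {φ : InvMP} {ε : ℝ} (hn : near W (stepK (adjM G)) φ ε) : near W (graphonOf G) φ ε :=
  (near_graph_left hW (hn.symm hW (stepK_nice _))).symm (graphonOf_graphon G).nice hW

/-- a coloured approximation of a graph yields closeness to a graphon -/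
theorem finish {n N : ℕ} [NeZero n] [NeZero N] {G : SimpleGraph (Fin n)} {c : Fin n → Fin N}
    {u : Fin N → Fin N → ℝ} {U : ℝ → ℝ → ℝ} (hU : Nice U) {ε η γ : ℝ}
    (hu : ∀ a b, u a b ∈ Set.Icc (0 : ℝ) 1)
    (h1 : matLE (fun i j => adjM G i j - u (c i) (c j)) ε)
    (h2 : ∑ a, |((Finset.univ.filter fun i => c i = a).card / n - 1 / N : ℝ)| ≤ η)
    (h3 : ∫ z, |U z.1 z.2 - stepK u z.1 z.2| ∂(lam.prod lam) ≤ γ) :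
    ∃ φ, near (graphonOf G) U φ (ε + 4 * N * η + γ) := by
  obtain ⟨φ, hφ⟩ := align c (id : Fin N → Fin N) (η := η) (by
    intro a
    refine le_trans ?_ h2
    have e1 : ∀ (m : ℕ) (d : Fin m → Fin N), ((Finset.univ.filter fun i => d i ≤ a).card : ℝ)
        = ∑ b ∈ Finset.univ.filter (fun b => b ≤ a), ((Finset.univ.filter fun i => d i = b).card : ℝ) := by
      intro m d
      rw [← Nat.cast_sum, Finset.card_eq_sum_card_fiberwise (f := d) (t := Finset.univ.filter (fun b => b ≤ a))]
      · congr 1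
        refine Finset.sum_congr rfl fun b hb => ?_
        congr 1
        ext i
        simp at hb ⊢
        rintro rfl; exact hb
      · intro i hi; simpa using hi
    rw [e1 n c, e1 N id, Finset.sum_div, Finset.sum_div, ← Finset.sum_sub_distrib]
    refine (Finset.abs_sum_le_sum_abs _ _).trans ?_
    refine (Finset.sum_le_sum (g := fun a => |((Finset.univ.filter fun i => c i = a).card / n - 1 / N : ℝ)|)
      fun b _ => ?_).trans (Finset.sum_le_sum_of_subset_of_nonneg (Finset.subset_univ _) fun _ _ _ => abs_nonneg _)
    have : (Finset.univ.filter fun i : Fin N => id i = b).card = 1 := by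
      simp [Finset.filter_eq']
    rw [this]; simp)
  have hn := hφ (adjM G) u u 1 ε 0 (fun a b => abs_le.2 ⟨by linarith [(hu a b).1], (hu a b).2⟩) h1
    (matLE_of_l1 (by simp))
  have hs : near (stepK u) U InvMP.refl γ := by
    refine cutLE_of_l1 ((stepK_nice _).sub (hU.pull _)) (le_trans (le_of_eq ?_) h3)
    refine integral_congr_ae (ae_of_all _ fun z => ?_)
    simp only [abs_sub_comm (stepK u z.1 z.2)]
    rfl
  exact ⟨_, cutLE.mono (near_graph_left hU (hn.tri (stepK_nice _) (stepK_nice _) hU hs)) (by linarith)⟩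


theorem energy_drop {n : ℕ} (A : Fin n → Fin n → ℝ) (S T : Finset (Fin n)) (ε r : ℝ) (hr : r ^ 2 = 1)
    (h0 : 0 < ε) (h : ε * (n : ℝ) ^ 2 < r * ∑ i ∈ S, ∑ j ∈ T, A i j) :
    ∑ i, ∑ j, (A i j - r * ε * (if i ∈ S ∧ j ∈ T then 1 else 0)) ^ 2
      ≤ ∑ i, ∑ j, (A i j) ^ 2 - ε ^ 2 * (n : ℝ) ^ 2 := by
  have e1 : ∑ i ∈ S, ∑ j ∈ T, A i j = ∑ i, ∑ j, (if i ∈ S ∧ j ∈ T then 1 else 0) * A i j := by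
    rw [← Finset.sum_filter_add_sum_filter_not Finset.univ (fun i => i ∈ S)]
    have : ∑ i ∈ Finset.univ.filter (fun i => ¬ i ∈ S), ∑ j, (if i ∈ S ∧ j ∈ T then 1 else 0) * A i j = 0 := by
      refine Finset.sum_eq_zero fun i hi => ?_
      simp at hi
      simp [hi]
    rw [this, add_zero, Finset.filter_mem_eq_inter, Finset.univ_inter]
    refine Finset.sum_congr rfl fun i hi => ?_
    simp [hi]
  have e2 : ∑ i : Fin n, ∑ j : Fin n, (if i ∈ S ∧ j ∈ T then (1:ℝ) else 0) ≤ (n : ℝ) ^ 2 := by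
    calc _ ≤ ∑ i : Fin n, ∑ j : Fin n, (1 : ℝ) := by
          refine Finset.sum_le_sum fun i _ => Finset.sum_le_sum fun j _ => ?_
          split_ifs <;> norm_num
      _ = _ := by simp [sq]
  have e3 : ∑ i, ∑ j, (A i j - r * ε * (if i ∈ S ∧ j ∈ T then 1 else 0)) ^ 2
      = ∑ i, ∑ j, (A i j) ^ 2 - 2 * ε * (r * ∑ i ∈ S, ∑ j ∈ T, A i j)
        + ε ^ 2 * ∑ i : Fin n, ∑ j : Fin n, (if i ∈ S ∧ j ∈ T then (1:ℝ) else 0) := by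
    rw [e1]
    simp only [Finset.mul_sum, ← Finset.sum_sub_distrib, ← Finset.sum_add_distrib]
    refine Finset.sum_congr rfl fun i _ => Finset.sum_congr rfl fun j _ => ?_
    split_ifs
    · ring_nf; rw [hr]; ring
    · ring
  rw [e3]
  have := mul_le_mul_of_nonneg_left e2 (sq_nonneg ε)
  nlinarith

theorem greedy (ε : ℝ) (hε : 0 < ε) (t : ℕ) : ∃ (κ : Type) (_ : Finite κ) (_ : Nonempty κ)
    (S : Set (κ → κ → ℝ)), S.Finite ∧ ∀ (n : ℕ) (A : Fin n → Fin n → ℝ),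
      ∑ i, ∑ j, (A i j) ^ 2 ≤ t * ε ^ 2 * (n : ℝ) ^ 2 →
      ∃ (c : Fin n → κ), ∃ s ∈ S, matLE (fun i j => A i j - s (c i) (c j)) ε := by
  classical
  induction t with
  | zero =>
    refine ⟨Unit, inferInstance, inferInstance, {0}, Set.finite_singleton _, fun n A hA => ?_⟩
    refine ⟨fun _ => (), 0, rfl, matLE_of_l1 ?_⟩
    have h0 : ∑ i, ∑ j, (A i j) ^ 2 = 0 := le_antisymm (by simpa using hA) (by positivity)
    have h1 : ∀ i j, A i j = 0 := by
      intro i j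
      rw [Finset.sum_eq_zero_iff_of_nonneg (fun i _ => by positivity)] at h0
      have := h0 i (Finset.mem_univ _)
      rw [Finset.sum_eq_zero_iff_of_nonneg (fun i _ => by positivity)] at this
      simpa using this j (Finset.mem_univ _)
    simp [h1]; positivity
  | succ t ih =>
    obtain ⟨κ, _, _, 𝒮, hS, ih⟩ := ih
    let f : (κ → κ → ℝ) × ℝ → (κ × Bool × Bool → κ × Bool × Bool → ℝ) := fun q a b =>
      q.1 a.1 b.1 + q.2 * ε * (if a.2.1 = true ∧ b.2.2 = true then 1 else 0)
    refine ⟨κ × Bool × Bool, inferInstance, inferInstance, {0} ∪ f '' (𝒮 ×ˢ {1, -1}),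
      (Set.finite_singleton _).union ((hS.prod (by simp)).image f), fun n A hA => ?_⟩
    by_cases hm : matLE A ε
    · refine ⟨fun _ => Classical.arbitrary _, 0, by simp, by simpa using hm⟩
    have : ∃ S T : Finset (Fin n), ε * (n : ℝ) ^ 2 < |∑ i ∈ S, ∑ j ∈ T, A i j| := by
      by_contra hcon
      push Not at hcon
      exact hm (matLE_of_finset hcon)
    obtain ⟨S, T, hST⟩ := this
    have : ∃ r : ℝ, r ∈ ({1, -1} : Set ℝ) ∧ r ^ 2 = 1 ∧ ε * (n : ℝ) ^ 2 < r * ∑ i ∈ S, ∑ j ∈ T, A i j := by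
      rcases abs_cases (∑ i ∈ S, ∑ j ∈ T, A i j) with h | h
      · exact ⟨1, by simp, by simp, by rw [h.1] at hST; linarith⟩
      · exact ⟨-1, by simp, by simp, by rw [h.1] at hST; linarith⟩
    obtain ⟨r, hr, hr2, hrS⟩ := this
    have hd := energy_drop A S T ε r hr2 hε hrS
    obtain ⟨c, s, hs, hc⟩ := ih n _ (hd.trans (by push_cast at hA; linarith))
    refine ⟨fun i => (c i, decide (i ∈ S), decide (i ∈ T)), f (s, r), Or.inr ⟨(s, r), ⟨hs, hr⟩, rfl⟩, ?_⟩
    have : (fun i j => A i j - f (s, r) (c i, decide (i ∈ S), decide (i ∈ T)) (c j, decide (j ∈ S), decide (j ∈ T)))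
      = (fun i j => A i j - r * ε * (if i ∈ S ∧ j ∈ T then 1 else 0) - s (c i) (c j)) := by
      funext i j
      simp only [f, decide_eq_true_eq]
      ring
    rw [this]
    exact hc

theorem exists_bound_finite {κ : Type} [Finite κ] {S : Set (κ → κ → ℝ)} (hS : S.Finite) :
    ∃ L : ℝ, 0 ≤ L ∧ ∀ s ∈ S, ∀ a b, |s a b| ≤ L := by
  cases nonempty_fintype κ
  refine ⟨∑ s ∈ hS.toFinset, ∑ a, ∑ b, |s a b|, by positivity, fun s hs a b => ?_⟩
  calc |s a b| ≤ ∑ b, |s a b| := Finset.single_le_sum (f := fun b => |s a b|) (fun _ _ => abs_nonneg _) (Finset.mem_univ _)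
    _ ≤ ∑ a, ∑ b, |s a b| := Finset.single_le_sum (f := fun a => ∑ b, |s a b|) (fun _ _ => by positivity) (Finset.mem_univ _)
    _ ≤ _ := Finset.single_le_sum (f := fun s : κ → κ → ℝ => ∑ a, ∑ b, |s a b|) (fun _ _ => by positivity) (hS.mem_toFinset.2 hs)

theorem adjM_mem {n : ℕ} (G : SimpleGraph (Fin n)) (i j) : adjM G i j ∈ Set.Icc (0:ℝ) 1 := by
  unfold adjM; split_ifs <;> simp

theorem total_bdd (ε : ℝ) (hε : 0 < ε) : ∃ (Q : Type) (_ : Finite Q)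
    (col : ∀ n, SimpleGraph (Fin n) → SimpleGraph (Fin n) → Q),
    ∀ n n' [NeZero n] [NeZero n'] (H G : SimpleGraph (Fin n)) (H' G' : SimpleGraph (Fin n')),
      col n H G = col n' H' G' → ∃ φ, near (graphonOf H) (graphonOf H') φ ε ∧
        near (graphonOf G) (graphonOf G') φ ε := by
  classical
  have he : 0 < ε / 4 := by linarith
  obtain ⟨t, ht⟩ := exists_nat_ge (1 / (ε / 4) ^ 2)
  obtain ⟨κ, _, _, S, hS, hreg⟩ := greedy (ε / 4) he t
  have hreg' : ∀ n (G : SimpleGraph (Fin n)), ∃ (c : Fin n → κ), ∃ s ∈ S,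
      matLE (fun i j => adjM G i j - s (c i) (c j)) (ε / 4) := by
    intro n G
    apply hreg
    calc ∑ i, ∑ j, (adjM G i j) ^ 2 ≤ ∑ i : Fin n, ∑ j : Fin n, (1 : ℝ) := by
          refine Finset.sum_le_sum fun i _ => Finset.sum_le_sum fun j _ => ?_
          have := adjM_mem G i j
          exact pow_le_one₀ this.1 this.2
      _ = 1 * (n : ℝ) ^ 2 := by simp [sq]
      _ ≤ _ := by
          gcongr
          rw [div_le_iff₀ (by positivity)] at ht
          exact ht
  choose c s hs hcs using hreg'
  obtain ⟨L, hL0, hL⟩ := exists_bound_finite hS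
  obtain ⟨p, ⟨e⟩⟩ := Finite.exists_equiv_fin (κ × κ)
  obtain ⟨M, hM⟩ := exists_nat_ge (8 * L * p / ε + 1)
  have hM0 : (0:ℝ) < M := lt_of_lt_of_le (by positivity) hM
  have hfin := hS.to_subtype
  let cc : ∀ n (H G : SimpleGraph (Fin n)), Fin n → Fin p := fun n H G i => e (c n H i, c n G i)
  let fr : ∀ n (H G : SimpleGraph (Fin n)), Fin p → ℝ := fun n H G a =>
    (Finset.univ.filter fun i => cc n H G i ≤ a).card / n
  have hfr : ∀ n (H G : SimpleGraph (Fin n)) a, fr n H G a ≤ 1 := by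
    intro n H G a
    refine div_le_one_of_le₀ ?_ (by positivity)
    have := Finset.card_le_univ (Finset.univ.filter fun i => cc n H G i ≤ a)
    simp only [Fintype.card_fin] at this
    exact_mod_cast this
  have hfr0 : ∀ n (H G : SimpleGraph (Fin n)) a, 0 ≤ fr n H G a := by
    intro n H G a; positivity
  refine ⟨S × S × (Fin p → Fin (M + 1)), inferInstance, fun n H G =>
    (⟨s n H, hs n H⟩, ⟨s n G, hs n G⟩, fun a => ⟨⌊M * fr n H G a⌋₊, by
      rw [Nat.lt_succ_iff]
      apply Nat.floor_le_of_le
      exact (mul_le_mul_of_nonneg_left (hfr n H G a) hM0.le).trans (by simp)⟩), ?_⟩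
  intro n n' _ _ H G H' G' hq
  simp only [Prod.mk.injEq, Subtype.mk.injEq, funext_iff, Fin.mk.injEq] at hq
  obtain ⟨q1, q2, q3⟩ := hq
  have q1 : s n H = s n' H' := by funext a b; exact q1 a b
  have q2 : s n G = s n' G' := by funext a b; exact q2 a b
  obtain ⟨φ, hφ⟩ := align (cc n H G) (cc n' H' G') (η := 1 / M) (by
    intro a
    change |fr n H G a - fr n' H' G' a| ≤ _
    have h3 := q3 a
    have a1 := Nat.floor_le (mul_nonneg hM0.le (hfr0 n H G a))
    have a2 := Nat.lt_floor_add_one (M * fr n H G a)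
    have b1 := Nat.floor_le (mul_nonneg hM0.le (hfr0 n' H' G' a))
    have b2 := Nat.lt_floor_add_one (M * fr n' H' G' a)
    rw [h3] at a1 a2
    rw [le_div_iff₀ hM0, ← abs_of_pos hM0, ← abs_mul, abs_le]
    constructor <;> linarith)
  have hfinal : ε / 4 + ε / 4 + 4 * L * (p * (1 / M)) ≤ ε := by
    have h1 : 8 * L * p / ε ≤ M := by linarith
    rw [div_le_iff₀ hε] at h1
    have : 4 * L * (p * (1 / M)) ≤ ε / 2 := by
      rw [show 4 * L * (p * (1 / (M:ℝ))) = (4 * L * p) / M by ring, div_le_iff₀ hM0]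
      linarith
    linarith
  refine ⟨φ, ?_, ?_⟩
  · have := hφ (adjM H) (adjM H') (fun a b => s n H (e.symm a).1 (e.symm b).1) L (ε / 4) (ε / 4)
      (fun a b => hL _ (hs n H) _ _) (by simpa [cc] using hcs n H) (by simpa [cc, q1] using hcs n' H')
    exact (near_graph_left (graphonOf_graphon _).nice (near_graph_right (stepK_nice _) this)).mono hfinal
  · have := hφ (adjM G) (adjM G') (fun a b => s n G (e.symm a).2 (e.symm b).2) L (ε / 4) (ε / 4)
      (fun a b => hL _ (hs n G) _ _) (by simpa [cc] using hcs n G) (by simpa [cc, q2] using hcs n' G')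
    exact (near_graph_left (graphonOf_graphon _).nice (near_graph_right (stepK_nice _) this)).mono hfinal


/-- weak limit along a filter, tested against bounded measurable functions -/
def wlim (𝒰 : Filter ℕ) (K : ℕ → ℝ → ℝ → ℝ) (u : ℝ → ℝ → ℝ) : Prop :=
  ∀ (h : ℝ × ℝ → ℝ), Measurable h → (∃ C, ∀ z, |h z| ≤ C) →
    Tendsto (fun k => ∫ z, h z * K k z.1 z.2 ∂(lam.prod lam)) 𝒰
      (𝓝 (∫ z, h z * u z.1 z.2 ∂(lam.prod lam)))

theorem exists_wlim (𝒰 : Ultrafilter ℕ) (K : ℕ → ℝ → ℝ → ℝ) (hK : ∀ k, IsGraphon (K k)) :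
    ∃ u : ℝ → ℝ → ℝ, Measurable (Function.uncurry u) ∧
      Integrable (fun z : ℝ × ℝ => u z.1 z.2) (lam.prod lam) ∧ wlim 𝒰 K u := by
  set μ := lam.prod lam with hμ
  have mem : ∀ h : ℝ × ℝ → ℝ, Measurable h → (∃ C, ∀ z, |h z| ≤ C) → MemLp h 2 μ := by
    rintro h hm ⟨C, hC⟩
    exact MemLp.of_bound hm.aestronglyMeasurable C (ae_of_all _ fun z => by simpa using hC z)
  have mK : ∀ k, MemLp (fun z : ℝ × ℝ => K k z.1 z.2) 2 μ := fun k =>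
    mem _ (hK k).1 ⟨1, fun z => by
      rw [abs_of_nonneg ((hK k).2.2 _ _).1]; exact ((hK k).2.2 _ _).2⟩
  let v : ℕ → Lp ℝ 2 μ := fun k => (mK k).toLp _
  have hv : ∀ k, ‖v k‖ ≤ 1 := by
    intro k
    have := Lp.norm_le_of_ae_bound (f := v k) (C := 1) zero_le_one (by
      filter_upwards [(mK k).coeFn_toLp] with z hz
      rw [hz, Real.norm_eq_abs, abs_of_nonneg ((hK k).2.2 _ _).1]; exact ((hK k).2.2 _ _).2)
    simpa [measureUnivNNReal, hμ] using this
  let d : ℕ → WeakDual ℝ (Lp ℝ 2 μ) := fun k => StrongDual.toWeakDual (InnerProductSpace.toDual ℝ _ (v k))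
  have hc := WeakDual.isCompact_closedBall (𝕜 := ℝ) (0 : StrongDual ℝ (Lp ℝ 2 μ)) 1
  obtain ⟨x, hx, hle⟩ := hc.ultrafilter_le_nhds (𝒰.map d) (by
    rw [le_principal_iff, Ultrafilter.mem_coe, Ultrafilter.mem_map]
    refine Filter.univ_mem' fun k => ?_
    simp [d, hv])
  set w : Lp ℝ 2 μ := (InnerProductSpace.toDual ℝ _).symm (WeakDual.toStrongDual x) with hw
  have hws : AEStronglyMeasurable (w : ℝ × ℝ → ℝ) μ := (Lp.memLp w).1
  let u := hws.mk
  have hum : Measurable u := hws.stronglyMeasurable_mk.measurable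
  have hue : w =ᵐ[μ] u := hws.ae_eq_mk
  refine ⟨fun x y => u (x, y), hum, ?_, ?_⟩
  · exact ((Lp.memLp w).integrable (by norm_num)).congr hue
  · intro h hm hb
    have mh := mem h hm hb
    have t := ((WeakDual.eval_continuous (mh.toLp h)).tendsto x).comp (show Tendsto d 𝒰 (𝓝 x) from hle)
    have e1 : x (mh.toLp h) = ∫ z, h z * u (z.1, z.2) ∂μ := by
      have : x (mh.toLp h) = inner ℝ w (mh.toLp h) := by
        rw [hw, InnerProductSpace.toDual_symm_apply]; rfl
      rw [this, L2.inner_def]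
      refine integral_congr_ae ?_
      filter_upwards [hue, mh.coeFn_toLp] with z h1 h2
      simp [h1, h2]
    have e2 : ∀ k, (d k) (mh.toLp h) = ∫ z, h z * K k z.1 z.2 ∂μ := by
      intro k
      have : d k (mh.toLp h) = inner ℝ (v k) (mh.toLp h) := rfl
      rw [this, L2.inner_def]
      refine integral_congr_ae ?_
      filter_upwards [(mK k).coeFn_toLp, mh.coeFn_toLp] with z h1 h2
      simp [v, h1, h2]
    rw [e1] at t
    exact t.congr fun k => e2 k

theorem wlim_le {𝒰 : Filter ℕ} [𝒰.NeBot] {K J : ℕ → ℝ → ℝ → ℝ} {u v : ℝ → ℝ → ℝ}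
    (hK : ∀ k, Nice (K k)) (hJ : ∀ k, Nice (J k))
    (hu : Integrable (fun z : ℝ × ℝ => u z.1 z.2) (lam.prod lam))
    (hv : Integrable (fun z : ℝ × ℝ => v z.1 z.2) (lam.prod lam))
    (h1 : wlim 𝒰 K u) (h2 : wlim 𝒰 J v) (hle : ∀ k x y, K k x y ≤ J k x y) :
    ∀ᵐ z ∂(lam.prod lam), u z.1 z.2 ≤ v z.1 z.2 := by
  refine ae_le_of_forall_setIntegral_le hu hv fun S hS _ => ?_
  have hb : ∃ C, ∀ z : ℝ × ℝ, |S.indicator (fun _ => (1:ℝ)) z| ≤ C := ⟨1, fun z => by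
    by_cases hz : z ∈ S <;> simp [hz]⟩
  have hm : Measurable (S.indicator (fun _ : ℝ × ℝ => (1:ℝ))) := measurable_const.indicator hS
  have e : ∀ w : ℝ → ℝ → ℝ, ∫ z, S.indicator (fun _ => (1:ℝ)) z * w z.1 z.2 ∂(lam.prod lam)
      = ∫ z in S, w z.1 z.2 ∂(lam.prod lam) := by
    intro w
    rw [← integral_indicator hS]
    congr 1; funext z
    by_cases hz : z ∈ S <;> simp [hz]
  have t1 := h1 _ hm hb
  have t2 := h2 _ hm hb
  simp only [e] at t1 t2
  exact le_of_tendsto_of_tendsto' t1 t2 fun k => setIntegral_mono ((hK k).integrable _).integrableOn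
    ((hJ k).integrable _).integrableOn fun z => hle k _ _

theorem integral_swap' (F : ℝ × ℝ → ℝ) : ∫ z, F z.swap ∂(lam.prod lam) = ∫ z, F z ∂(lam.prod lam) :=
  integral_prod_swap F

theorem exists_wlim_graphon (𝒰 : Ultrafilter ℕ) (K : ℕ → ℝ → ℝ → ℝ) (hK : ∀ k, IsGraphon (K k)) :
    ∃ U : ℝ → ℝ → ℝ, IsGraphon U ∧ wlim 𝒰 K U := by
  obtain ⟨u, hum, hui, hu⟩ := exists_wlim 𝒰 K hK
  have n0 : Nice (fun _ _ => 0) := ⟨measurable_const, 0, by simp⟩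
  have n1 : Nice (fun _ _ => 1) := ⟨measurable_const, 1, by simp⟩
  have a0 := wlim_le (𝒰 := 𝒰) (K := fun _ _ _ => 0) (u := fun _ _ => 0) (fun _ => n0) (fun k => (hK k).nice)
    (n0.integrable _) hui (fun h _ _ => tendsto_const_nhds) hu (fun k x y => ((hK k).2.2 x y).1)
  have a1 := wlim_le (𝒰 := 𝒰) (J := fun _ _ _ => 1) (v := fun _ _ => 1) (fun k => (hK k).nice) (fun _ => n1)
    hui (n1.integrable _) hu (fun h _ _ => tendsto_const_nhds) (fun k x y => ((hK k).2.2 x y).2)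
  have hus : wlim 𝒰 K (fun x y => u y x) := by
    intro h hm hb
    have := hu (fun z => h z.swap) (hm.comp measurable_swap) ⟨hb.choose, fun z => hb.choose_spec _⟩
    rw [← integral_swap'] at this
    refine (this.congr fun k => ?_)
    rw [← integral_swap']
    congr 1; funext z
    simp [(hK k).2.1 z.1 z.2]
  have hsi : Integrable (fun z : ℝ × ℝ => u z.2 z.1) (lam.prod lam) := hui.swap
  have s1 := wlim_le (𝒰 := 𝒰) (fun k => (hK k).nice) (fun k => (hK k).nice) hui hsi hu hus
    (fun k x y => le_refl _)
  have s2 := wlim_le (𝒰 := 𝒰) (fun k => (hK k).nice) (fun k => (hK k).nice) hsi hui hus hu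
    (fun k x y => le_refl _)
  refine ⟨fun x y => max 0 (min 1 ((u x y + u y x) / 2)), ⟨?_, ?_, ?_⟩, ?_⟩
  · have : Measurable (fun z : ℝ × ℝ => u z.1 z.2) := hum
    have h2 : Measurable (fun z : ℝ × ℝ => u z.2 z.1) := hum.comp measurable_swap
    exact measurable_const.max (measurable_const.min ((this.add h2).div_const 2))
  · intro x y; simp only [add_comm (u x y)]
  · intro x y; exact ⟨le_max_left _ _, max_le zero_le_one (min_le_left _ _)⟩
  · intro h hm hb
    refine Tendsto.congr' (EventuallyEq.rfl) ?_
    have := hu h hm hb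
    convert this using 2
    refine integral_congr_ae ?_
    filter_upwards [a0, a1, s1, s2] with z h1 h2 h3 h4
    have : (u z.1 z.2 + u z.2 z.1) / 2 = u z.1 z.2 := by linarith
    simp only [this]
    rw [min_eq_right h2, max_eq_right h1]

theorem cutLE_lim {𝒰 : Filter ℕ} [𝒰.NeBot] {K : ℕ → ℝ → ℝ → ℝ} {U V : ℝ → ℝ → ℝ}
    (hK : ∀ k, Nice (K k)) (hU : Nice U) (hV : Nice V) (h : wlim 𝒰 K U) {ε : ℝ}
    (hc : ∀ᶠ k in 𝒰, cutLE (fun x y => V x y - K k x y) ε) : cutLE (fun x y => V x y - U x y) ε := by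
  intro f g hf hg
  have hfg := hf.nice_mul hg
  have t := h (fun z => f z.1 * g z.2) hfg.1 ⟨hfg.2.choose, fun z => hfg.2.choose_spec _ _⟩
  have e : ∀ J, Nice J → ∫ z, f z.1 * g z.2 * (V z.1 z.2 - J z.1 z.2) ∂(lam.prod lam)
      = ∫ z, f z.1 * g z.2 * V z.1 z.2 ∂(lam.prod lam) - ∫ z, f z.1 * g z.2 * J z.1 z.2 ∂(lam.prod lam) := by
    intro J hJ
    rw [← integral_sub (hV.integrable_test hf hg _) (hJ.integrable_test hf hg _)]
    congr 1; funext z; ring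
  rw [e U hU]
  refine le_of_tendsto ((tendsto_const_nhds.sub t).abs) ?_
  filter_upwards [hc] with k hk
  have := hk f g hf hg
  rwa [e _ (hK k)] at this

/-- Compactness of pairs of graphs. -/
theorem compact_pairs (n : ℕ → ℕ) [∀ m, NeZero (n m)] (H G : ∀ m, SimpleGraph (Fin (n m)))
    (hHG : ∀ m, H m ≤ G m) : ∃ (U V : ℝ → ℝ → ℝ) (g : ℕ → ℕ) (ψ : ℕ → InvMP), IsGraphon U ∧ IsGraphon V ∧
      (∀ᵐ z ∂(lam.prod lam), U z.1 z.2 ≤ V z.1 z.2) ∧ (∀ k, k ≤ g k) ∧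
      ∀ k, cutLE (fun x y => pull (graphonOf (H (g k))) (ψ k) x y - U x y) (2 * (1 / 2) ^ k) ∧
        cutLE (fun x y => pull (graphonOf (G (g k))) (ψ k) x y - V x y) (2 * (1 / 2) ^ k) := by
  let 𝒰 : Ultrafilter ℕ := hyperfilter ℕ
  have hle : (𝒰 : Filter ℕ) ≤ atTop := by
    rw [← Nat.cofinite_eq_atTop]; exact hyperfilter_le_cofinite
  have htb := fun k : ℕ => total_bdd ((1 / 2 : ℝ) ^ k) (by positivity)
  choose Q hQ col hcol using htb
  have hq : ∀ k, ∃ q : Q k, ∀ᶠ m in 𝒰, col k (n m) (H m) (G m) = q := by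
    intro k
    have := hQ k
    obtain ⟨q, hq⟩ := (𝒰.map (fun m => col k (n m) (H m) (G m))).eq_pure_of_finite
    refine ⟨q, ?_⟩
    have : {q} ∈ 𝒰.map (fun m => col k (n m) (H m) (G m)) := by rw [hq]; exact rfl
    exact this
  choose q hq using hq
  have hg : ∀ k, ∃ m, k ≤ m ∧ ∀ j ∈ Finset.range (k + 1), col j (n m) (H m) (G m) = q j := by
    intro k
    exact (((eventually_ge_atTop k).filter_mono hle).and ((Finset.eventually_all _).2 fun j _ => hq j)).exists
  choose g hgk hg using hg
  have hφ : ∀ k, ∃ φ, near (graphonOf (H (g k))) (graphonOf (H (g (k + 1)))) φ ((1 / 2 : ℝ) ^ k) ∧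
      near (graphonOf (G (g k))) (graphonOf (G (g (k + 1)))) φ ((1 / 2 : ℝ) ^ k) := by
    intro k
    apply hcol k
    rw [hg k k (by simp), hg (k + 1) k (by simp)]
  choose φ hφ using hφ
  let ψ : ℕ → InvMP := fun k => Nat.rec InvMP.refl (fun k p => p.trans (φ k)) k
  have hψ : ∀ k, ψ (k + 1) = (ψ k).trans (φ k) := fun k => rfl
  have gr : ∀ (F : ∀ m, SimpleGraph (Fin (n m))) k, IsGraphon (pull (graphonOf (F (g k))) (ψ k)) :=
    fun F k => (graphonOf_graphon _).pull _
  have key : ∀ F : ∀ m, SimpleGraph (Fin (n m)), (∀ k, near (graphonOf (F (g k)))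
      (graphonOf (F (g (k + 1)))) (φ k) ((1 / 2 : ℝ) ^ k)) → ∀ k i,
      cutLE (fun x y => pull (graphonOf (F (g k))) (ψ k) x y
        - pull (graphonOf (F (g (k + i)))) (ψ (k + i)) x y) (2 * (1 / 2) ^ k - 2 * (1 / 2) ^ (k + i)) := by
    intro F hF k i
    induction i with
    | zero => 
      have := cutLE_of_ae ((gr F k).nice.sub (gr F k).nice) (ae_of_all _ fun z => sub_self _)
      simpa using this
    | succ i ih =>
      have h1 := (hF (k + i)).comp ((graphonOf_graphon _).nice.sub ((graphonOf_graphon _).nice.pull _)) (ψ (k + i))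
      have h2 := ih.tri (gr F k).nice (gr F (k + i)).nice (gr F (k + i + 1)).nice h1
      refine cutLE.mono h2 (le_of_eq ?_)
      ring
  obtain ⟨U, hU, hUl⟩ := exists_wlim_graphon 𝒰 _ (gr H)
  obtain ⟨V, hV, hVl⟩ := exists_wlim_graphon 𝒰 _ (gr G)
  refine ⟨U, V, g, ψ, hU, hV, ?_, hgk, fun k => ⟨?_, ?_⟩⟩
  · refine wlim_le (fun k => (gr H k).nice) (fun k => (gr G k).nice) (hU.nice.integrable _)
      (hV.nice.integrable _) hUl hVl fun k x y => ?_
    unfold pull graphonOf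
    split_ifs with h1 h2
    · rfl
    · obtain ⟨i, j, h, h'⟩ := h1
      exact absurd ⟨i, j, hHG _ h, h'⟩ h2
    · exact zero_le_one
    · rfl
  · refine cutLE_lim (fun k => (gr H k).nice) hU.nice (gr H k).nice hUl ?_
    filter_upwards [(eventually_ge_atTop k).filter_mono hle] with l hl
    obtain ⟨i, rfl⟩ := Nat.exists_eq_add_of_le hl
    exact (key H (fun k => (hφ k).1) k i).mono (by linarith [show (0:ℝ) < (1/2)^(k+i) by positivity])
  · refine cutLE_lim (fun k => (gr G k).nice) hV.nice (gr G k).nice hVl ?_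
    filter_upwards [(eventually_ge_atTop k).filter_mono hle] with l hl
    obtain ⟨i, rfl⟩ := Nat.exists_eq_add_of_le hl
    exact (key G (fun k => (hφ k).2) k i).mono (by linarith [show (0:ℝ) < (1/2)^(k+i) by positivity])


abbrev piL (k : ℕ) : Measure (Fin k → ℝ) := Measure.pi fun _ => lam

theorem cube_measure (k : ℕ) : volume.restrict (cube k) = piL k := by
  rw [cube, volume_pi, Measure.restrict_pi_pi]

theorem update_mp {k : ℕ} (i : Fin k) : MeasurePreserving
    (fun z : (Fin k → ℝ) × ℝ => Function.update z.1 i z.2) ((piL k).prod lam) (piL k) := by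
  have hm : Measurable (fun z : (Fin k → ℝ) × ℝ => Function.update z.1 i z.2) := by
    refine measurable_pi_iff.2 fun l => ?_
    by_cases h : l = i
    · subst h; simpa using measurable_snd
    · simp only [Function.update_of_ne h]; exact (measurable_pi_apply l).comp measurable_fst
  refine ⟨hm, (Measure.pi_eq fun S hS => ?_).symm⟩
  rw [Measure.map_apply hm (MeasurableSet.univ_pi hS)]
  have : (fun z : (Fin k → ℝ) × ℝ => Function.update z.1 i z.2) ⁻¹' Set.univ.pi S
      = (Set.univ.pi (Function.update S i Set.univ)) ×ˢ S i := by
    ext ⟨x, s⟩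
    simp only [Set.mem_preimage, Set.mem_pi, Set.mem_univ, true_implies, Set.mem_prod]
    constructor
    · intro h
      refine ⟨fun l => ?_, by simpa using h i⟩
      by_cases hl : l = i
      · subst hl; simp
      · simpa [hl] using h l
    · rintro ⟨h1, h2⟩ l
      by_cases hl : l = i
      · subst hl; simpa using h2
      · simpa [hl] using h1 l
  rw [this, Measure.prod_prod, Measure.pi_pi]
  have e : (fun l => lam (Function.update S i Set.univ l))
      = Function.update (fun l => lam (S l)) i 1 := by
    funext l
    by_cases hl : l = i
    · subst hl; simp
    · simp [hl]
  rw [e, Finset.prod_update_of_mem (Finset.mem_univ _), one_mul, mul_comm,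
    Finset.sdiff_singleton_eq_erase, Finset.mul_prod_erase _ (fun l => lam (S l)) (Finset.mem_univ i)]

theorem update2_mp {k : ℕ} (i j : Fin k) : MeasurePreserving
    (fun z : (Fin k → ℝ) × (ℝ × ℝ) => Function.update (Function.update z.1 i z.2.1) j z.2.2)
    ((piL k).prod (lam.prod lam)) (piL k) := by
  have h1 := (update_mp i).prod (MeasurePreserving.id lam)
  have h2 := (measurePreserving_prodAssoc (piL k) lam lam).symm
  exact (update_mp j).comp (h1.comp h2)

/-- the single edge estimate -/
theorem edge_est {k : ℕ} {i j : Fin k} (hij : i ≠ j) {D : ℝ → ℝ → ℝ} (hD : Nice D) {ε : ℝ}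
    (h : cutLE D ε) {Φ Ψ : (Fin k → ℝ) → ℝ} (hΦ : Measurable Φ) (hΨ : Measurable Ψ)
    (bΦ : ∀ x, Φ x ∈ Set.Icc (0:ℝ) 1) (bΨ : ∀ x, Ψ x ∈ Set.Icc (0:ℝ) 1)
    (dΦ : ∀ x t, Φ (Function.update x j t) = Φ x) (dΨ : ∀ x t, Ψ (Function.update x i t) = Ψ x) :
    |∫ x, D (x i) (x j) * (Φ x * Ψ x) ∂(piL k)| ≤ ε := by
  have hmp := update2_mp i j
  have hDm : Measurable (fun x : Fin k → ℝ => D (x i) (x j)) :=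
    hD.1.comp (f := fun x : Fin k → ℝ => (x i, x j)) (by fun_prop)
  obtain ⟨C, hC⟩ := hD.2
  have hC0 : 0 ≤ C := (abs_nonneg _).trans (hC 0 0)
  have hFm : Measurable (fun x : Fin k → ℝ => D (x i) (x j) * (Φ x * Ψ x)) := hDm.mul (hΦ.mul hΨ)
  have hFi : Integrable (fun x : Fin k → ℝ => D (x i) (x j) * (Φ x * Ψ x)) (piL k) := by
    refine Integrable.of_bound hFm.aestronglyMeasurable C (ae_of_all _ fun x => ?_)
    rw [norm_mul, norm_mul, Real.norm_eq_abs, Real.norm_eq_abs, Real.norm_eq_abs,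
      abs_of_nonneg (bΦ x).1, abs_of_nonneg (bΨ x).1]
    have := mul_le_one₀ (bΦ x).2 (bΨ x).1 (bΨ x).2
    calc _ ≤ C * 1 := by
          gcongr
          · exact mul_nonneg (bΦ x).1 (bΨ x).1
          · exact hC _ _
      _ = C := mul_one C
  rw [← hmp.map_eq, integral_map hmp.measurable.aemeasurable hFm.aestronglyMeasurable]
  have hFi' := (hmp.integrable_comp hFm.aestronglyMeasurable).2 hFi
  rw [integral_prod _ (by exact hFi')]
  have hin : ∀ x : Fin k → ℝ, |∫ z : ℝ × ℝ, D (Function.update (Function.update x i z.1) j z.2 i)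
      (Function.update (Function.update x i z.1) j z.2 j) *
      (Φ (Function.update (Function.update x i z.1) j z.2) *
        Ψ (Function.update (Function.update x i z.1) j z.2)) ∂(lam.prod lam)| ≤ ε := by
    intro x
    have hf : Unitv (fun s => Φ (Function.update x i s)) :=
      ⟨hΦ.comp (measurable_update x), fun s => bΦ _⟩
    have hg : Unitv (fun s => Ψ (Function.update x j s)) :=
      ⟨hΨ.comp (measurable_update x), fun s => bΨ _⟩
    refine le_trans (le_of_eq ?_) (h _ _ hf hg)
    congr 1
    congr 1
    funext z
    rw [dΦ, Function.update_comm hij, dΨ, Function.update_self, Function.update_comm hij.symm,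
      Function.update_self]
    ring
  have hc := norm_integral_le_of_norm_le_const (μ := piL k) (C := ε) (f := fun x =>
    ∫ z : ℝ × ℝ, D (Function.update (Function.update x i z.1) j z.2 i)
      (Function.update (Function.update x i z.1) j z.2 j) *
      (Φ (Function.update (Function.update x i z.1) j z.2) *
        Ψ (Function.update (Function.update x i z.1) j z.2)) ∂(lam.prod lam)) (ae_of_all _ hin)
  rw [probReal_univ, mul_one] at hc
  exact hc

/-- hom product over a set of pairs -/
def hp {k : ℕ} (E : Finset (Fin k × Fin k)) (W : ℝ → ℝ → ℝ) (x : Fin k → ℝ) : ℝ :=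
  ∏ e ∈ E, W (x e.1) (x e.2)

theorem hp_measurable {k : ℕ} (E : Finset (Fin k × Fin k)) {W : ℝ → ℝ → ℝ}
    (hW : Measurable (Function.uncurry W)) : Measurable (hp E W) := by
  refine Finset.measurable_fun_prod _ fun e _ => ?_
  exact hW.comp (f := fun x : Fin k → ℝ => (x e.1, x e.2)) (by fun_prop)

theorem hp_mem {k : ℕ} (E : Finset (Fin k × Fin k)) {W : ℝ → ℝ → ℝ}
    (hW : IsGraphon W) (x) : hp E W x ∈ Set.Icc (0:ℝ) 1 :=
  ⟨Finset.prod_nonneg fun _ _ => (hW.2.2 _ _).1,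
    Finset.prod_le_one (fun _ _ => (hW.2.2 _ _).1) fun _ _ => (hW.2.2 _ _).2⟩

theorem hp_dep {k : ℕ} (E : Finset (Fin k × Fin k)) (W : ℝ → ℝ → ℝ) (j : Fin k)
    (hE : ∀ e ∈ E, e.1 ≠ j ∧ e.2 ≠ j) (x : Fin k → ℝ) (t : ℝ) :
    hp E W (Function.update x j t) = hp E W x := by
  refine Finset.prod_congr rfl fun e he => ?_
  rw [Function.update_of_ne (hE e he).1, Function.update_of_ne (hE e he).2]

theorem hp_split {k : ℕ} (E : Finset (Fin k × Fin k)) (W : ℝ → ℝ → ℝ) (j : Fin k) (x : Fin k → ℝ) :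
    hp E W x = hp (E.filter fun e => e.1 ≠ j ∧ e.2 ≠ j) W x * hp (E.filter fun e => ¬ (e.1 ≠ j ∧ e.2 ≠ j)) W x :=
  (Finset.prod_filter_mul_prod_filter_not _ _ _).symm

theorem hp_integrable {k : ℕ} (E R : Finset (Fin k × Fin k)) {U W : ℝ → ℝ → ℝ}
    (hU : IsGraphon U) (hW : IsGraphon W) : Integrable (fun x => hp E U x * hp R W x) (piL k) := by
  refine Integrable.of_bound ((hp_measurable E hU.1).mul (hp_measurable R hW.1)).aestronglyMeasurable 1
    (ae_of_all _ fun x => ?_)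
  have h1 := hp_mem E hU x
  have h2 := hp_mem R hW x
  rw [norm_mul, Real.norm_eq_abs, Real.norm_eq_abs, abs_of_nonneg h1.1, abs_of_nonneg h2.1]
  exact mul_le_one₀ h1.2 h2.1 h2.2

theorem counting_aux {k : ℕ} {U W : ℝ → ℝ → ℝ} (hU : IsGraphon U) (hW : IsGraphon W) {ε : ℝ}
    (h : cutLE (fun x y => U x y - W x y) ε) (E : Finset (Fin k × Fin k)) :
    ∀ R : Finset (Fin k × Fin k), Disjoint E R → (∀ e ∈ E ∪ R, e.1 < e.2) →
    |∫ x, hp E U x * hp R W x ∂(piL k) - ∫ x, hp E W x * hp R W x ∂(piL k)| ≤ E.card * ε := by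
  induction E using Finset.induction_on with
  | empty => intro R _ _; simp [hp]
  | insert e E he ih =>
    intro R hd hlt
    have heR : e ∉ R := Finset.disjoint_left.1 hd (Finset.mem_insert_self _ _)
    have hER : Disjoint E R := Finset.disjoint_of_subset_left (Finset.subset_insert _ _) hd
    have ih' := ih (insert e R) (by
      rw [Finset.disjoint_insert_right]; exact ⟨he, hER⟩) (by
      intro e' he'
      apply hlt
      simp only [Finset.mem_union, Finset.mem_insert] at he' ⊢
      tauto)
    have elt : e.1 < e.2 := hlt e (by simp)
    have hne : ∀ e' ∈ E ∪ R, ¬ ((e'.1 = e.2 ∨ e'.2 = e.2) ∧ (e'.1 = e.1 ∨ e'.2 = e.1)) := by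
      intro e' he' hh
      have l : e'.1 < e'.2 := hlt e' (by simp only [Finset.mem_union, Finset.mem_insert] at he' ⊢; tauto)
      have n : e' ≠ e := by
        rintro rfl
        rcases Finset.mem_union.1 he' with h | h
        · exact he h
        · exact heR h
      apply n
      rcases hh with ⟨h1 | h1, h2 | h2⟩
      · rw [h1] at h2; exact absurd h2 elt.ne'
      · rw [h1, h2] at l; exact absurd l elt.asymm
      · exact Prod.ext h2 h1
      · rw [h1] at h2; exact absurd h2 elt.ne'
    have hU' : IsGraphon U := hU
    set p : Fin k × Fin k → Prop := fun e' => e'.1 ≠ e.2 ∧ e'.2 ≠ e.2 with hp_def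
    have est := edge_est (k := k) elt.ne (hU.nice.sub hW.nice) h
      (Φ := fun x => hp (E.filter p) U x * hp (R.filter p) W x)
      (Ψ := fun x => hp (E.filter fun e => ¬ p e) U x * hp (R.filter fun e => ¬ p e) W x)
      ((hp_measurable _ hU.1).mul (hp_measurable _ hW.1))
      ((hp_measurable _ hU.1).mul (hp_measurable _ hW.1))
      (fun x => ⟨mul_nonneg (hp_mem _ hU x).1 (hp_mem _ hW x).1,
        mul_le_one₀ (hp_mem _ hU x).2 (hp_mem _ hW x).1 (hp_mem _ hW x).2⟩)
      (fun x => ⟨mul_nonneg (hp_mem _ hU x).1 (hp_mem _ hW x).1,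
        mul_le_one₀ (hp_mem _ hU x).2 (hp_mem _ hW x).1 (hp_mem _ hW x).2⟩)
      (fun x t => by
        rw [hp_dep _ _ _ (fun e he => (Finset.mem_filter.1 he).2), hp_dep _ _ _ (fun e he => (Finset.mem_filter.1 he).2)])
      (fun x t => by
        have key : ∀ Z : Finset (Fin k × Fin k), Z ⊆ E ∪ R → ∀ e' ∈ Z.filter (fun e => ¬ p e), e'.1 ≠ e.1 ∧ e'.2 ≠ e.1 := by
          intro Z hZ e' he'
          rw [Finset.mem_filter] at he'
          have := hne e' (hZ he'.1)
          have h2 := he'.2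
          simp only [hp_def] at h2
          tauto
        rw [hp_dep _ _ _ (key E Finset.subset_union_left), hp_dep _ _ _ (key R Finset.subset_union_right)])
    have e1 : ∀ x : Fin k → ℝ, hp (insert e E) U x * hp R W x
        = (U (x e.1) (x e.2) - W (x e.1) (x e.2)) * (hp (E.filter p) U x * hp (R.filter p) W x *
          (hp (E.filter fun e => ¬ p e) U x * hp (R.filter fun e => ¬ p e) W x))
          + hp E U x * hp (insert e R) W x := by
      intro x
      have s1 := hp_split E U e.2 x
      have s2 := hp_split R W e.2 x
      have s3 : hp (insert e E) U x = U (x e.1) (x e.2) * hp E U x := Finset.prod_insert he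
      have s4 : hp (insert e R) W x = W (x e.1) (x e.2) * hp R W x := Finset.prod_insert heR
      rw [s3, s4, s1, s2]
      ring
    have e2 : ∀ x : Fin k → ℝ, hp (insert e E) W x * hp R W x = hp E W x * hp (insert e R) W x := by
      intro x
      have s3 : hp (insert e E) W x = W (x e.1) (x e.2) * hp E W x := Finset.prod_insert he
      have s4 : hp (insert e R) W x = W (x e.1) (x e.2) * hp R W x := Finset.prod_insert heR
      rw [s3, s4]; ring
    have i1 : Integrable (fun x => (U (x e.1) (x e.2) - W (x e.1) (x e.2)) * (hp (E.filter p) U x * hp (R.filter p) W x *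
          (hp (E.filter fun e => ¬ p e) U x * hp (R.filter fun e => ¬ p e) W x))) (piL k) := by
      have := (hp_integrable (insert e E) R hU hW).sub (hp_integrable E (insert e R) hU hW)
      refine this.congr (ae_of_all _ fun x => ?_)
      simp only [Pi.sub_apply]
      rw [e1 x]; ring
    simp only [e2]
    simp only [e1]
    rw [integral_add i1 (hp_integrable E (insert e R) hU hW), Finset.card_insert_of_notMem he]
    push_cast
    rw [add_sub_assoc]
    refine (abs_add_le _ _).trans ?_
    linarith

open Classical in
theorem homDensity_eq {k : ℕ} (F : SimpleGraph (Fin k)) (W : ℝ → ℝ → ℝ) :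
    homDensity F W = ∫ x, hp (Finset.univ.filter fun e : Fin k × Fin k => e.1 < e.2 ∧ F.Adj e.1 e.2) W x ∂(piL k) := by
  rw [homDensity, cube_measure]
  congr 1; funext x
  rw [hp, Finset.prod_filter, ← Finset.univ_product_univ, Finset.prod_product]

theorem hp_pull {k : ℕ} (E : Finset (Fin k × Fin k)) {W : ℝ → ℝ → ℝ} (hW : IsGraphon W) (φ : InvMP) :
    ∫ x, hp E (pull W φ) x ∂(piL k) = ∫ x, hp E W x ∂(piL k) := by
  have h := measurePreserving_pi (fun _ : Fin k => lam) (fun _ : Fin k => lam) (fun _ => φ.measurePreserving)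
  conv_rhs => rw [piL, ← h.map_eq]
  rw [integral_map h.measurable.aemeasurable (hp_measurable E hW.1).aestronglyMeasurable]
  rfl

theorem iso_of_near {U W : ℝ → ℝ → ℝ} (hU : IsGraphon U) (hW : IsGraphon W)
    (h : ∀ ε > 0, ∃ φ, near U W φ ε) : GraphonIso U W := by
  classical
  intro k F
  rw [homDensity_eq, homDensity_eq]
  set E := Finset.univ.filter fun e : Fin k × Fin k => e.1 < e.2 ∧ F.Adj e.1 e.2 with hE
  rw [← sub_eq_zero, ← abs_eq_zero]
  refine le_antisymm (le_of_forall_pos_le_add fun ε hε => ?_) (abs_nonneg _)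
  obtain ⟨φ, hφ⟩ := h (ε / (E.card + 1)) (by positivity)
  have := counting_aux hU (hW.pull φ) hφ E ∅ (by simp) (by simp [hE]; tauto)
  rw [← hp_pull E hW φ]
  have e : ∀ x : Fin k → ℝ, hp ∅ (pull W φ) x = 1 := fun x => rfl
  simp only [e, mul_one] at this
  refine this.trans ?_
  rw [zero_add, mul_div_assoc', div_le_iff₀ (by positivity)]
  nlinarith

theorem aeLE_of_ae {U W : ℝ → ℝ → ℝ} (h : ∀ᵐ z ∂(lam.prod lam), U z.1 z.2 ≤ W z.1 z.2) : aeLE U W := by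
  rw [Measure.prod_restrict] at h
  exact h

theorem ae_of_aeLE {U W : ℝ → ℝ → ℝ} (h : aeLE U W) : ∀ᵐ z ∂(lam.prod lam), U z.1 z.2 ≤ W z.1 z.2 := by
  rw [Measure.prod_restrict]
  exact h

theorem GraphonIso.refl (U : ℝ → ℝ → ℝ) : GraphonIso U U := fun _ _ => rfl

theorem subset_dir (P : GraphProp) : closureP (upP P) ⊆ upR (closureP P) := by
  rintro W ⟨hW, n, G, hG, hn, ht⟩
  choose H hH hHG using hG
  obtain ⟨m0, hm0⟩ := (hn.eventually_ge_atTop 1).exists_forall_of_atTop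
  have : ∀ m, NeZero (n (m + m0)) := fun m => ⟨by have := hm0 (m + m0) (by omega); omega⟩
  obtain ⟨U, V, g, ψ, hU, hV, hUV, hg, hk⟩ := compact_pairs (fun m => n (m + m0)) (fun m => H (m + m0))
    (fun m => G (m + m0)) (fun m => hHG _)
  have hgt : Tendsto g atTop atTop := tendsto_atTop_mono hg tendsto_id
  have hgt' : Tendsto (fun k => g k + m0) atTop atTop := tendsto_atTop_mono (fun k => Nat.le_add_right _ _) hgt
  have hp2 : Tendsto (fun k : ℕ => 2 * (1 / 2 : ℝ) ^ k) atTop (𝓝 0) := by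
    simpa using (tendsto_pow_atTop_nhds_zero_of_lt_one (r := (1/2 : ℝ)) (by norm_num) (by norm_num)).const_mul 2
  have hnear : ∀ (F : ∀ m, SimpleGraph (Fin (n m))) (U : ℝ → ℝ → ℝ), IsGraphon U → ∀ k,
      cutLE (fun x y => pull (graphonOf (F (g k + m0))) (ψ k) x y - U x y) (2 * (1 / 2) ^ k) →
      near U (graphonOf (F (g k + m0))) (ψ k) (2 * (1 / 2) ^ k) := fun F U hU k h => h.symm
  refine ⟨hW, U, ⟨hU, fun k => n (g k + m0), fun k => H (g k + m0), fun k => hH _, hn.comp hgt', ?_⟩,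
    U, V, hU, hV, GraphonIso.refl U, ?_, aeLE_of_ae hUV⟩
  · refine squeeze_zero (fun k => deltaCut_nonneg _ _) (fun k => ?_) hp2
    exact deltaCut_le (graphonOf_graphon _).nice hU.nice
      ((hnear H U hU k (hk k).1).symm hU.nice (graphonOf_graphon _).nice)
  · refine iso_of_near hW hV fun ε hε => ?_
    have t1 := ht.comp hgt'
    have ev := (t1.eventually (gt_mem_nhds (half_pos hε))).and (hp2.eventually (gt_mem_nhds (half_pos hε)))
    obtain ⟨k, h1, h2⟩ := ev.exists
    obtain ⟨φ, hφ⟩ := exists_near (graphonOf_graphon _).nice hW.nice h1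
    have hs := (hφ.symm (graphonOf_graphon _).nice hW.nice).tri hW.nice (graphonOf_graphon _).nice hV.nice
      ((hnear G V hV k (hk k).2).symm hV.nice (graphonOf_graphon _).nice)
    exact ⟨_, hs.mono (by linarith)⟩


theorem sum_biUnion_le' {α β : Type*} [DecidableEq β] (s : Finset α) (t : α → Finset β) {f : β → ℝ}
    (hf : ∀ b, 0 ≤ f b) : ∑ b ∈ s.biUnion t, f b ≤ ∑ a ∈ s, ∑ b ∈ t a, f b := by
  classical
  induction s using Finset.induction_on with
  | empty => simp
  | insert a s ha ih =>
    rw [Finset.biUnion_insert, Finset.sum_insert ha]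
    have := Finset.sum_union_inter (s₁ := t a) (s₂ := s.biUnion t) (f := f)
    have h5 : 0 ≤ ∑ b ∈ t a ∩ s.biUnion t, f b := Finset.sum_nonneg fun F _ => hf F
    linarith

/-- ordered pairs -/
def pairs (k : ℕ) : Finset (Fin k × Fin k) := Finset.univ.filter fun e => e.1 < e.2

open Classical in
theorem sum_graph {k : ℕ} (h : Fin k × Fin k → Bool → ℝ) :
    ∑ F : SimpleGraph (Fin k), ∏ e ∈ pairs k, h e (decide (F.Adj e.1 e.2))
      = ∏ e ∈ pairs k, (h e true + h e false) := by
  let toG : ({e // e ∈ pairs k} → Bool) → SimpleGraph (Fin k) := fun b =>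
    SimpleGraph.fromRel (fun i j => ∃ he : (i, j) ∈ pairs k, b ⟨(i, j), he⟩ = true)
  have hadj : ∀ b (e : {e // e ∈ pairs k}), (toG b).Adj e.1.1 e.1.2 ↔ b e = true := by
    rintro b ⟨⟨i, j⟩, he⟩
    have hlt : i < j := (Finset.mem_filter.1 he).2
    simp only [toG, SimpleGraph.fromRel_adj]
    constructor
    · rintro ⟨_, ⟨h1, h2⟩ | ⟨h1, h2⟩⟩
      · exact h2
      · exact absurd (Finset.mem_filter.1 h1).2 hlt.asymm
    · intro h1
      exact ⟨hlt.ne, Or.inl ⟨he, h1⟩⟩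
  let E : ({e // e ∈ pairs k} → Bool) ≃ SimpleGraph (Fin k) :=
    { toFun := toG
      invFun := fun F e => decide (F.Adj e.1.1 e.1.2)
      left_inv := by
        intro b; funext e
        have := hadj b e
        by_cases hb : b e = true
        · simp [this, hb]
        · simp [this, hb]
      right_inv := by
        intro F
        ext i j
        simp only [toG, SimpleGraph.fromRel_adj, decide_eq_true_eq]
        constructor
        · rintro ⟨_, ⟨h1, h2⟩ | ⟨h1, h2⟩⟩
          · exact h2
          · exact h2.symm
        · intro h
          refine ⟨h.ne, ?_⟩
          rcases lt_or_gt_of_ne h.ne with hl | hl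
          · exact Or.inl ⟨Finset.mem_filter.2 ⟨Finset.mem_univ _, hl⟩, h⟩
          · exact Or.inr ⟨Finset.mem_filter.2 ⟨Finset.mem_univ _, hl⟩, h.symm⟩ }
  rw [← E.sum_comp]
  have e1 : ∀ b, ∏ e ∈ pairs k, h e (decide ((E b).Adj e.1 e.2)) = ∏ e : {e // e ∈ pairs k}, h e (b e) := by
    intro b
    rw [← Finset.prod_coe_sort]
    refine Finset.prod_congr rfl fun e _ => ?_
    congr 1
    have : (E b).Adj e.1.1 e.1.2 ↔ b e = true := hadj b e
    by_cases hb : b e = true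
    · simp [this, hb]
    · simp [this, hb]
  simp only [e1]
  rw [← Finset.prod_coe_sort (pairs k)]
  have := Finset.prod_univ_sum (fun _ : {e // e ∈ pairs k} => (Finset.univ : Finset Bool)) (fun e t => h e t)
  simp only [Fintype.piFinset_univ, Fintype.sum_bool] at this
  exact this.symm

open Classical in
/-- probability weight of a graph -/
def wt {k : ℕ} (p : Fin k → Fin k → ℝ) (F : SimpleGraph (Fin k)) : ℝ :=
  ∏ e ∈ pairs k, if F.Adj e.1 e.2 then p e.1 e.2 else 1 - p e.1 e.2

def Symm01 {k : ℕ} (p : Fin k → Fin k → ℝ) : Prop :=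
  (∀ i j, p i j = p j i) ∧ ∀ i j, p i j ∈ Set.Icc (0:ℝ) 1

theorem wt_nonneg {k : ℕ} {p : Fin k → Fin k → ℝ} (hp : Symm01 p) (F : SimpleGraph (Fin k)) : 0 ≤ wt p F := by
  refine Finset.prod_nonneg fun e _ => ?_
  have := hp.2 e.1 e.2
  split_ifs
  · exact this.1
  · linarith [this.2]

theorem wt_sum {k : ℕ} (p : Fin k → Fin k → ℝ) : ∑ F, wt p F = 1 := by
  classical
  have := sum_graph (k := k) (fun e t => if t then p e.1 e.2 else 1 - p e.1 e.2)
  simp only [decide_eq_true_eq] at this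
  unfold wt
  convert this using 2
  simp

theorem exp_le_quad {x : ℝ} (h : |x| ≤ 1) : Real.exp x ≤ 1 + x + x ^ 2 := by
  have := Real.abs_exp_sub_one_sub_id_le h
  linarith [(abs_le.1 this).2]

theorem bern_mgf {p l : ℝ} (hp : p ∈ Set.Icc (0:ℝ) 1) (hl : |l| ≤ 1) :
    p * Real.exp (l * (1 - p)) + (1 - p) * Real.exp (l * (0 - p)) ≤ Real.exp (l ^ 2) := by
  have h1 : |l * (1 - p)| ≤ 1 := by
    rw [abs_mul]
    exact mul_le_one₀ hl (abs_nonneg _) (abs_le.2 ⟨by linarith [hp.2], by linarith [hp.1]⟩)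
  have h2 : |l * (0 - p)| ≤ 1 := by
    rw [abs_mul]
    exact mul_le_one₀ hl (abs_nonneg _) (abs_le.2 ⟨by linarith [hp.2], by linarith [hp.1]⟩)
  have a1 := mul_le_mul_of_nonneg_left (exp_le_quad h1) hp.1
  have a2 := mul_le_mul_of_nonneg_left (exp_le_quad h2) (sub_nonneg.2 hp.2)
  have a3 := Real.add_one_le_exp (l ^ 2)
  have a4 : l ^ 2 * (p * (1 - p)) ≤ l ^ 2 * 1 := by
    refine mul_le_mul_of_nonneg_left ?_ (sq_nonneg _)
    nlinarith [hp.1, hp.2]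
  nlinarith

theorem pairs_card (k : ℕ) : (pairs k).card ≤ k ^ 2 := by
  refine (Finset.card_filter_le _ _).trans ?_
  simp [sq]

theorem mgf {k : ℕ} {p : Fin k → Fin k → ℝ} (hp : Symm01 p) (d : Fin k × Fin k → ℝ) (l : ℝ)
    (hd : ∀ e, |l * d e| ≤ 1) (hd2 : ∀ e, (d e) ^ 2 ≤ 4) :
    ∑ F, wt p F * Real.exp (l * ∑ e ∈ pairs k, d e * (adjM F e.1 e.2 - p e.1 e.2))
      ≤ Real.exp (4 * l ^ 2 * (k:ℝ) ^ 2) := by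
  classical
  have h := sum_graph (k := k) (fun e t => (if t then p e.1 e.2 else 1 - p e.1 e.2) *
    Real.exp (l * d e * ((if t then 1 else 0) - p e.1 e.2)))
  have e1 : ∀ F : SimpleGraph (Fin k), wt p F * Real.exp (l * ∑ e ∈ pairs k, d e * (adjM F e.1 e.2 - p e.1 e.2))
      = ∏ e ∈ pairs k, ((if decide (F.Adj e.1 e.2) = true then p e.1 e.2 else 1 - p e.1 e.2) *
    Real.exp (l * d e * ((if decide (F.Adj e.1 e.2) = true then 1 else 0) - p e.1 e.2))) := by
    intro F
    rw [Finset.prod_mul_distrib, ← Real.exp_sum, Finset.mul_sum, wt]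
    simp only [decide_eq_true_eq, adjM, mul_assoc]
  rw [Finset.sum_congr rfl fun F _ => e1 F, h]
  calc _ ≤ ∏ e ∈ pairs k, Real.exp (4 * l ^ 2) := by
        refine Finset.prod_le_prod (fun e _ => ?_) fun e _ => ?_
        · have := hp.2 e.1 e.2
          simp
          refine add_nonneg (mul_nonneg this.1 (Real.exp_pos _).le) (mul_nonneg (by linarith [this.2]) (Real.exp_pos _).le)
        · have := bern_mgf (hp.2 e.1 e.2) (hd e)
          simp only [if_true, Bool.false_eq_true, if_false]
          refine this.trans (Real.exp_le_exp.2 ?_)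
          rw [mul_pow]
          nlinarith [hd2 e, sq_nonneg l]
    _ = Real.exp ((pairs k).card * (4 * l ^ 2)) := by
        rw [Finset.prod_const, ← Real.exp_nat_mul]
    _ ≤ _ := by
        refine Real.exp_le_exp.2 ?_
        have : ((pairs k).card : ℝ) ≤ (k:ℝ) ^ 2 := by exact_mod_cast pairs_card k
        nlinarith [sq_nonneg l]

/-- one sided tail -/
theorem tail {k : ℕ} {p : Fin k → Fin k → ℝ} (hp : Symm01 p) (d : Fin k × Fin k → ℝ) (l a : ℝ) (hl : 0 ≤ l)
    (hd : ∀ e, |l * d e| ≤ 1) (hd2 : ∀ e, (d e) ^ 2 ≤ 4) :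
    ∑ F ∈ Finset.univ.filter (fun F : SimpleGraph (Fin k) =>
      a ≤ ∑ e ∈ pairs k, d e * (adjM F e.1 e.2 - p e.1 e.2)), wt p F
      ≤ Real.exp (4 * l ^ 2 * (k:ℝ) ^ 2 - l * a) := by
  have h := mgf hp d l hd hd2
  have : ∑ F ∈ Finset.univ.filter (fun F : SimpleGraph (Fin k) =>
      a ≤ ∑ e ∈ pairs k, d e * (adjM F e.1 e.2 - p e.1 e.2)), wt p F * Real.exp (l * a)
      ≤ Real.exp (4 * l ^ 2 * (k:ℝ) ^ 2) := by
    refine le_trans ?_ h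
    refine (Finset.sum_le_sum fun F hF => ?_).trans (Finset.sum_le_sum_of_subset_of_nonneg
      (Finset.filter_subset _ _) fun F _ _ => mul_nonneg (wt_nonneg hp F) (Real.exp_pos _).le)
    refine mul_le_mul_of_nonneg_left (Real.exp_le_exp.2 ?_) (wt_nonneg hp F)
    exact mul_le_mul_of_nonneg_left (Finset.mem_filter.1 hF).2 hl
  rw [← Finset.sum_mul] at this
  rw [Real.exp_sub, le_div_iff₀ (Real.exp_pos _)]
  exact this

open Classical in
def dST {k : ℕ} (S T : Finset (Fin k)) (e : Fin k × Fin k) : ℝ :=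
  (if e.1 ∈ S ∧ e.2 ∈ T then 1 else 0) + (if e.2 ∈ S ∧ e.1 ∈ T then 1 else 0)

theorem dST_bd {k : ℕ} (S T : Finset (Fin k)) (e : Fin k × Fin k) : 0 ≤ dST S T e ∧ dST S T e ≤ 2 := by
  unfold dST; split_ifs <;> norm_num

theorem sum_pairs {k : ℕ} (f : Fin k → Fin k → ℝ) :
    ∑ i, ∑ j, f i j = ∑ e ∈ pairs k, (f e.1 e.2 + f e.2 e.1) + ∑ i, f i i := by
  have h1 : ∑ i, ∑ j, f i j = ∑ e : Fin k × Fin k, f e.1 e.2 := by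
    rw [← Finset.univ_product_univ, Finset.sum_product]
  have h2 : ∑ e ∈ pairs k, f e.2 e.1 = ∑ e ∈ Finset.univ.filter (fun e : Fin k × Fin k => e.2 < e.1), f e.1 e.2 := by
    refine Finset.sum_bij' (fun e _ => e.swap) (fun e _ => e.swap) ?_ ?_ ?_ ?_ ?_ <;> simp [pairs]
  have h3 : ∑ i, f i i = ∑ e ∈ Finset.univ.filter (fun e : Fin k × Fin k => e.1 = e.2), f e.1 e.2 := by
    refine Finset.sum_bij' (fun i _ => (i, i)) (fun e _ => e.1) ?_ ?_ ?_ ?_ ?_ <;> simp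
  rw [h1, Finset.sum_add_distrib, h2, h3, pairs]
  rw [← Finset.sum_filter_add_sum_filter_not Finset.univ (fun e : Fin k × Fin k => e.1 < e.2), add_assoc]
  congr 1
  rw [← Finset.sum_filter_add_sum_filter_not (Finset.univ.filter fun e : Fin k × Fin k => ¬ e.1 < e.2)
    (fun e : Fin k × Fin k => e.2 < e.1), Finset.filter_filter, Finset.filter_filter]
  congr 1
  · refine Finset.sum_congr (Finset.filter_congr fun e _ => ?_) fun _ _ => rfl
    constructor
    · exact fun h => h.2
    · exact fun h => ⟨h.asymm, h⟩
  · refine Finset.sum_congr (Finset.filter_congr fun e _ => ?_) fun _ _ => rfl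
    constructor
    · exact fun h => le_antisymm (not_lt.1 h.2) (not_lt.1 h.1)
    · exact fun h => by simp [h]

theorem sum_ST {k : ℕ} {p : Fin k → Fin k → ℝ} (hp : Symm01 p) (F : SimpleGraph (Fin k)) (S T : Finset (Fin k)) :
    |∑ i ∈ S, ∑ j ∈ T, (adjM F i j - p i j)| ≤
      |∑ e ∈ pairs k, dST S T e * (adjM F e.1 e.2 - p e.1 e.2)| + k := by
  classical
  have e1 : ∑ i ∈ S, ∑ j ∈ T, (adjM F i j - p i j)
      = ∑ i, ∑ j, (if i ∈ S ∧ j ∈ T then 1 else 0) * (adjM F i j - p i j) := by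
    rw [← Finset.sum_filter_add_sum_filter_not Finset.univ (fun i => i ∈ S)]
    have : ∑ i ∈ Finset.univ.filter (fun i => ¬ i ∈ S), ∑ j, (if i ∈ S ∧ j ∈ T then 1 else 0) * (adjM F i j - p i j) = 0 := by
      refine Finset.sum_eq_zero fun i hi => ?_
      simp at hi
      simp [hi]
    rw [this, add_zero, Finset.filter_mem_eq_inter, Finset.univ_inter]
    refine Finset.sum_congr rfl fun i hi => ?_
    simp [hi]
  have e2 : ∀ i j, adjM F i j = adjM F j i := fun i j => by simp [adjM, SimpleGraph.adj_comm]
  rw [e1, sum_pairs]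
  have e3 : ∑ e ∈ pairs k, ((if e.1 ∈ S ∧ e.2 ∈ T then 1 else 0) * (adjM F e.1 e.2 - p e.1 e.2)
      + (if e.2 ∈ S ∧ e.1 ∈ T then 1 else 0) * (adjM F e.2 e.1 - p e.2 e.1))
      = ∑ e ∈ pairs k, dST S T e * (adjM F e.1 e.2 - p e.1 e.2) := by
    refine Finset.sum_congr rfl fun e _ => ?_
    rw [e2 e.2 e.1, hp.1 e.2 e.1, dST]; ring
  rw [e3]
  refine (abs_add_le _ _).trans (add_le_add le_rfl ?_)
  refine (Finset.abs_sum_le_sum_abs _ _).trans ((Finset.sum_le_sum (g := fun _ => (1:ℝ)) fun i _ => ?_).trans (by simp))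
  have a := adjM_mem F i i
  have b := hp.2 i i
  split_ifs
  · rw [one_mul, abs_le]; constructor <;> linarith [a.1, a.2, b.1, b.2]
  · simp

open Classical in
theorem conc_bound {k : ℕ} {p : Fin k → Fin k → ℝ} (hp : Symm01 p) {ε : ℝ} (h0 : 0 < ε) (h1 : ε ≤ 1)
    (hk : 2 / ε ≤ k) :
    ∑ F ∈ Finset.univ.filter (fun F : SimpleGraph (Fin k) => ¬ matLE (fun i j => adjM F i j - p i j) ε), wt p F
      ≤ (2:ℝ) ^ k * 2 ^ k * (2 * Real.exp (- (ε ^ 2 / 64 * (k:ℝ) ^ 2))) := by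
  set a : ℝ := ε / 2 * (k:ℝ) ^ 2 with ha
  have hka : (k:ℝ) ≤ a := by
    rw [div_le_iff₀ h0] at hk
    have : (0:ℝ) ≤ k := Nat.cast_nonneg _
    nlinarith
  set B : Finset (Fin k) × Finset (Fin k) → ℝ → Finset (SimpleGraph (Fin k)) := fun q r =>
    Finset.univ.filter (fun F : SimpleGraph (Fin k) =>
      a ≤ ∑ e ∈ pairs k, (r * dST q.1 q.2 e) * (adjM F e.1 e.2 - p e.1 e.2)) with hB
  have hsub : (Finset.univ.filter (fun F : SimpleGraph (Fin k) => ¬ matLE (fun i j => adjM F i j - p i j) ε))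
      ⊆ (Finset.univ : Finset (Finset (Fin k) × Finset (Fin k))).biUnion (fun q => B q 1 ∪ B q (-1)) := by
    intro F hF
    have hF := (Finset.mem_filter.1 hF).2
    have : ∃ S T : Finset (Fin k), ε * (k : ℝ) ^ 2 < |∑ i ∈ S, ∑ j ∈ T, (adjM F i j - p i j)| := by
      by_contra hcon
      push Not at hcon
      exact hF (matLE_of_finset hcon)
    obtain ⟨S, T, hST⟩ := this
    have h2 := sum_ST hp F S T
    have h3 : a ≤ |∑ e ∈ pairs k, dST S T e * (adjM F e.1 e.2 - p e.1 e.2)| := by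
      rw [ha] at hka ⊢; linarith
    refine Finset.mem_biUnion.2 ⟨(S, T), Finset.mem_univ _, ?_⟩
    rw [Finset.mem_union, hB]
    simp only [Finset.mem_filter, Finset.mem_univ, true_and, one_mul, neg_mul, Finset.sum_neg_distrib]
    rcases abs_cases (∑ e ∈ pairs k, dST S T e * (adjM F e.1 e.2 - p e.1 e.2)) with h | h
    · left; rw [h.1] at h3; exact h3
    · right; rw [h.1] at h3; exact h3
  have htail : ∀ q r, (r = 1 ∨ r = -1) → ∑ F ∈ B q r, wt p F ≤ Real.exp (- (ε ^ 2 / 64 * (k:ℝ) ^ 2)) := by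
    intro q r hr
    have hb := dST_bd q.1 q.2
    refine (tail hp (fun e => r * dST q.1 q.2 e) (ε / 16) a (by positivity) ?_ ?_).trans (le_of_eq ?_)
    · intro e
      have : |r| = 1 := by rcases hr with rfl | rfl <;> simp
      rw [abs_mul, abs_mul, this, abs_of_nonneg (hb e).1, abs_of_pos (by positivity)]
      nlinarith [hb e]
    · intro e
      have : r ^ 2 = 1 := by rcases hr with rfl | rfl <;> simp
      rw [mul_pow, this]
      nlinarith [hb e]
    · congr 1; rw [ha]; ring
  calc _ ≤ ∑ F ∈ (Finset.univ : Finset (Finset (Fin k) × Finset (Fin k))).biUnion (fun q => B q 1 ∪ B q (-1)), wt p F :=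
        Finset.sum_le_sum_of_subset_of_nonneg hsub fun F _ _ => wt_nonneg hp F
    _ ≤ ∑ q : Finset (Fin k) × Finset (Fin k), ∑ F ∈ B q 1 ∪ B q (-1), wt p F :=
        sum_biUnion_le' _ _ fun F => wt_nonneg hp F
    _ ≤ ∑ q : Finset (Fin k) × Finset (Fin k), (2 * Real.exp (- (ε ^ 2 / 64 * (k:ℝ) ^ 2))) := by
        refine Finset.sum_le_sum fun q _ => ?_
        have := Finset.sum_union_inter (s₁ := B q 1) (s₂ := B q (-1)) (f := fun F => wt p F)
        have h5 : 0 ≤ ∑ F ∈ B q 1 ∩ B q (-1), wt p F := Finset.sum_nonneg fun F _ => wt_nonneg hp F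
        linarith [htail q 1 (Or.inl rfl), htail q (-1) (Or.inr rfl)]
    _ = _ := by simp [Finset.card_univ]

open Classical in
theorem conc (ε η : ℝ) (hε : 0 < ε) (hη : 0 < η) : ∃ k0 : ℕ, ∀ k ≥ k0, ∀ p : Fin k → Fin k → ℝ, Symm01 p →
    ∑ F ∈ Finset.univ.filter (fun F : SimpleGraph (Fin k) => ¬ matLE (fun i j => adjM F i j - p i j) ε), wt p F
      ≤ η := by
  set ε' := min ε 1 with he
  have h0 : 0 < ε' := lt_min hε one_pos
  obtain ⟨k0, hk0⟩ := exists_nat_ge (2 / ε' + 3 * 64 / ε' ^ 2 + 2 / η)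
  refine ⟨k0, fun k hk p hp => ?_⟩
  have hk : (k0:ℝ) ≤ k := by exact_mod_cast hk
  have p1 : 0 < 2 / ε' := by positivity
  have p2 : 0 < 3 * 64 / ε' ^ 2 := by positivity
  have p3 : 0 < 2 / η := by positivity
  have b1 : 2 / ε' ≤ k := by linarith
  have b2 : 3 * 64 / ε' ^ 2 ≤ k := by linarith
  have b3 : 2 / η ≤ k := by linarith
  have hb := conc_bound hp h0 (min_le_right _ _) b1
  refine le_trans ?_ (hb.trans ?_)
  · refine Finset.sum_le_sum_of_subset_of_nonneg (fun F hF => ?_) fun F _ _ => wt_nonneg hp F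
    rw [Finset.mem_filter] at hF ⊢
    exact ⟨hF.1, fun h => hF.2 (h.mono (min_le_left _ _))⟩
  · have kk : (0:ℝ) < k := lt_of_lt_of_le p1 b1
    have two : (2:ℝ) ^ k ≤ Real.exp k := by
      have := Real.add_one_le_exp (1:ℝ)
      calc (2:ℝ) ^ k ≤ (Real.exp 1) ^ k := by gcongr; linarith
        _ = _ := by rw [← Real.exp_nat_mul]; simp
    have hq : (k:ℝ) * 3 ≤ ε' ^ 2 / 64 * (k:ℝ) ^ 2 := by
      rw [div_le_iff₀ (by positivity)] at b2
      nlinarith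
    calc (2:ℝ) ^ k * 2 ^ k * (2 * Real.exp (- (ε' ^ 2 / 64 * (k:ℝ) ^ 2)))
        ≤ Real.exp k * Real.exp k * (2 * Real.exp (- ((k:ℝ) * 3))) := by gcongr
      _ = 2 * Real.exp (-k) := by
          rw [show -(k:ℝ) = k + k + -(k * 3) by ring, Real.exp_add, Real.exp_add]; ring
      _ ≤ η := by
          rw [Real.exp_neg, ← div_eq_mul_inv, div_le_iff₀ (Real.exp_pos _)]
          rw [div_le_iff₀ hη] at b3
          have := Real.add_one_le_exp (k:ℝ)
          nlinarith

theorem rounding (ε : ℝ) (hε : 0 < ε) : ∃ k0 : ℕ, ∀ k ≥ k0, ∀ K : Fin k → Fin k → ℝ, Symm01 K →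
    ∃ G : SimpleGraph (Fin k), (∀ i j, i ≠ j → K i j = 1 → G.Adj i j) ∧
      matLE (fun i j => adjM G i j - K i j) ε := by
  classical
  obtain ⟨k0, h⟩ := conc ε (1 / 2) hε (by norm_num)
  refine ⟨k0, fun k hk K hK => ?_⟩
  have h1 := h k hk K hK
  have h2 := wt_sum K
  rw [← Finset.sum_filter_add_sum_filter_not Finset.univ
    (fun F : SimpleGraph (Fin k) => matLE (fun i j => adjM F i j - K i j) ε)] at h2
  have h3 : 0 < ∑ F ∈ Finset.univ.filter (fun F : SimpleGraph (Fin k) => matLE (fun i j => adjM F i j - K i j) ε), wt K F := by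
    linarith
  obtain ⟨G, hG, hw⟩ := Finset.exists_ne_zero_of_sum_ne_zero h3.ne'
  refine ⟨G, ?_, (Finset.mem_filter.1 hG).2⟩
  have key : ∀ i j, i < j → K i j = 1 → G.Adj i j := by
    intro i j hij h1
    by_contra hn
    apply hw
    refine Finset.prod_eq_zero (i := (i, j)) (Finset.mem_filter.2 ⟨Finset.mem_univ _, hij⟩) ?_
    simp [hn, h1]
  intro i j hij h1
  rcases lt_or_gt_of_ne hij with h | h
  · exact key i j h h1
  · exact (key j i h (by rw [hK.1, h1])).symm


theorem idx_dist {n : ℕ} [NeZero n] {x : ℝ} (hx : x ∈ Set.Ioc (0:ℝ) 1) :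
    |x - ((idx n x : ℕ) : ℝ) / n| ≤ 1 / n := by
  have h := (idx_eq_iff hx (idx n x)).1 rfl
  rw [abs_of_nonneg (by linarith [h.1])]
  have := h.2
  rw [add_div] at this
  linarith

theorem step_density {U : ℝ → ℝ → ℝ} (hU : IsGraphon U) {γ : ℝ} (hγ : 0 < γ) :
    ∃ N0 : ℕ, ∀ (N : ℕ) [NeZero N], N0 ≤ N → ∃ u : Fin N → Fin N → ℝ, Symm01 u ∧
      ∫ z, |U z.1 z.2 - stepK u z.1 z.2| ∂(lam.prod lam) ≤ γ := by
  obtain ⟨g, gc, gi, gcont, gint⟩ :=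
    (hU.nice.integrable (lam.prod lam)).exists_hasCompactSupport_integral_sub_le (half_pos hγ)
  have guc := gc.uniformContinuous_of_continuous gcont
  obtain ⟨δ, hδ, hd⟩ := Metric.uniformContinuous_iff.1 guc (γ / 2) (half_pos hγ)
  obtain ⟨N0, hN0⟩ := exists_nat_gt (1 / δ)
  refine ⟨N0, fun N _ hN => ?_⟩
  have hNp := npos N
  have hN1 : 1 / (N:ℝ) < δ := by
    have : (N0:ℝ) ≤ N := by exact_mod_cast hN
    rw [div_lt_iff₀ hNp]
    rw [div_lt_iff₀ hδ] at hN0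
    nlinarith
  let g' : ℝ × ℝ → ℝ := fun z => (g z + g z.swap) / 2
  let cl : ℝ → ℝ := fun t => max 0 (min 1 t)
  have hcl : ∀ s ∈ Set.Icc (0:ℝ) 1, ∀ t, |s - cl t| ≤ |s - t| := by
    intro s hs t
    obtain ⟨h0, h1⟩ := hs
    simp only [cl]
    rcases le_total t 0 with ht | ht
    · rw [min_eq_right (by linarith), max_eq_left ht, abs_of_nonneg (by linarith), abs_of_nonneg (by linarith)]
      linarith
    · rcases le_total t 1 with ht' | ht'
      · rw [min_eq_right ht', max_eq_right ht]
      · rw [min_eq_left ht', max_eq_right zero_le_one, abs_of_nonpos (by linarith), abs_of_nonpos (by linarith)]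
        linarith
  let u : Fin N → Fin N → ℝ := fun i j => cl (g' (((i:ℕ):ℝ) / N, ((j:ℕ):ℝ) / N))
  refine ⟨u, ⟨fun i j => ?_, fun i j => ⟨le_max_left _ _, max_le zero_le_one (min_le_left _ _)⟩⟩, ?_⟩
  · simp only [u, g', Prod.swap_prod_mk, add_comm]
  have gs : Integrable (fun z => g z.swap) (lam.prod lam) := gint.swap
  have Ui := hU.nice.integrable (lam.prod lam)
  have i1 : Integrable (fun z : ℝ × ℝ => |U z.1 z.2 - g z|) (lam.prod lam) := (Ui.sub gint).abs
  have i2 : Integrable (fun z : ℝ × ℝ => |U z.1 z.2 - g z.swap|) (lam.prod lam) := (Ui.sub gs).abs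
  have e2 : ∫ z : ℝ × ℝ, |U z.1 z.2 - g z.swap| ∂(lam.prod lam) = ∫ z : ℝ × ℝ, |U z.1 z.2 - g z| ∂(lam.prod lam) := by
    rw [← integral_swap' (fun z => |U z.1 z.2 - g z|)]
    congr 1; funext z
    simp only [Prod.fst_swap, Prod.snd_swap]
    rw [hU.2.1]
  have pt : ∀ᵐ z ∂(lam.prod lam), |U z.1 z.2 - stepK u z.1 z.2| ≤
      (|U z.1 z.2 - g z| + |U z.1 z.2 - g z.swap|) / 2 + γ / 2 := by
    filter_upwards [ae_prod lam_mem' lam_mem'] with z hz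
    have d1 := idx_dist (n := N) hz.1
    have d2 := idx_dist (n := N) hz.2
    have c1 : |g z - g (((idx N z.1 : ℕ):ℝ) / N, ((idx N z.2 : ℕ):ℝ) / N)| < γ / 2 := by
      rw [← Real.dist_eq]
      apply hd
      rw [Prod.dist_eq, Real.dist_eq, Real.dist_eq]
      exact max_lt (d1.trans_lt hN1) (d2.trans_lt hN1)
    have c2 : |g z.swap - g (((idx N z.2 : ℕ):ℝ) / N, ((idx N z.1 : ℕ):ℝ) / N)| < γ / 2 := by
      rw [← Real.dist_eq]
      apply hd
      rw [Prod.dist_eq, Real.dist_eq, Real.dist_eq]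
      exact max_lt (d2.trans_lt hN1) (d1.trans_lt hN1)
    refine (hcl _ (hU.2.2 _ _) _).trans ?_
    simp only [g', Prod.swap_prod_mk]
    have a1 := abs_le.1 c1.le
    have a2 := abs_le.1 c2.le
    have a3 := abs_le.1 (le_refl |U z.1 z.2 - g z|)
    have a4 := abs_le.1 (le_refl |U z.1 z.2 - g z.swap|)
    rw [abs_le]
    constructor <;> linarith [a1.1, a1.2, a2.1, a2.2, a3.1, a3.2, a4.1, a4.2]
  calc _ ≤ ∫ z : ℝ × ℝ, ((|U z.1 z.2 - g z| + |U z.1 z.2 - g z.swap|) / 2 + γ / 2) ∂(lam.prod lam) :=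
        integral_mono_ae ((hU.nice.sub (stepK_nice u)).integrable _).abs
          (((i1.add i2).div_const 2).add (integrable_const _)) pt
    _ = ((∫ z : ℝ × ℝ, |U z.1 z.2 - g z| ∂(lam.prod lam)) + ∫ z : ℝ × ℝ, |U z.1 z.2 - g z.swap| ∂(lam.prod lam)) / 2 + γ / 2 := by
        rw [integral_add (by exact (i1.add i2).div_const 2) (integrable_const _), integral_div, integral_add i1 i2]
        simp
    _ ≤ γ := by
        rw [e2]
        have : ∫ z : ℝ × ℝ, |U z.1 z.2 - g z| ∂(lam.prod lam) ≤ γ / 2 := by simpa [Real.norm_eq_abs] using gi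
        linarith

section pi
variable {X : Type*} [MeasurableSpace X] {k : ℕ} (μ : Fin k → Measure X) [∀ i, IsProbabilityMeasure (μ i)]

theorem pi_one (i : Fin k) {h : X → ℝ} (hh : Measurable h) :
    ∫ x, h (x i) ∂(Measure.pi μ) = ∫ t, h t ∂(μ i) := by
  have := measurePreserving_eval μ i
  conv_rhs => rw [← this.map_eq]
  rw [integral_map this.measurable.aemeasurable hh.aestronglyMeasurable]

theorem pi_two {i j : Fin k} (hij : i ≠ j) {h : X × X → ℝ} (hh : Measurable h) :
    ∫ x, h (x i, x j) ∂(Measure.pi μ) = ∫ t, h t ∂((μ i).prod (μ j)) := by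
  have hI := (ProbabilityTheory.iIndepFun_pi (μ := μ) (X := fun _ => id) (fun i => aemeasurable_id)).indepFun hij
  have hI' : ProbabilityTheory.IndepFun (fun x : Fin k → X => x i) (fun x : Fin k → X => x j) (Measure.pi μ) := hI
  rw [ProbabilityTheory.indepFun_iff_map_prod_eq_prod_map_map (measurable_pi_apply i).aemeasurable
    (measurable_pi_apply j).aemeasurable] at hI'
  have e1 : Measure.map (fun x : Fin k → X => x i) (Measure.pi μ) = μ i := (measurePreserving_eval μ i).map_eq
  have e2 : Measure.map (fun x : Fin k → X => x j) (Measure.pi μ) = μ j := (measurePreserving_eval μ j).map_eq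
  rw [e1, e2] at hI'
  rw [← hI', integral_map (by fun_prop) hh.aestronglyMeasurable]

theorem pi_count {B : Set X} (hB : MeasurableSet B) :
    ∫ x, |∑ i, (B.indicator (fun _ => (1:ℝ)) (x i) - (μ i).real B)| ∂(Measure.pi μ) ≤ Real.sqrt k := by
  set Y : Fin k → X → ℝ := fun i t => B.indicator (fun _ => (1:ℝ)) t - (μ i).real B with hY
  have mInd : Measurable (B.indicator (fun _ => (1:ℝ))) := measurable_const.indicator hB
  have mY : ∀ i, Measurable (Y i) := fun i => mInd.sub_const _
  have indb : ∀ t, B.indicator (fun _ => (1:ℝ)) t ∈ Set.Icc (0:ℝ) 1 := by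
    intro t; by_cases h : t ∈ B <;> simp [h]
  have rb : ∀ i, (μ i).real B ∈ Set.Icc (0:ℝ) 1 := fun i => ⟨measureReal_nonneg, measureReal_le_one⟩
  have bY : ∀ i t, |Y i t| ≤ 1 := by
    intro i t
    rw [abs_le]
    have := indb t; have := rb i
    constructor <;> simp only [hY] <;> linarith [(indb t).1, (indb t).2, (rb i).1, (rb i).2]
  have mem : ∀ i, MemLp (Y i) 2 (μ i) := fun i =>
    MemLp.of_bound (mY i).aestronglyMeasurable 1 (ae_of_all _ fun t => bY i t)
  have hv := ProbabilityTheory.variance_sum_pi mem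
  set S : (Fin k → X) → ℝ := fun x => ∑ i, Y i (x i) with hS
  have hSe : (∑ i, fun ω : Fin k → X => Y i (ω i)) = S := by funext x; simp [hS]
  have mS : Measurable S := Finset.measurable_fun_sum _ fun i _ => (mY i).comp (measurable_pi_apply i)
  have bS : ∀ x, |S x| ≤ k := by
    intro x
    refine (Finset.abs_sum_le_sum_abs _ _).trans ((Finset.sum_le_sum fun i _ => bY i (x i)).trans ?_)
    simp
  have mzero : ∫ x, S x ∂(Measure.pi μ) = 0 := by
    simp only [hS]
    rw [integral_finsetSum]
    · refine Finset.sum_eq_zero fun i _ => ?_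
      rw [pi_one μ i (mY i)]
      simp only [hY]
      rw [integral_sub (Integrable.of_bound mInd.aestronglyMeasurable 1 (ae_of_all _ fun t => by
        rw [Real.norm_eq_abs, abs_le]; constructor <;> linarith [(indb t).1, (indb t).2])) (integrable_const _),
        integral_indicator hB]
      simp
    · intro i _
      exact Integrable.of_bound ((mY i).comp (measurable_pi_apply i)).aestronglyMeasurable 1 (ae_of_all _ fun t => bY i _)
  have memS : MemLp S 2 (Measure.pi μ) := MemLp.of_bound mS.aestronglyMeasurable k (ae_of_all _ fun t => bS t)
  have vle : ∫ x, S x ^ 2 ∂(Measure.pi μ) ≤ k := by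
    have : ProbabilityTheory.variance S (Measure.pi μ) = ∫ x, S x ^ 2 ∂(Measure.pi μ) :=
      ProbabilityTheory.variance_of_integral_eq_zero mS.aemeasurable mzero
    rw [← this, ← hSe, hv]
    refine (Finset.sum_le_sum (g := fun _ => (1:ℝ)) fun i _ => ?_).trans (by simp)
    have := ProbabilityTheory.variance_le_sq_of_bounded (μ := μ i) (X := Y i) (a := -1) (b := 1)
      (ae_of_all _ fun t => abs_le.1 (bY i t)) (mY i).aemeasurable
    norm_num at this; exact this
  have := ProbabilityTheory.variance_nonneg |S| (Measure.pi μ)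
  rw [ProbabilityTheory.variance_eq_sub memS.abs] at this
  simp only [Pi.pow_apply, Pi.abs_apply, sq_abs] at this
  refine Real.le_sqrt_of_sq_le ?_
  linarith
end pi


theorem Yint {X : Type*} [MeasurableSpace X] {k N : ℕ} {μ : Measure (Fin k → X)} [IsProbabilityMeasure μ]
    {c : X → Fin N} (hc : Measurable c) (a : Fin N) : Integrable (fun x : Fin k → X =>
      |(((Finset.univ.filter fun i => c (x i) = a).card : ℝ) / k - 1 / N)|) μ := by
  have e : (fun x : Fin k → X => |(((Finset.univ.filter fun i => c (x i) = a).card : ℝ) / k - 1 / N)|)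
      = fun x : Fin k → X => |((∑ i, (c ⁻¹' {a}).indicator (fun _ => (1:ℝ)) (x i)) / k - 1 / N)| := by
    funext x
    congr 3
    rw [Finset.card_filter]; push_cast
    refine Finset.sum_congr rfl fun i _ => ?_
    by_cases h : c (x i) = a <;> simp [h]
  rw [e]
  have hB : MeasurableSet (c ⁻¹' {a}) := hc (measurableSet_singleton a)
  have i0 : ∀ i : Fin k, Integrable (fun x : Fin k → X => (c ⁻¹' {a}).indicator (fun _ => (1:ℝ)) (x i)) μ := by
    intro i
    refine Integrable.of_bound ((measurable_const.indicator hB).comp (measurable_pi_apply i)).aestronglyMeasurable 1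
      (ae_of_all _ fun x => ?_)
    by_cases h : x i ∈ c ⁻¹' {a} <;> simp [h]
  exact (((integrable_finsetSum _ fun i _ => i0 i).div_const _).sub (integrable_const _)).abs

theorem count_est {X : Type*} [MeasurableSpace X] {k N : ℕ} [NeZero k] [NeZero N] (μ : Fin k → Measure X)
    [∀ i, IsProbabilityMeasure (μ i)] {c : X → Fin N} (hc : Measurable c)
    (h : ∀ a, ∑ i, (μ i).real (c ⁻¹' {a}) = (k:ℝ) / N) :
    ∫ x, ∑ a, |(((Finset.univ.filter fun i => c (x i) = a).card : ℝ) / k - 1 / N)| ∂(Measure.pi μ)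
      ≤ N / Real.sqrt k := by
  have hk := npos k
  rw [integral_finsetSum _ fun a _ => Yint hc a]
  have : ∀ a ∈ (Finset.univ : Finset (Fin N)),
      ∫ x, |(((Finset.univ.filter fun i => c (x i) = a).card : ℝ) / k - 1 / N)| ∂(Measure.pi μ) ≤ 1 / Real.sqrt k := by
    intro a _
    have hB : MeasurableSet (c ⁻¹' {a}) := hc (measurableSet_singleton a)
    have h1 := pi_count μ hB
    have e : ∀ x : Fin k → X, |(((Finset.univ.filter fun i => c (x i) = a).card : ℝ) / k - 1 / N)|
        = (1 / k) * |∑ i, ((c ⁻¹' {a}).indicator (fun _ => (1:ℝ)) (x i) - (μ i).real (c ⁻¹' {a}))| := by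
      intro x
      conv_rhs => rw [← abs_of_pos (show (0:ℝ) < 1 / k by positivity), ← abs_mul]
      congr 1
      rw [Finset.sum_sub_distrib, h a, Finset.card_filter]
      push_cast
      have : ∀ i, (if c (x i) = a then (1:ℝ) else 0) = (c ⁻¹' {a}).indicator (fun _ => (1:ℝ)) (x i) := by
        intro i
        by_cases h : c (x i) = a <;> simp [h]
      simp only [this]
      have hN := npos N
      field_simp
    simp only [e]
    rw [integral_const_mul]
    calc _ ≤ 1 / (k:ℝ) * Real.sqrt k := by gcongr
      _ = 1 / Real.sqrt k := by
        rw [one_div_mul_eq_div, Real.sqrt_div_self]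
        simp
  refine (Finset.sum_le_sum this).trans (le_of_eq ?_)
  simp [div_eq_mul_inv]

/-- density with signed edges -/
def sd {k : ℕ} (A B : Finset (Fin k × Fin k)) (W : ℝ → ℝ → ℝ) (x : Fin k → ℝ) : ℝ :=
  hp A W x * hp B (fun s t => 1 - W s t) x

theorem compl_graphon {W : ℝ → ℝ → ℝ} (hW : IsGraphon W) : IsGraphon (fun s t => 1 - W s t) :=
  ⟨measurable_const.sub hW.1, fun x y => by simp only [hW.2.1 x y], fun x y =>
    ⟨by linarith [(hW.2.2 x y).2], by linarith [(hW.2.2 x y).1]⟩⟩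

theorem sd_eq {U W : ℝ → ℝ → ℝ} (hU : IsGraphon U) (hW : IsGraphon W) (h : GraphonIso U W) {k : ℕ}
    (B : Finset (Fin k × Fin k)) : ∀ A ⊆ pairs k, B ⊆ pairs k → Disjoint A B →
      ∫ x, sd A B U x ∂(piL k) = ∫ x, sd A B W x ∂(piL k) := by
  classical
  induction B using Finset.induction_on with
  | empty =>
    intro A hA _ _
    have := h k (SimpleGraph.fromRel fun i j => (i, j) ∈ A)
    rw [homDensity_eq, homDensity_eq] at this
    set Z := (Finset.univ.filter fun e : Fin k × Fin k => e.1 < e.2 ∧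
        (SimpleGraph.fromRel fun i j => (i, j) ∈ A).Adj e.1 e.2) with hZ
    have e : Z = A := by
      ext e
      simp only [hZ, Finset.mem_filter, Finset.mem_univ, true_and, SimpleGraph.fromRel_adj]
      constructor
      · rintro ⟨h1, _, h2 | h2⟩
        · exact h2
        · exact absurd (Finset.mem_filter.1 (hA h2)).2 h1.asymm
      · intro h2
        have := (Finset.mem_filter.1 (hA h2)).2
        exact ⟨this, this.ne, Or.inl h2⟩
    have this : ∫ x, hp Z U x ∂(piL k) = ∫ x, hp Z W x ∂(piL k) := by convert this
    rw [e] at this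
    simpa [sd, hp] using this
  | insert e B he ih =>
    intro A hA hB hd
    have heP : e ∈ pairs k := hB (Finset.mem_insert_self _ _)
    have heA : e ∉ A := fun h => Finset.disjoint_left.1 hd h (Finset.mem_insert_self _ _)
    have hB' : B ⊆ pairs k := (Finset.subset_insert _ _).trans hB
    have hd1 : Disjoint A B := hd.mono_right (Finset.subset_insert _ _)
    have hd2 : Disjoint (insert e A) B := by
      rw [Finset.disjoint_insert_left]; exact ⟨he, hd1⟩
    have hA2 : insert e A ⊆ pairs k := Finset.insert_subset heP hA
    have key : ∀ V : ℝ → ℝ → ℝ, IsGraphon V → ∫ x, sd A (insert e B) V x ∂(piL k)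
        = ∫ x, sd A B V x ∂(piL k) - ∫ x, sd (insert e A) B V x ∂(piL k) := by
      intro V hV
      simp only [sd]
      rw [← integral_sub (hp_integrable A B hV (compl_graphon hV)) (hp_integrable _ B hV (compl_graphon hV))]
      congr 1; funext x
      simp only [hp, Finset.prod_insert he, Finset.prod_insert heA]
      ring
    rw [key U hU, key W hW, ih A hA hB' hd1, ih _ hA2 hB' hd2]

theorem wt_eq_sd {k : ℕ} (F : SimpleGraph (Fin k)) : ∃ A ⊆ pairs k, ∃ B ⊆ pairs k, Disjoint A B ∧
    ∀ (W : ℝ → ℝ → ℝ) (x : Fin k → ℝ), wt (fun i j => W (x i) (x j)) F = sd A B W x := by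
  classical
  refine ⟨(pairs k).filter (fun e => F.Adj e.1 e.2), Finset.filter_subset _ _,
    (pairs k).filter (fun e => ¬ F.Adj e.1 e.2), Finset.filter_subset _ _,
    Finset.disjoint_filter_filter_not _ _ _, fun W x => ?_⟩
  rw [wt, Finset.prod_ite]
  simp only [sd, hp]

theorem ind_eq {U W : ℝ → ℝ → ℝ} (hU : IsGraphon U) (hW : IsGraphon W) (h : GraphonIso U W) {k : ℕ}
    (F : SimpleGraph (Fin k)) : ∫ x, wt (fun i j => U (x i) (x j)) F ∂(piL k)
      = ∫ x, wt (fun i j => W (x i) (x j)) F ∂(piL k) := by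
  obtain ⟨A, hA, B, hB, hd, e⟩ := wt_eq_sd F
  simp only [e]
  exact sd_eq hU hW h B A hA hB hd

theorem wt_int {U : ℝ → ℝ → ℝ} (hU : IsGraphon U) {k : ℕ} (F : SimpleGraph (Fin k)) :
    Integrable (fun x => wt (fun i j => U (x i) (x j)) F) (piL k) := by
  obtain ⟨A, hA, B, hB, hd, e⟩ := wt_eq_sd F
  simp only [e]
  exact hp_integrable A B hU (compl_graphon hU)

theorem l1_est {X : Type*} [MeasurableSpace X] {k : ℕ} (μ : Measure X) [IsProbabilityMeasure μ]
    {D : X × X → ℝ} (hD : Measurable D) (bD : ∀ z, |D z| ≤ 1) {γ : ℝ} (h : ∫ z, |D z| ∂(μ.prod μ) ≤ γ) :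
    ∫ x : Fin k → X, ∑ i, ∑ j, |D (x i, x j)| ∂(Measure.pi fun _ => μ) ≤ k + (k:ℝ) ^ 2 * γ := by
  have i0 : ∀ i j : Fin k, Integrable (fun x : Fin k → X => |D (x i, x j)|) (Measure.pi fun _ => μ) := by
    intro i j
    refine Integrable.of_bound (Measurable.aestronglyMeasurable ?_) 1 (ae_of_all _ fun x => by simpa using bD _)
    exact (hD.comp (f := fun x : Fin k → X => (x i, x j)) (by fun_prop)).abs
  have hγ : 0 ≤ γ := le_trans (integral_nonneg fun z => abs_nonneg _) h
  rw [integral_finsetSum _ fun i _ => integrable_finsetSum _ fun j _ => i0 i j]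
  have : ∀ i j : Fin k, ∫ x : Fin k → X, |D (x i, x j)| ∂(Measure.pi fun _ => μ) ≤ (if i = j then 1 else 0) + γ := by
    intro i j
    by_cases hij : i = j
    · rw [if_pos hij]
      have : ∫ x : Fin k → X, |D (x i, x j)| ∂(Measure.pi fun _ => μ) ≤ ∫ x : Fin k → X, (1:ℝ) ∂(Measure.pi fun _ => μ) :=
        integral_mono (i0 i j) (integrable_const _) fun x => bD _
      simp at this
      linarith
    · rw [if_neg hij, zero_add]
      have := pi_two (fun _ : Fin k => μ) hij (h := fun z => |D z|) hD.abs
      rw [this]; exact h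
  calc _ = ∑ i : Fin k, ∑ j : Fin k, ∫ x : Fin k → X, |D (x i, x j)| ∂(Measure.pi fun _ => μ) := by
        refine Finset.sum_congr rfl fun i _ => ?_
        rw [integral_finsetSum _ fun j _ => i0 i j]
    _ ≤ ∑ i : Fin k, ∑ j : Fin k, ((if i = j then 1 else 0) + γ) :=
        Finset.sum_le_sum fun i _ => Finset.sum_le_sum fun j _ => this i j
    _ = _ := by
        simp [Finset.sum_add_distrib]; ring


open Classical in
theorem bad_pt {U : ℝ → ℝ → ℝ} (hU : IsGraphon U) {N k : ℕ} [NeZero N] [NeZero k] {u : Fin N → Fin N → ℝ}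
    (hu : Symm01 u) {ε γ η τ ε1 θ : ℝ} (hγ : ∫ z, |U z.1 z.2 - stepK u z.1 z.2| ∂(lam.prod lam) ≤ γ)
    (hη : 0 < η) (hτ : 0 < τ) (hθ : 0 ≤ θ) (hsum : ε1 + τ + 4 * N * η + γ ≤ ε)
    (hc : ∀ p : Fin k → Fin k → ℝ, Symm01 p →
      ∑ F ∈ Finset.univ.filter (fun F : SimpleGraph (Fin k) => ¬ matLE (fun i j => adjM F i j - p i j) ε1), wt p F ≤ θ)
    (x : Fin k → ℝ) :
    ∑ F ∈ Finset.univ.filter (fun F : SimpleGraph (Fin k) => ¬ ∃ φ, near (graphonOf F) U φ ε),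
      wt (fun i j => U (x i) (x j)) F ≤ θ +
        (∑ a, |(((Finset.univ.filter fun i => idx N (x i) = a).card : ℝ) / k - 1 / N)|) / η
        + (∑ i, ∑ j, |U (x i) (x j) - stepK u (x i) (x j)|) / (τ * (k:ℝ) ^ 2) := by
  have hp : Symm01 (fun i j => U (x i) (x j)) := ⟨fun i j => hU.2.1 _ _, fun i j => hU.2.2 _ _⟩
  have hk := npos k
  set Y1 := ∑ a, |(((Finset.univ.filter fun i => idx N (x i) = a).card : ℝ) / k - 1 / N)| with hY1
  set Y2 := ∑ i, ∑ j, |U (x i) (x j) - stepK u (x i) (x j)| with hY2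
  have n1 : 0 ≤ Y1 := Finset.sum_nonneg fun _ _ => abs_nonneg _
  have n2 : 0 ≤ Y2 := Finset.sum_nonneg fun _ _ => Finset.sum_nonneg fun _ _ => abs_nonneg _
  have n1' : 0 ≤ Y1 / η := by positivity
  have n2' : 0 ≤ Y2 / (τ * (k:ℝ) ^ 2) := by positivity
  have le1 : ∑ F ∈ Finset.univ.filter (fun F : SimpleGraph (Fin k) => ¬ ∃ φ, near (graphonOf F) U φ ε),
      wt (fun i j => U (x i) (x j)) F ≤ 1 := by
    rw [← wt_sum (fun i j => U (x i) (x j))]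
    exact Finset.sum_le_sum_of_subset_of_nonneg (Finset.filter_subset _ _) fun F _ _ => wt_nonneg hp F
  by_cases c1 : Y1 ≤ η
  · by_cases c2 : Y2 ≤ τ * (k:ℝ) ^ 2
    · refine le_trans ?_ ((hc _ hp).trans (by linarith))
      refine Finset.sum_le_sum_of_subset_of_nonneg (fun F hF => ?_) fun F _ _ => wt_nonneg hp F
      rw [Finset.mem_filter] at hF ⊢
      refine ⟨Finset.mem_univ _, fun hm => hF.2 ?_⟩
      have h2 : matLE (fun i j => U (x i) (x j) - stepK u (x i) (x j)) τ := matLE_of_l1 c2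
      have h3 := hm.add h2
      have h4 : matLE (fun i j => adjM F i j - u (idx N (x i)) (idx N (x j))) (ε1 + τ) := by
        refine Eq.subst (motive := fun D => matLE D (ε1 + τ)) ?_ h3
        funext i j
        simp only [stepK]
        ring
      obtain ⟨φ, hφ⟩ := finish hU.nice hu.2 h4 c1 hγ
      exact ⟨φ, hφ.mono hsum⟩
    · have : 1 ≤ Y2 / (τ * (k:ℝ) ^ 2) := by
        rw [le_div_iff₀ (by positivity)]; linarith
      linarith
  · have : 1 ≤ Y1 / η := by
      rw [le_div_iff₀ (by positivity)]; linarith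
    linarith

open Classical in
theorem sampling {U : ℝ → ℝ → ℝ} (hU : IsGraphon U) {ε : ℝ} (hε : 0 < ε) :
    ∃ k0 : ℕ, ∀ (k : ℕ) [NeZero k], k0 ≤ k →
      ∑ F ∈ Finset.univ.filter (fun F : SimpleGraph (Fin k) => ¬ ∃ φ, near (graphonOf F) U φ ε),
        ∫ x, wt (fun i j => U (x i) (x j)) F ∂(piL k) ≤ 1 / 4 := by
  obtain ⟨N0, hN0⟩ := step_density hU (γ := ε / 256) (by positivity)
  obtain ⟨N, hNz, hNN⟩ : ∃ N : ℕ, ∃ _ : NeZero N, N0 ≤ N := ⟨N0 + 1, inferInstance, by omega⟩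
  obtain ⟨u, hu, hui⟩ := hN0 N hNN
  have hNp := npos N
  obtain ⟨k1, hk1⟩ := conc (ε / 8) (1 / 8) (by positivity) (by norm_num)
  set η := ε / (32 * N) with hη
  have hη0 : 0 < η := by positivity
  obtain ⟨k2, hk2⟩ := exists_nat_ge ((16 * N / η) ^ 2 + 256 / ε)
  refine ⟨k1 + k2, fun k _ hk => ?_⟩
  have hkp := npos k
  have kb : (16 * N / η) ^ 2 + 256 / ε ≤ k := hk2.trans (by exact_mod_cast (by omega : k2 ≤ k))
  have q0 : 0 < 256 / ε := by positivity
  have q1 : 0 ≤ (16 * N / η) ^ 2 := by positivity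
  have pt := bad_pt hU (k := k) hu (ε := ε) (γ := ε / 256) (η := η) (τ := ε / 8) (ε1 := ε / 8) (θ := 1 / 8)
    hui hη0 (by positivity) (by norm_num) (by
      have : 4 * (N:ℝ) * η = ε / 8 := by rw [hη]; field_simp; norm_num
      rw [this]; linarith) (hk1 k (by omega))
  rw [← integral_finsetSum _ fun F _ => wt_int hU F]
  have i1 : Integrable (fun x : Fin k → ℝ => (∑ a, |(((Finset.univ.filter fun i => idx N (x i) = a).card : ℝ) / k - 1 / N)|)) (piL k) :=
    integrable_finsetSum _ fun a _ => Yint (idx_measurable N) a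
  have hDn := hU.nice.sub (stepK_nice u)
  have bD : ∀ z : ℝ × ℝ, |U z.1 z.2 - stepK u z.1 z.2| ≤ 1 := by
    intro z
    have h1 := hU.2.2 z.1 z.2
    have h2 := hu.2 (idx N z.1) (idx N z.2)
    simp only [stepK]
    rw [abs_le]; constructor <;> linarith [h1.1, h1.2, h2.1, h2.2]
  have i2 : Integrable (fun x : Fin k → ℝ => (∑ i, ∑ j, |U (x i) (x j) - stepK u (x i) (x j)|)) (piL k) := by
    refine integrable_finsetSum _ fun i _ => integrable_finsetSum _ fun j _ => ?_
    refine Integrable.of_bound (Measurable.aestronglyMeasurable ?_) 1 (ae_of_all _ fun x => by simpa using bD (x i, x j))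
    exact (hDn.1.comp (f := fun x : Fin k → ℝ => (x i, x j)) (by fun_prop)).abs
  have e1 := count_est (fun _ : Fin k => lam) (idx_measurable N) (by
    intro a; rw [Finset.sum_const, lam_fiber]; simp [div_eq_mul_inv])
  have e2 := l1_est (k := k) lam (D := fun z : ℝ × ℝ => U z.1 z.2 - stepK u z.1 z.2) hDn.1 bD hui
  simp only at e2
  calc _ ≤ ∫ x : Fin k → ℝ, (1 / 8 +
        (∑ a, |(((Finset.univ.filter fun i => idx N (x i) = a).card : ℝ) / k - 1 / N)|) / η
        + (∑ i, ∑ j, |U (x i) (x j) - stepK u (x i) (x j)|) / (ε / 8 * (k:ℝ) ^ 2)) ∂(piL k) :=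
        integral_mono (integrable_finsetSum _ fun F _ => wt_int hU F)
          (((integrable_const _).add (i1.div_const _)).add (i2.div_const _)) pt
    _ = 1 / 8 + (∫ x : Fin k → ℝ, (∑ a, |(((Finset.univ.filter fun i => idx N (x i) = a).card : ℝ) / k - 1 / N)|) ∂(piL k)) / η
        + (∫ x : Fin k → ℝ, (∑ i, ∑ j, |U (x i) (x j) - stepK u (x i) (x j)|) ∂(piL k)) / (ε / 8 * (k:ℝ) ^ 2) := by
        rw [integral_add (by exact (integrable_const _).add (i1.div_const _)) (i2.div_const _),
          integral_add (integrable_const _) (i1.div_const _), integral_div, integral_div, integral_div]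
        simp
    _ ≤ 1 / 8 + (N / Real.sqrt k) / η + (k + (k:ℝ) ^ 2 * (ε / 256)) / (ε / 8 * (k:ℝ) ^ 2) := by
        gcongr
    _ ≤ 1 / 8 + 1 / 16 + 1 / 16 := by
        have s1 : 16 * N / η ≤ Real.sqrt k := Real.le_sqrt_of_sq_le (by linarith)
        have sp : 0 < Real.sqrt k := Real.sqrt_pos.2 hkp
        have f1 : (N / Real.sqrt k) / η ≤ 1 / 16 := by
          rw [div_le_iff₀ hη0] at s1
          rw [div_div, div_le_iff₀ (by positivity)]
          linarith
        have f2 : (k + (k:ℝ) ^ 2 * (ε / 256)) / (ε / 8 * (k:ℝ) ^ 2) ≤ 1 / 16 := by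
          have k256 : 256 / ε ≤ k := by linarith
          rw [div_le_iff₀ hε] at k256
          rw [div_le_iff₀ (by positivity)]
          nlinarith
        linarith
    _ = 1 / 4 := by norm_num

theorem near_of_iso {U W : ℝ → ℝ → ℝ} (hU : IsGraphon U) (hW : IsGraphon W) (h : GraphonIso U W)
    {ε : ℝ} (hε : 0 < ε) : ∃ φ, near U W φ ε := by
  classical
  obtain ⟨k1, h1⟩ := sampling hU (half_pos hε)
  obtain ⟨k2, h2⟩ := sampling hW (half_pos hε)
  set k := k1 + k2 + 1 with hk
  have h1 := h1 k (by omega)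
  have h2 := h2 k (by omega)
  have tot : ∑ F : SimpleGraph (Fin k), ∫ x, wt (fun i j => U (x i) (x j)) F ∂(piL k) = 1 := by
    rw [← integral_finsetSum _ fun F _ => wt_int hU F]
    simp [wt_sum]
  by_contra hcon
  have cover : (Finset.univ : Finset (SimpleGraph (Fin k))) ⊆
      (Finset.univ.filter (fun F : SimpleGraph (Fin k) => ¬ ∃ φ, near (graphonOf F) U φ (ε / 2))) ∪
      (Finset.univ.filter (fun F : SimpleGraph (Fin k) => ¬ ∃ φ, near (graphonOf F) W φ (ε / 2))) := by
    intro F _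
    by_contra hF
    simp only [Finset.mem_union, Finset.mem_filter, Finset.mem_univ, true_and, not_or, not_not] at hF
    obtain ⟨⟨φ, hφ⟩, ψ, hψ⟩ := hF
    have gn := (graphonOf_graphon F).nice
    have := (hφ.symm gn hU.nice).tri hU.nice gn hW.nice hψ
    rw [add_halves] at this
    exact hcon ⟨_, this⟩
  have nn : ∀ F : SimpleGraph (Fin k), 0 ≤ ∫ x, wt (fun i j => U (x i) (x j)) F ∂(piL k) := fun F =>
    integral_nonneg fun x => wt_nonneg ⟨fun i j => hU.2.1 _ _, fun i j => hU.2.2 _ _⟩ F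
  have := Finset.sum_le_sum_of_subset_of_nonneg cover (f := fun F => ∫ x, wt (fun i j => U (x i) (x j)) F ∂(piL k)) fun F _ _ => nn F
  have ui := Finset.sum_union_inter
    (s₁ := Finset.univ.filter (fun F : SimpleGraph (Fin k) => ¬ ∃ φ, near (graphonOf F) U φ (ε / 2)))
    (s₂ := Finset.univ.filter (fun F : SimpleGraph (Fin k) => ¬ ∃ φ, near (graphonOf F) W φ (ε / 2)))
    (f := fun F => ∫ x, wt (fun i j => U (x i) (x j)) F ∂(piL k))
  have inn : 0 ≤ ∑ F ∈ (Finset.univ.filter (fun F : SimpleGraph (Fin k) => ¬ ∃ φ, near (graphonOf F) U φ (ε / 2))) ∩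
      (Finset.univ.filter (fun F : SimpleGraph (Fin k) => ¬ ∃ φ, near (graphonOf F) W φ (ε / 2))),
      ∫ x, wt (fun i j => U (x i) (x j)) F ∂(piL k) := Finset.sum_nonneg fun F _ => nn F
  have h2' : ∑ F ∈ (Finset.univ.filter (fun F : SimpleGraph (Fin k) => ¬ ∃ φ, near (graphonOf F) W φ (ε / 2))),
      ∫ x, wt (fun i j => U (x i) (x j)) F ∂(piL k) ≤ 1 / 4 := by
    refine le_trans (le_of_eq (Finset.sum_congr rfl fun F _ => ind_eq hU hW h F)) h2
  linarith


/-- discrete measure on colours -/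
def nu {n N : ℕ} (f : Fin N → Fin n → ℝ) (i : Fin n) : Measure (Fin N) :=
  ∑ a, ENNReal.ofReal (f a i) • Measure.dirac a

theorem nu_prob {n N : ℕ} {f : Fin N → Fin n → ℝ} (f0 : ∀ a i, 0 ≤ f a i) (f1 : ∀ i, ∑ a, f a i = 1) (i : Fin n) :
    IsProbabilityMeasure (nu f i) := by
  constructor
  simp only [nu, Measure.coe_finset_sum, Finset.sum_apply, Measure.smul_apply, measure_univ, smul_eq_mul, mul_one]
  rw [← ENNReal.ofReal_sum_of_nonneg fun a _ => f0 a i, f1 i, ENNReal.ofReal_one]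

theorem nu_real {n N : ℕ} {f : Fin N → Fin n → ℝ} (f0 : ∀ a i, 0 ≤ f a i) (i : Fin n) (a : Fin N) :
    (nu f i).real {a} = f a i := by
  rw [Measure.real]
  simp only [nu, Measure.coe_finset_sum, Finset.sum_apply, Measure.smul_apply, smul_eq_mul]
  rw [Finset.sum_eq_single a]
  · simp [f0 a i]
  · intro b _ hb
    simp [hb]
  · simp

theorem nu_int {n N : ℕ} {f : Fin N → Fin n → ℝ} (f0 : ∀ a i, 0 ≤ f a i) (f1 : ∀ i, ∑ a, f a i = 1) (i : Fin n)
    (h : Fin N → ℝ) : ∫ a, h a ∂(nu f i) = ∑ a, f a i * h a := by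
  have := nu_prob f0 f1 i
  rw [integral_fintype Integrable.of_finite]
  simp [nu_real f0]

theorem color {n N : ℕ} [NeZero n] [NeZero N] {f : Fin N → Fin n → ℝ} (f0 : ∀ a i, 0 ≤ f a i)
    (f1 : ∀ i, ∑ a, f a i = 1) (f2 : ∀ a, ∑ i, f a i = (n:ℝ) / N)
    {e : Fin N → Fin N → Fin n → Fin n → ℝ} (e0 : ∀ a b i j, 0 ≤ e a b i j) (e1 : ∀ a b i j, e a b i j ≤ 1)
    {γ δ : ℝ} (hγ : 0 ≤ γ) (hδ : 0 < δ)
    (e2 : ∑ i, ∑ j, ∑ a, ∑ b, f a i * (f b j * e a b i j) ≤ γ * (n:ℝ) ^ 2) :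
    ∃ c : Fin n → Fin N,
      ∑ a, |((Finset.univ.filter fun i => c i = a).card / n - 1 / N : ℝ)| ≤ 4 * (N / Real.sqrt n) ∧
      ((Finset.univ.filter fun i => f (c i) i < δ).card : ℝ) ≤ 4 * (N * δ * n) ∧
      ∑ i, ∑ j, e (c i) (c j) i j ≤ 4 * (n + γ * (n:ℝ) ^ 2) := by
  have hn := npos n
  have hN := npos N
  have : ∀ i, IsProbabilityMeasure (nu f i) := nu_prob f0 f1
  set P := Measure.pi (nu f) with hP
  set Y1 : (Fin n → Fin N) → ℝ := fun c => ∑ a, |((Finset.univ.filter fun i => c i = a).card / n - 1 / N : ℝ)| with hY1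
  set Y2 : (Fin n → Fin N) → ℝ := fun c => ((Finset.univ.filter fun i => f (c i) i < δ).card : ℝ) with hY2
  set Y3 : (Fin n → Fin N) → ℝ := fun c => ∑ i, ∑ j, e (c i) (c j) i j with hY3
  have E1 : ∫ c, Y1 c ∂P ≤ N / Real.sqrt n := by
    have := count_est (nu f) (c := id) measurable_id (by intro a; simp only [Set.preimage_id, nu_real f0, f2])
    exact this
  have E2 : ∫ c, Y2 c ∂P ≤ N * δ * n := by
    have e : ∀ c, Y2 c = ∑ i, if f (c i) i < δ then (1:ℝ) else 0 := by
      intro c; simp only [hY2]; rw [Finset.card_filter]; push_cast; rfl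
    simp only [e]
    rw [integral_finsetSum _ fun i _ => Integrable.of_finite]
    calc _ ≤ ∑ i : Fin n, N * δ := by
          refine Finset.sum_le_sum fun i _ => ?_
          rw [hP, pi_one (nu f) i (h := fun a => if f a i < δ then (1:ℝ) else 0) (measurable_of_finite _), nu_int f0 f1]
          calc _ ≤ ∑ a : Fin N, δ := by
                refine Finset.sum_le_sum fun a _ => ?_
                split_ifs with h
                · linarith
                · linarith
            _ = _ := by simp
      _ = _ := by simp; ring
  have E3 : ∫ c, Y3 c ∂P ≤ n + γ * (n:ℝ) ^ 2 := by
    simp only [hY3]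
    rw [integral_finsetSum _ fun i _ => Integrable.of_finite]
    have : ∀ i j : Fin n, ∫ c, e (c i) (c j) i j ∂P ≤ (if i = j then 1 else 0) + ∑ a, ∑ b, f a i * (f b j * e a b i j) := by
      intro i j
      have nn : 0 ≤ ∑ a, ∑ b, f a i * (f b j * e a b i j) :=
        Finset.sum_nonneg fun a _ => Finset.sum_nonneg fun b _ => mul_nonneg (f0 _ _) (mul_nonneg (f0 _ _) (e0 _ _ _ _))
      by_cases hij : i = j
      · rw [if_pos hij]
        have : ∫ c, e (c i) (c j) i j ∂P ≤ ∫ c, (1:ℝ) ∂P :=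
          integral_mono Integrable.of_finite Integrable.of_finite fun c => e1 _ _ _ _
        simp at this
        linarith
      · rw [if_neg hij, zero_add]
        rw [hP, pi_two (nu f) hij (h := fun z => e z.1 z.2 i j) (measurable_of_finite _),
          integral_prod _ Integrable.of_finite, nu_int f0 f1]
        refine le_of_eq (Finset.sum_congr rfl fun a _ => ?_)
        rw [nu_int f0 f1 j (fun b => e a b i j), Finset.mul_sum]
    calc _ = ∑ i : Fin n, ∑ j : Fin n, ∫ c, e (c i) (c j) i j ∂P := by
          refine Finset.sum_congr rfl fun i _ => ?_
          rw [integral_finsetSum _ fun j _ => Integrable.of_finite]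
      _ ≤ ∑ i : Fin n, ∑ j : Fin n, ((if i = j then 1 else 0) + ∑ a, ∑ b, f a i * (f b j * e a b i j)) :=
          Finset.sum_le_sum fun i _ => Finset.sum_le_sum fun j _ => this i j
      _ = n + ∑ i, ∑ j, ∑ a, ∑ b, f a i * (f b j * e a b i j) := by
          simp [Finset.sum_add_distrib]
      _ ≤ _ := by linarith
  set A1 := N / Real.sqrt n with hA1
  set A2 := N * δ * n with hA2
  set A3 := n + γ * (n:ℝ) ^ 2 with hA3
  have p1 : 0 < A1 := by have := Real.sqrt_pos.2 hn; positivity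
  have p2 : 0 < A2 := by positivity
  have p3 : 0 < A3 := by positivity
  obtain ⟨c, hc⟩ := exists_le_integral (μ := P) (f := fun c => Y1 c / (4 * A1) + Y2 c / (4 * A2) + Y3 c / (4 * A3))
    Integrable.of_finite
  rw [integral_add Integrable.of_finite Integrable.of_finite, integral_add Integrable.of_finite Integrable.of_finite,
    integral_div, integral_div, integral_div] at hc
  have q1 : (∫ c, Y1 c ∂P) / (4 * A1) ≤ 1 / 4 := by rw [div_le_iff₀ (by positivity)]; linarith
  have q2 : (∫ c, Y2 c ∂P) / (4 * A2) ≤ 1 / 4 := by rw [div_le_iff₀ (by positivity)]; linarith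
  have q3 : (∫ c, Y3 c ∂P) / (4 * A3) ≤ 1 / 4 := by rw [div_le_iff₀ (by positivity)]; linarith
  have n1 : 0 ≤ Y1 c := Finset.sum_nonneg fun _ _ => abs_nonneg _
  have n2 : 0 ≤ Y2 c := Nat.cast_nonneg _
  have n3 : 0 ≤ Y3 c := Finset.sum_nonneg fun _ _ => Finset.sum_nonneg fun _ _ => e0 _ _ _ _
  have r1 : 0 ≤ Y1 c / (4 * A1) := by positivity
  have r2 : 0 ≤ Y2 c / (4 * A2) := by positivity
  have r3 : 0 ≤ Y3 c / (4 * A3) := by positivity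
  refine ⟨c, ?_, ?_, ?_⟩
  · have : Y1 c / (4 * A1) ≤ 1 := by linarith
    rwa [div_le_one (by positivity)] at this
  · have : Y2 c / (4 * A2) ≤ 1 := by linarith
    rwa [div_le_one (by positivity)] at this
  · have : Y3 c / (4 * A3) ≤ 1 := by linarith
    rwa [div_le_one (by positivity)] at this


def cel {n N : ℕ} [NeZero n] (b : ℝ → Fin N) (a : Fin N) (i : Fin n) (x : ℝ) : ℝ :=
  if idx n x = i ∧ b x = a then 1 else 0

def fr {n N : ℕ} [NeZero n] (b : ℝ → Fin N) (a : Fin N) (i : Fin n) : ℝ := n * ∫ x, cel b a i x ∂lam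

def er {n N : ℕ} [NeZero n] (b : ℝ → Fin N) (V : ℝ → ℝ → ℝ) (u : Fin N → Fin N → ℝ) (a a' : Fin N)
    (i j : Fin n) : ℝ :=
  (n : ℝ) ^ 2 * (∫ z, cel b a i z.1 * cel b a' j z.2 * |V z.1 z.2 - u a a'| ∂(lam.prod lam))
    / (fr b a i * fr b a' j)

section cells
variable {n N : ℕ} [NeZero n] {b : ℝ → Fin N}

theorem cel_unit (hb : Measurable b) (a : Fin N) (i : Fin n) : Unitv (cel b a i) := by
  refine ⟨?_, fun x => ?_⟩
  · exact Measurable.ite ((idx_measurable n (measurableSet_singleton i)).inter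
      (hb (measurableSet_singleton a))) measurable_const measurable_const
  · unfold cel; split_ifs <;> simp

theorem cel_nn (a : Fin N) (i : Fin n) (x : ℝ) : 0 ≤ cel b a i x := by
  unfold cel; split_ifs <;> simp

theorem cel_int (hb : Measurable b) (a : Fin N) (i : Fin n) : Integrable (cel b a i) lam := by
  refine Integrable.of_bound (cel_unit hb a i).1.aestronglyMeasurable 1 (ae_of_all _ fun x => ?_)
  have := (cel_unit hb a i).2 x
  rw [Real.norm_eq_abs, abs_of_nonneg this.1]; exact this.2

theorem cel_sum_a (i : Fin n) (x : ℝ) : ∑ a, cel b a i x = (idx n ⁻¹' {i}).indicator (fun _ => 1) x := by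
  by_cases h : idx n x = i <;> simp [cel, h]

theorem cel_sum_i (a : Fin N) (x : ℝ) : ∑ i : Fin n, cel b a i x = (b ⁻¹' {a}).indicator (fun _ => 1) x := by
  by_cases h : b x = a <;> simp [cel, h]

theorem fr_nn (a : Fin N) (i : Fin n) : 0 ≤ fr b a i :=
  mul_nonneg (Nat.cast_nonneg _) (integral_nonneg fun x => cel_nn a i x)

theorem fr_sum_a (hb : Measurable b) (i : Fin n) : ∑ a, fr b a i = 1 := by
  have hn := npos n
  simp only [fr, ← Finset.mul_sum]
  rw [← integral_finsetSum _ fun a _ => cel_int hb a i]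
  simp only [cel_sum_a]
  rw [integral_indicator_const _ (meas_fiber i), lam_fiber]
  simp [hn.ne']

theorem fr_sum_i (hb : Measurable b) (hbN : ∀ a, lam.real (b ⁻¹' {a}) = 1 / N) (a : Fin N) : ∑ i : Fin n, fr b a i = (n : ℝ) / N := by
  simp only [fr, ← Finset.mul_sum]
  rw [← integral_finsetSum _ fun i _ => cel_int hb a i]
  simp only [cel_sum_i]
  rw [integral_indicator_const _ (hb (measurableSet_singleton a)), hbN]
  simp; ring

theorem cel_prod (a a' : Fin N) (i j : Fin n) :
    ∫ z, cel b a i z.1 * cel b a' j z.2 ∂(lam.prod lam) = fr b a i * fr b a' j / (n : ℝ) ^ 2 := by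
  have hn := npos n
  rw [integral_prod_mul, fr, fr]
  field_simp

variable {V : ℝ → ℝ → ℝ} {u : Fin N → Fin N → ℝ}

theorem absnice (hV : IsGraphon V) (κ : ℝ) : Nice (fun x y => |V x y - κ|) := by
  refine ⟨(hV.1.sub_const κ).abs, 1 + |κ|, fun x y => ?_⟩
  have := hV.2.2 x y
  rw [abs_abs]
  refine (abs_sub _ _).trans ?_
  rw [abs_of_nonneg this.1]; linarith [this.2]

theorem subnice (hV : IsGraphon V) (κ : ℝ) : Nice (fun x y => V x y - κ) := by
  refine ⟨(hV.1.sub_const κ), 1 + |κ|, fun x y => ?_⟩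
  have := hV.2.2 x y
  refine (abs_sub _ _).trans ?_
  rw [abs_of_nonneg this.1]; linarith [this.2]

theorem E_nn (κ : ℝ) (a a' : Fin N) (i j : Fin n) :
    0 ≤ ∫ z, cel b a i z.1 * cel b a' j z.2 * |V z.1 z.2 - κ| ∂(lam.prod lam) :=
  integral_nonneg fun z => mul_nonneg (mul_nonneg (cel_nn _ _ _) (cel_nn _ _ _)) (abs_nonneg _)

theorem er_nn (a a' : Fin N) (i j : Fin n) : 0 ≤ er b V u a a' i j :=
  div_nonneg (mul_nonneg (by positivity) (E_nn _ _ _ _ _)) (mul_nonneg (fr_nn _ _) (fr_nn _ _))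

theorem er_le (hb : Measurable b) (hV : IsGraphon V) (hu : ∀ a b, u a b ∈ Set.Icc (0:ℝ) 1) (a a' : Fin N) (i j : Fin n) : er b V u a a' i j ≤ 1 := by
  have hn := npos n
  refine div_le_one_of_le₀ ?_ (mul_nonneg (fr_nn _ _) (fr_nn _ _))
  have h : ∫ z, cel b a i z.1 * cel b a' j z.2 * |V z.1 z.2 - u a a'| ∂(lam.prod lam)
      ≤ ∫ z, cel b a i z.1 * cel b a' j z.2 ∂(lam.prod lam) := by
    refine integral_mono ((absnice hV _).integrable_test (cel_unit hb a i) (cel_unit hb a' j) _)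
      (((cel_unit hb a i).nice_mul (cel_unit hb a' j)).integrable _) fun z => ?_
    refine mul_le_of_le_one_right (mul_nonneg (cel_nn _ _ _) (cel_nn _ _ _)) ?_
    have h1 := hV.2.2 z.1 z.2
    have h2 := hu a a'
    rw [abs_le]; constructor <;> linarith [h1.1, h1.2, h2.1, h2.2]
  rw [cel_prod, le_div_iff₀ (by positivity)] at h
  linarith

theorem er_sum (hb : Measurable b) (hV : IsGraphon V) {γ : ℝ} (h : ∫ z, |V z.1 z.2 - u (b z.1) (b z.2)| ∂(lam.prod lam) ≤ γ) :
    ∑ i : Fin n, ∑ j : Fin n, ∑ a, ∑ a', fr b a i * (fr b a' j * er b V u a a' i j) ≤ γ * (n : ℝ) ^ 2 := by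
  have hn := npos n
  have h1 : ∀ (i j : Fin n) (a a' : Fin N), fr b a i * (fr b a' j * er b V u a a' i j) ≤
      (n : ℝ) ^ 2 * (∫ z, cel b a i z.1 * cel b a' j z.2 * |V z.1 z.2 - u a a'| ∂(lam.prod lam)) := by
    intro i j a a'
    have h0 : 0 ≤ (n : ℝ) ^ 2 * (∫ z, cel b a i z.1 * cel b a' j z.2 * |V z.1 z.2 - u a a'| ∂(lam.prod lam)) :=
      mul_nonneg (by positivity) (E_nn _ _ _ _ _)
    rw [← mul_assoc]
    by_cases hf : fr b a i * fr b a' j = 0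
    · rw [hf, zero_mul]; exact h0
    · rw [er, mul_div_cancel₀ _ hf]
  have h2 : ∑ i : Fin n, ∑ j : Fin n, ∑ a, ∑ a',
      (∫ z, cel b a i z.1 * cel b a' j z.2 * |V z.1 z.2 - u a a'| ∂(lam.prod lam)) =
      ∫ z, |V z.1 z.2 - u (b z.1) (b z.2)| ∂(lam.prod lam) := by
    have hi : ∀ (i j : Fin n) (a a' : Fin N), Integrable
        (fun z : ℝ × ℝ => cel b a i z.1 * cel b a' j z.2 * |V z.1 z.2 - u a a'|) (lam.prod lam) :=
      fun i j a a' => (absnice hV _).integrable_test (cel_unit hb a i) (cel_unit hb a' j) _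
    have e : ∀ z : ℝ × ℝ, |V z.1 z.2 - u (b z.1) (b z.2)| = ∑ i : Fin n, ∑ j : Fin n, ∑ a, ∑ a',
        cel b a i z.1 * cel b a' j z.2 * |V z.1 z.2 - u a a'| := by
      intro z
      rw [Finset.sum_eq_single (idx n z.1), Finset.sum_eq_single (idx n z.2),
        Finset.sum_eq_single (b z.1), Finset.sum_eq_single (b z.2)]
      · simp [cel]
      · intro a' _ h; simp [cel, h.symm]
      · simp
      · intro a' _ h; simp [cel, h.symm]
      · simp
      · intro a' _ h; simp [cel, h.symm]
      · simp
      · intro a' _ h; simp [cel, h.symm]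
      · simp
    simp only [e]
    rw [integral_finsetSum _ fun i _ => integrable_finsetSum _ fun j _ => integrable_finsetSum _ fun a _ =>
      integrable_finsetSum _ fun a' _ => hi i j a a']
    refine Finset.sum_congr rfl fun i _ => ?_
    rw [integral_finsetSum _ fun j _ => integrable_finsetSum _ fun a _ =>
      integrable_finsetSum _ fun a' _ => hi i j a a']
    refine Finset.sum_congr rfl fun j _ => ?_
    rw [integral_finsetSum _ fun a _ => integrable_finsetSum _ fun a' _ => hi i j a a']
    refine Finset.sum_congr rfl fun a _ => ?_
    rw [integral_finsetSum _ fun a' _ => hi i j a a']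
  calc _ ≤ ∑ i : Fin n, ∑ j : Fin n, ∑ a, ∑ a', (n : ℝ) ^ 2 *
      (∫ z, cel b a i z.1 * cel b a' j z.2 * |V z.1 z.2 - u a a'| ∂(lam.prod lam)) := by
        exact Finset.sum_le_sum fun i _ => Finset.sum_le_sum fun j _ => Finset.sum_le_sum fun a _ =>
          Finset.sum_le_sum fun a' _ => h1 i j a a'
    _ = (n : ℝ) ^ 2 * ∫ z, |V z.1 z.2 - u (b z.1) (b z.2)| ∂(lam.prod lam) := by
        rw [← h2]; simp only [Finset.mul_sum]
    _ ≤ _ := by rw [mul_comm]; gcongr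

theorem g_unit (hb : Measurable b) {s : Fin n → ℝ} {δ : ℝ} (hδ : 0 < δ) (a : Fin N) (hs : ∀ i, s i ∈ Set.Icc (0:ℝ) 1)
    (hsf : ∀ i, s i ≠ 0 → δ ≤ fr b a i) :
    Unitv (fun x => ∑ i, s i * δ / fr b a i * cel b a i x) := by
  have hc : ∀ i, 0 ≤ s i * δ / fr b a i ∧ s i * δ / fr b a i ≤ 1 := by
    intro i
    refine ⟨div_nonneg (mul_nonneg (hs i).1 hδ.le) (fr_nn _ _), ?_⟩
    refine div_le_one_of_le₀ ?_ (fr_nn _ _)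
    by_cases h : s i = 0
    · rw [h, zero_mul]; exact fr_nn _ _
    · have := hsf i h
      nlinarith [(hs i).2]
  refine ⟨Finset.measurable_sum _ fun i _ => (cel_unit hb a i).1.const_mul _, fun x => ⟨?_, ?_⟩⟩
  · exact Finset.sum_nonneg fun i _ => mul_nonneg (hc i).1 (cel_nn _ _ _)
  · calc _ ≤ ∑ i : Fin n, cel b a i x :=
        Finset.sum_le_sum fun i _ => mul_le_of_le_one_left (cel_nn _ _ _) (hc i).2
      _ ≤ 1 := by rw [cel_sum_i]; by_cases h : x ∈ b ⁻¹' {a} <;> simp [h]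

theorem block (hb : Measurable b) (hV : IsGraphon V) {M : Fin n → Fin n → ℝ} {ε δ : ℝ} (hδ : 0 < δ)
    (hc : cutLE (fun x y => stepK M x y - V x y) ε) {s t : Fin n → ℝ} (a a' : Fin N)
    (hs : ∀ i, s i ∈ Set.Icc (0:ℝ) 1) (hsf : ∀ i, s i ≠ 0 → δ ≤ fr b a i)
    (ht : ∀ i, t i ∈ Set.Icc (0:ℝ) 1) (htf : ∀ i, t i ≠ 0 → δ ≤ fr b a' i) :
    |∑ i, ∑ j, s i * t j * (M i j - u a a')| ≤
      ε / δ ^ 2 * (n : ℝ) ^ 2 + ∑ i, ∑ j, s i * t j * er b V u a a' i j := by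
  have hn := npos n
  set κ := u a a' with hκ
  have hD : Nice (fun x y => stepK M x y - V x y) := (stepK_nice M).sub hV.nice
  set A : Fin n → Fin n → ℝ := fun i j => ∫ z, cel b a i z.1 * cel b a' j z.2 *
    (stepK M z.1 z.2 - V z.1 z.2) ∂(lam.prod lam) with hA
  set B : Fin n → Fin n → ℝ := fun i j => ∫ z, cel b a i z.1 * cel b a' j z.2 *
    (V z.1 z.2 - κ) ∂(lam.prod lam) with hB
  have hAB : ∀ i j, A i j + B i j = (M i j - κ) * (fr b a i * fr b a' j / (n : ℝ) ^ 2) := by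
    intro i j
    rw [hA, hB, ← integral_add (hD.integrable_test (cel_unit hb a i) (cel_unit hb a' j) _)
      ((subnice hV κ).integrable_test (cel_unit hb a i) (cel_unit hb a' j) _), ← cel_prod,
      ← integral_const_mul]
    congr 1; funext z
    unfold cel stepK
    split_ifs with h1 h2
    · rw [h1.1, h2.1]; ring
    all_goals ring
  have hBle : ∀ i j, |B i j| ≤ ∫ z, cel b a i z.1 * cel b a' j z.2 * |V z.1 z.2 - κ| ∂(lam.prod lam) := by
    intro i j
    refine abs_integral_le_integral_abs.trans (le_of_eq ?_)
    congr 1; funext z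
    rw [abs_mul, abs_of_nonneg (mul_nonneg (cel_nn _ _ _) (cel_nn _ _ _))]
  have hcut := hc _ _ (g_unit hb hδ a hs hsf) (g_unit hb hδ a' ht htf)
  have hexp : ∫ z, (∑ i, s i * δ / fr b a i * cel b a i z.1) * (∑ j, t j * δ / fr b a' j * cel b a' j z.2) *
      (stepK M z.1 z.2 - V z.1 z.2) ∂(lam.prod lam) =
      ∑ i, ∑ j, s i * δ / fr b a i * (t j * δ / fr b a' j) * A i j := by
    have e : ∀ z : ℝ × ℝ, (∑ i, s i * δ / fr b a i * cel b a i z.1) * (∑ j, t j * δ / fr b a' j * cel b a' j z.2) *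
      (stepK M z.1 z.2 - V z.1 z.2) = ∑ i, ∑ j, s i * δ / fr b a i * (t j * δ / fr b a' j) *
        (cel b a i z.1 * cel b a' j z.2 * (stepK M z.1 z.2 - V z.1 z.2)) := by
      intro z
      rw [Finset.sum_mul_sum, Finset.sum_mul]
      refine Finset.sum_congr rfl fun i _ => ?_
      rw [Finset.sum_mul]
      refine Finset.sum_congr rfl fun j _ => ?_
      ring
    simp only [e]
    have hi : ∀ i j : Fin n, Integrable (fun z : ℝ × ℝ => s i * δ / fr b a i * (t j * δ / fr b a' j) *
        (cel b a i z.1 * cel b a' j z.2 * (stepK M z.1 z.2 - V z.1 z.2))) (lam.prod lam) :=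
      fun i j => (hD.integrable_test (cel_unit hb a i) (cel_unit hb a' j) _).const_mul _
    rw [integral_finsetSum _ fun i _ => integrable_finsetSum _ fun j _ => hi i j]
    refine Finset.sum_congr rfl fun i _ => ?_
    rw [integral_finsetSum _ fun j _ => hi i j]
    refine Finset.sum_congr rfl fun j _ => ?_
    rw [integral_const_mul]
  rw [hexp] at hcut
  have hterm : ∀ i j, s i * t j * (M i j - κ) = (n : ℝ) ^ 2 / δ ^ 2 *
      (s i * δ / fr b a i * (t j * δ / fr b a' j) * A i j) +
      s i * t j * ((n : ℝ) ^ 2 * B i j / (fr b a i * fr b a' j)) := by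
    intro i j
    by_cases h1 : s i = 0
    · simp [h1]
    by_cases h2 : t j = 0
    · simp [h2]
    have f1 := (hδ.trans_le (hsf i h1)).ne'
    have f2 := (hδ.trans_le (htf j h2)).ne'
    have h3 : M i j - κ = (A i j + B i j) * (n : ℝ) ^ 2 / (fr b a i * fr b a' j) := by
      rw [hAB]; field_simp
    rw [h3]; field_simp
  simp only [hterm, Finset.sum_add_distrib, ← Finset.mul_sum]
  refine (abs_add_le _ _).trans (add_le_add ?_ ?_)
  · rw [abs_mul, abs_of_nonneg (by positivity)]
    calc _ ≤ (n : ℝ) ^ 2 / δ ^ 2 * ε := by gcongr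
      _ = _ := by ring
  · refine (Finset.abs_sum_le_sum_abs _ _).trans (Finset.sum_le_sum fun i _ => ?_)
    refine (Finset.abs_sum_le_sum_abs _ _).trans (Finset.sum_le_sum fun j _ => ?_)
    rw [abs_mul, abs_of_nonneg (mul_nonneg (hs i).1 (ht j).1)]
    refine mul_le_mul_of_nonneg_left ?_ (mul_nonneg (hs i).1 (ht j).1)
    have hf := mul_nonneg (fr_nn (b := b) a i) (fr_nn (b := b) a' j)
    rw [abs_div, abs_of_nonneg hf, er, abs_mul, abs_of_nonneg (by positivity : (0:ℝ) ≤ (n:ℝ)^2)]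
    gcongr
    exact hBle i j

end cells

theorem sum_color {n N : ℕ} (c : Fin n → Fin N) (F : Fin N → Fin N → Fin n → Fin n → ℝ) (p t : Fin n → ℝ) :
    ∑ a, ∑ a', ∑ i, ∑ j, (if c i = a then p i else 0) * (if c j = a' then t j else 0) * F a a' i j
      = ∑ i, ∑ j, p i * t j * F (c i) (c j) i j := by
  have h1 : ∀ a, ∑ a', ∑ i, ∑ j, (if c i = a then p i else 0) * (if c j = a' then t j else 0) * F a a' i j
      = ∑ i, ∑ j, (if c i = a then p i else 0) * t j * F a (c j) i j := by
    intro a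
    rw [Finset.sum_comm]
    refine Finset.sum_congr rfl fun i _ => ?_
    rw [Finset.sum_comm]
    refine Finset.sum_congr rfl fun j _ => ?_
    rw [Finset.sum_eq_single (c j)]
    · simp
    · intro a' _ h; simp [h.symm]
    · simp
  simp only [h1]
  rw [Finset.sum_comm]
  refine Finset.sum_congr rfl fun i _ => ?_
  rw [Finset.sum_comm]
  refine Finset.sum_congr rfl fun j _ => ?_
  rw [Finset.sum_eq_single (c i)]
  · simp
  · intro a' _ h; simp [h.symm]
  · simp

theorem colored {n N : ℕ} [NeZero n] {b : ℝ → Fin N} (hb : Measurable b)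
    {V : ℝ → ℝ → ℝ} (hV : IsGraphon V) {u r : Fin N → Fin N → ℝ} (hu : ∀ a b, u a b ∈ Set.Icc (0:ℝ) 1)
    (hr : ∀ a b, r a b ∈ Set.Icc (0:ℝ) 1)
    {M : Fin n → Fin n → ℝ} (hM : ∀ i j, M i j ∈ Set.Icc (0:ℝ) 1) {ε δ : ℝ} (hε : 0 ≤ ε) (hδ : 0 < δ)
    (hc : cutLE (fun x y => stepK M x y - V x y) ε) (c : Fin n → Fin N) {β ζ : ℝ}
    (h1 : ((Finset.univ.filter fun i => fr b (c i) i < δ).card : ℝ) ≤ β * n)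
    (h2 : ∑ i, ∑ j, er b V u (c i) (c j) i j ≤ ζ * (n : ℝ) ^ 2) :
    matLE (fun i j => (M i j - u (c i) (c j)) * r (c i) (c j)) (N ^ 2 * (ε / δ ^ 2) + ζ + 2 * β) := by
  intro f g hf hg
  set ch : Fin n → ℝ := fun i => if fr b (c i) i < δ then 1 else 0 with hch
  have hch01 : ∀ i, ch i = 0 ∨ ch i = 1 := fun i => by simp only [hch]; split_ifs <;> simp
  have hchs : ∑ i, ch i ≤ β * n := by
    simpa [hch, Finset.sum_boole] using h1
  set p : Fin n → ℝ := fun i => if fr b (c i) i < δ then 0 else f i with hp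
  set t : Fin n → ℝ := fun i => if fr b (c i) i < δ then 0 else g i with ht
  have hp01 : ∀ i, p i ∈ Set.Icc (0:ℝ) 1 := fun i => by
    simp only [hp]; split_ifs; · simp
    exact hf i
  have ht01 : ∀ i, t i ∈ Set.Icc (0:ℝ) 1 := fun i => by
    simp only [ht]; split_ifs; · simp
    exact hg i
  have hd : ∀ i j, |f i * g j - p i * t j| ≤ ch i + ch j := by
    intro i j
    have a1 := hf i
    have a2 := hg j
    have h0 : 0 ≤ f i * g j := mul_nonneg a1.1 a2.1
    have h1 : f i * g j ≤ 1 := mul_le_one₀ a1.2 a2.1 a2.2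
    simp only [hp, ht, hch]
    split_ifs <;> simp [abs_of_nonneg h0] <;> linarith
  have hMu : ∀ i j, |(M i j - u (c i) (c j)) * r (c i) (c j)| ≤ 1 := by
    intro i j
    have m := hM i j
    have k := hu (c i) (c j)
    have q := hr (c i) (c j)
    rw [abs_mul, abs_of_nonneg q.1]
    refine mul_le_one₀ ?_ q.1 q.2
    rw [abs_le]; constructor <;> linarith [m.1, m.2, k.1, k.2]
  have e1 : ∑ i, ∑ j, f i * g j * ((M i j - u (c i) (c j)) * r (c i) (c j)) =
      ∑ i, ∑ j, (f i * g j - p i * t j) * ((M i j - u (c i) (c j)) * r (c i) (c j)) +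
      ∑ i, ∑ j, p i * t j * ((M i j - u (c i) (c j)) * r (c i) (c j)) := by
    simp only [← Finset.sum_add_distrib]
    refine Finset.sum_congr rfl fun i _ => Finset.sum_congr rfl fun j _ => by ring
  have b1 : |∑ i, ∑ j, (f i * g j - p i * t j) * ((M i j - u (c i) (c j)) * r (c i) (c j))| ≤
      2 * β * (n : ℝ) ^ 2 := by
    calc _ ≤ ∑ i, ∑ j, (ch i + ch j) := by
          refine (Finset.abs_sum_le_sum_abs _ _).trans (Finset.sum_le_sum fun i _ => ?_)
          refine (Finset.abs_sum_le_sum_abs _ _).trans (Finset.sum_le_sum fun j _ => ?_)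
          rw [abs_mul]
          have := mul_le_mul (hd i j) (hMu i j) (abs_nonneg _) ((abs_nonneg _).trans (hd i j))
          linarith
      _ = 2 * n * ∑ i, ch i := by
          simp only [Finset.sum_add_distrib, Finset.sum_const, Finset.card_univ, Fintype.card_fin,
            nsmul_eq_mul, ← Finset.mul_sum]
          ring
      _ ≤ 2 * n * (β * n) := by gcongr
      _ = _ := by ring
  have b2 : |∑ i, ∑ j, p i * t j * ((M i j - u (c i) (c j)) * r (c i) (c j))| ≤
      N ^ 2 * (ε / δ ^ 2) * (n : ℝ) ^ 2 + ζ * (n : ℝ) ^ 2 := by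
    rw [← sum_color c (fun a a' i j => (M i j - u a a') * r a a') p t]
    have hk : ∀ (q : Fin n → ℝ), (∀ i, q i ∈ Set.Icc (0:ℝ) 1) → ∀ a i, (if c i = a then q i else 0) ∈ Set.Icc (0:ℝ) 1 := by
      intro q hq a i; split_ifs; · exact hq i
      simp
    have hpf : ∀ (a : Fin N) i, (if c i = a then p i else 0) ≠ 0 → δ ≤ fr b a i := by
      intro a i h
      by_contra h'
      push Not at h'
      apply h
      by_cases h3 : c i = a
      · subst h3; simp [hp, h']
      · simp [h3]
    have htf : ∀ (a : Fin N) i, (if c i = a then t i else 0) ≠ 0 → δ ≤ fr b a i := by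
      intro a i h
      by_contra h'
      push Not at h'
      apply h
      by_cases h3 : c i = a
      · subst h3; simp [ht, h']
      · simp [h3]
    calc _ ≤ ∑ a, ∑ a', (ε / δ ^ 2 * (n : ℝ) ^ 2 + ∑ i, ∑ j, (if c i = a then p i else 0) *
          (if c j = a' then t j else 0) * er b V u a a' i j) := by
          refine (Finset.abs_sum_le_sum_abs _ _).trans (Finset.sum_le_sum fun a _ => ?_)
          refine (Finset.abs_sum_le_sum_abs _ _).trans (Finset.sum_le_sum fun a' _ => ?_)
          have := block hb hV (u := u) hδ hc a a' (hk p hp01 a) (hpf a) (hk t ht01 a') (htf a')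
          refine le_trans ?_ this
          have q := hr a a'
          have e : ∑ i, ∑ j, (if c i = a then p i else 0) * (if c j = a' then t j else 0) *
              ((M i j - u a a') * r a a') = (∑ i, ∑ j, (if c i = a then p i else 0) *
              (if c j = a' then t j else 0) * (M i j - u a a')) * r a a' := by
            simp only [Finset.sum_mul]
            refine Finset.sum_congr rfl fun i _ => Finset.sum_congr rfl fun j _ => by ring
          rw [e, abs_mul, abs_of_nonneg q.1]
          exact mul_le_of_le_one_right (abs_nonneg _) q.2
      _ = N ^ 2 * (ε / δ ^ 2) * (n : ℝ) ^ 2 + ∑ i, ∑ j, p i * t j * er b V u (c i) (c j) i j := by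
          simp only [Finset.sum_add_distrib, sum_color c (fun a a' i j => er b V u a a' i j) p t,
            Finset.sum_const, Finset.card_univ, Fintype.card_fin, nsmul_eq_mul]
          ring
      _ ≤ _ := by
          gcongr
          refine le_trans (Finset.sum_le_sum fun i _ => Finset.sum_le_sum fun j _ => ?_) h2
          exact mul_le_of_le_one_left (er_nn _ _ _ _)
            (mul_le_one₀ (hp01 i).2 (ht01 j).1 (ht01 j).2)
  simp only [e1]
  refine (abs_add_le _ _).trans ?_
  linarith

theorem propB {U W : ℝ → ℝ → ℝ} (hU : IsGraphon U) (hW : IsGraphon W)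
    (hUW : ∀ᵐ z ∂(lam.prod lam), U z.1 z.2 ≤ W z.1 z.2) {ε : ℝ} (hε : 0 < ε) :
    ∃ ε' > 0, ∃ m : ℕ, ∀ n [NeZero n], m ≤ n → ∀ H : SimpleGraph (Fin n),
      (∃ φ, near (graphonOf H) U φ ε') → ∃ G, H ≤ G ∧ ∃ ψ, near (graphonOf G) W ψ ε := by
  have hγ : 0 < ε / 64 := by positivity
  obtain ⟨N1, hN1⟩ := step_density hU hγ
  obtain ⟨N2, hN2⟩ := step_density hW hγ
  obtain ⟨N, hNz, hNN⟩ : ∃ N, ∃ _ : NeZero N, N1 + N2 ≤ N := ⟨N1 + N2 + 1, ⟨by omega⟩, by omega⟩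
  obtain ⟨u, hu, hu1⟩ := hN1 N (by omega)
  obtain ⟨w0, hw0, hw1⟩ := hN2 N (by omega)
  have hNp := npos N
  set w : Fin N → Fin N → ℝ := fun a a' => max (u a a') (w0 a a') with hw
  have hw01 : ∀ a a', w a a' ∈ Set.Icc (0:ℝ) 1 := fun a a' =>
    ⟨(hu.2 a a').1.trans (le_max_left _ _), max_le (hu.2 a a').2 (hw0.2 a a').2⟩
  have huw : ∀ a a', u a a' ≤ w a a' := fun a a' => le_max_left _ _
  have hws : ∀ a a', w a a' = w a' a := fun a a' => by simp only [hw]; rw [hu.1 a a', hw0.1 a a']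
  have hwI : ∫ z, |W z.1 z.2 - stepK w z.1 z.2| ∂(lam.prod lam) ≤ 2 * (ε / 64) := by
    have iU := (hU.nice.sub (stepK_nice u)).integrable (lam.prod lam)
    have iW := (hW.nice.sub (stepK_nice w0)).integrable (lam.prod lam)
    have iw := (hW.nice.sub (stepK_nice w)).integrable (lam.prod lam)
    calc _ ≤ ∫ z, (|U z.1 z.2 - stepK u z.1 z.2| + |W z.1 z.2 - stepK w0 z.1 z.2|) ∂(lam.prod lam) := by
          refine integral_mono_ae iw.abs (iU.abs.add iW.abs) ?_
          filter_upwards [hUW] with z hz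
          have e : stepK w z.1 z.2 = max (stepK u z.1 z.2) (stepK w0 z.1 z.2) := rfl
          simp only [e]
          have a1 := abs_le.1 (le_refl |U z.1 z.2 - stepK u z.1 z.2|)
          have a2 := abs_le.1 (le_refl |W z.1 z.2 - stepK w0 z.1 z.2|)
          have a3 := abs_nonneg (U z.1 z.2 - stepK u z.1 z.2)
          have a4 := abs_nonneg (W z.1 z.2 - stepK w0 z.1 z.2)
          rcases max_choice (stepK u z.1 z.2) (stepK w0 z.1 z.2) with h | h
          · have h' := max_eq_left_iff.1 h
            rw [h, abs_le]; constructor <;> linarith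
          · rw [h]; linarith
      _ ≤ _ := by rw [integral_add iU.abs iW.abs]; linarith
  set q : Fin N → Fin N → ℝ := fun a a' => (w a a' - u a a') / (1 - u a a') with hq
  have hq01 : ∀ a a', q a a' ∈ Set.Icc (0:ℝ) 1 := fun a a' => by
    have k1 := (hu.2 a a').2
    have k2 := (hw01 a a').2
    have k3 := huw a a'
    exact ⟨div_nonneg (by linarith) (by linarith), div_le_one_of_le₀ (by linarith) (by linarith)⟩
  have hqs : ∀ a a', q a a' = q a' a := fun a a' => by simp only [hq]; rw [hu.1 a a', hws a a']
  have hqw : ∀ a a', u a a' + (1 - u a a') * q a a' = w a a' := by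
    intro a a'
    by_cases h : 1 - u a a' = 0
    · have k2 := (hw01 a a').2
      have k3 := huw a a'
      rw [h]; linarith
    · simp only [hq]; rw [mul_div_cancel₀ _ h]; ring
  obtain ⟨δ, hδdef⟩ : ∃ δ, δ = ε / (64 * N) := ⟨_, rfl⟩
  have hδ : 0 < δ := by rw [hδdef]; positivity
  obtain ⟨k0, hk0⟩ := rounding (ε / 8) (by positivity)
  refine ⟨ε * δ ^ 2 / (8 * N ^ 2), by positivity,
    max k0 (max ⌈64 / ε⌉₊ ⌈(128 * (N:ℝ) ^ 2 / ε) ^ 2⌉₊), ?_⟩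
  intro n hnz hn H ⟨φ, hφ⟩
  have hnp := npos n
  have hn1 : k0 ≤ n := (le_max_left _ _).trans hn
  have hn2 : 64 / ε ≤ n := Nat.ceil_le.1 (((le_max_left _ _).trans (le_max_right _ _)).trans hn)
  have hn3 : (128 * (N:ℝ) ^ 2 / ε) ^ 2 ≤ n :=
    Nat.ceil_le.1 (((le_max_right _ _).trans (le_max_right _ _)).trans hn)
  have hφ' : near (stepK (adjM H)) U φ (ε * δ ^ 2 / (8 * N ^ 2)) :=
    near_congr_left (graphonOf_graphon H).nice (stepK_nice _) hU.nice
      (by filter_upwards [graphonOf_ae H] with z hz using hz.symm) hφ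
  set b : ℝ → Fin N := fun x => idx N (φ.toFun x) with hbdef
  have hb : Measurable b := (idx_measurable N).comp φ.measurePreserving.measurable
  have hbN : ∀ a, lam.real (b ⁻¹' {a}) = 1 / N := by
    intro a
    have := φ.measurePreserving.measureReal_preimage (meas_fiber a).nullMeasurableSet
    exact this.trans (lam_fiber a)
  have hV := hU.pull φ
  have hVI : ∫ z, |pull U φ z.1 z.2 - u (b z.1) (b z.2)| ∂(lam.prod lam) ≤ ε / 64 := by
    have := φ.integral_comp (F := fun z => |U z.1 z.2 - stepK u z.1 z.2|)
      (hU.1.sub (stepK_nice u).1).abs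
    exact (le_of_eq this).trans hu1
  obtain ⟨c, hc1, hc2, hc3⟩ := color (f := fr (n := n) b) (e := er (n := n) b (pull U φ) u) (γ := ε / 64) (δ := δ)
    fr_nn (fr_sum_a hb) (fr_sum_i hb hbN) er_nn (er_le hb hV hu.2) hγ.le hδ (er_sum hb hV hVI)
  have hcol := colored hb hV hu.2 (r := fun a a' => 1 - q a a')
    (fun a a' => ⟨by linarith [(hq01 a a').2], by linarith [(hq01 a a').1]⟩) (adjM_mem H)
    (by positivity) hδ hφ' c (β := 4 * (N * δ)) (ζ := 4 * (1 / n) + 4 * (ε / 64))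
    (by linarith) (by
      refine hc3.trans (le_of_eq ?_)
      field_simp)
  set K : Fin n → Fin n → ℝ := fun i j => adjM H i j + (1 - adjM H i j) * q (c i) (c j) with hK
  have hKs : Symm01 K := by
    refine ⟨fun i j => ?_, fun i j => ?_⟩
    · have hs : adjM H i j = adjM H j i := by
        by_cases h : H.Adj i j
        · simp [adjM, h, h.symm]
        · have h' : ¬ H.Adj j i := fun h' => h h'.symm
          simp [adjM, h, h']
      simp only [hK]; rw [hs, hqs (c i) (c j)]
    · have a1 := adjM_mem H i j
      have a2 := hq01 (c i) (c j)
      refine ⟨add_nonneg a1.1 (mul_nonneg (by linarith [a1.2]) a2.1), ?_⟩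
      simp only [hK]
      nlinarith [a1.1, a1.2, a2.1, a2.2]
  obtain ⟨G, hG1, hG2⟩ := hk0 n hn1 K hKs
  refine ⟨G, ?_, ?_⟩
  · intro i j hij
    exact hG1 i j hij.ne (by simp [hK, adjM, hij])
  have hG3 : matLE (fun i j => adjM G i j - w (c i) (c j)) (ε / 8 +
      (N ^ 2 * (ε * δ ^ 2 / (8 * N ^ 2) / δ ^ 2) + (4 * (1 / n) + 4 * (ε / 64)) + 2 * (4 * (N * δ)))) := by
    have := hG2.add hcol
    have e : (fun i j => adjM G i j - K i j + (adjM H i j - u (c i) (c j)) * (1 - q (c i) (c j)))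
        = (fun i j => adjM G i j - w (c i) (c j)) := by
      funext i j
      rw [← hqw (c i) (c j)]
      simp only [hK]; ring
    rwa [e] at this
  obtain ⟨ψ, hψ⟩ := finish hW.nice hw01 hG3 hc1 hwI
  refine ⟨ψ, hψ.mono ?_⟩
  have s1 : (N:ℝ) ^ 2 * (ε * δ ^ 2 / (8 * N ^ 2) / δ ^ 2) = ε / 8 := by field_simp
  have s2 : (N:ℝ) * δ = ε / 64 := by rw [hδdef]; field_simp
  have s3 : (1:ℝ) / n ≤ ε / 64 := by
    rw [div_le_iff₀ hε] at hn2
    rw [div_le_div_iff₀ hnp (by norm_num)]; linarith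
  have s4 : 4 * (N:ℝ) * (4 * (N / √n)) ≤ ε / 8 := by
    have h1 : 128 * (N:ℝ) ^ 2 / ε ≤ √n := Real.le_sqrt_of_sq_le hn3
    have h2 : 0 < √(n:ℝ) := Real.sqrt_pos.2 hnp
    rw [div_le_iff₀ hε] at h1
    have : 4 * (N:ℝ) * (4 * (N / √n)) = 16 * (N:ℝ)^2 / √n := by ring
    rw [this, div_le_div_iff₀ h2 (by norm_num)]; linarith
  rw [s1, s2]
  linarith

theorem superset_dir (P : GraphProp) : upR (closureP P) ⊆ closureP (upP P) := by
  rintro W ⟨hW, U, ⟨hU, n, H, hH, hn, ht⟩, U', W', hU', hW', hUU, hWW, hle⟩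
  have hmin : ∀ m, ∃ G : SimpleGraph (Fin (n m)), H m ≤ G ∧ ∀ G', H m ≤ G' →
      deltaCut (graphonOf G) W ≤ deltaCut (graphonOf G') W := by
    intro m
    obtain ⟨G, hG, hG'⟩ := Set.exists_min_image {G : SimpleGraph (Fin (n m)) | H m ≤ G}
      (fun G => deltaCut (graphonOf G) W) (Set.toFinite _) ⟨H m, by simp⟩
    exact ⟨G, hG, fun G' h => hG' G' h⟩
  choose G hG1 hG2 using hmin
  refine ⟨hW, n, G, fun m => ⟨H m, hH m, hG1 m⟩, hn, ?_⟩
  rw [Metric.tendsto_nhds]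
  intro ε hε
  obtain ⟨ε', hε', m0, hB⟩ := propB hU' hW' (ae_of_aeLE hle) (half_pos (half_pos hε))
  filter_upwards [ht.eventually (gt_mem_nhds (half_pos hε')), hn.eventually_ge_atTop (m0 + 1)] with m h1 h2
  have : NeZero (n m) := ⟨by omega⟩
  obtain ⟨φ, hφ⟩ := exists_near (graphonOf_graphon _).nice hU.nice h1
  obtain ⟨φ', hφ'⟩ := near_of_iso hU hU' hUU (half_pos hε')
  have h3 := hφ.tri (graphonOf_graphon _).nice hU.nice hU'.nice hφ'
  obtain ⟨G', hG', ψ, hψ⟩ := hB (n m) (by omega) (H m) ⟨_, h3.mono (by linarith)⟩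
  obtain ⟨ψ', hψ'⟩ := near_of_iso hW hW' hWW (half_pos (half_pos hε))
  have h4 := hψ.tri (graphonOf_graphon _).nice hW'.nice hW.nice (hψ'.symm hW.nice hW'.nice)
  have h5 := (hG2 m G' hG').trans (deltaCut_le (graphonOf_graphon _).nice hW.nice h4)
  rw [Real.dist_eq, sub_zero, abs_of_nonneg (deltaCut_nonneg _ _)]
  linarith


theorem closure_upward_comm (P : GraphProp) (hP : IsGraphProperty P) :
    closureP (upP P) = upR (closureP P) := by
  exact Set.Subset.antisymm (subset_dir P) (superset_dir P)

end
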